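/- (Zudilin) At least one of the four numbers ζ(5), ζ(7), ζ(9), ζ(11) is irrational. -/

import Mathlib

/-- The values of the Riemann zeta function at integers `s ≥ 2`,
as a real number: `ζ(s) = ∑_{n ≥ 1} n^{-s}`. -/
noncomputable def zetaR (s : ℕ) : ℝ := ∑' n : ℕ, 1 / (n + 1 : ℝ) ^ s

section
open Real Set Filter Topology MeasureTheory

/-- Fejér kernel. -/
noncomputable def fejer (v : ℝ) : ℝ := (1 - cos v) / v ^ 2

lemma fejer_nonneg (v : ℝ) : 0 ≤ fejer v :=
  div_nonneg (by linarith [cos_le_one v]) (sq_nonneg v)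

lemma fejer_le_one (v : ℝ) : fejer v ≤ 1 := by
  unfold fejer
  apply div_le_one_of_le₀ _ (sq_nonneg v)
  nlinarith [one_sub_sq_div_two_le_cos (x := v), sq_nonneg v]

lemma fejer_le (v : ℝ) : fejer v ≤ 4 * (1 + v ^ 2)⁻¹ := by
  rcases le_total (v ^ 2) 1 with h | h
  · refine (fejer_le_one v).trans ?_
    rw [← div_eq_mul_inv, le_div_iff₀ (by positivity)]
    linarith
  · unfold fejer
    rw [← div_eq_mul_inv, div_le_div_iff₀ (by positivity) (by positivity)]
    nlinarith [neg_one_le_cos v, cos_le_one v]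

lemma measurable_fejer : Measurable fejer := by
  unfold fejer; fun_prop

lemma integrable_fejer : Integrable fejer := by
  refine (integrable_inv_one_add_sq.const_mul 4).mono' measurable_fejer.aestronglyMeasurable ?_
  filter_upwards with v
  rw [norm_of_nonneg (fejer_nonneg v)]
  exact fejer_le v

lemma integral_fejer_pos : 0 < ∫ v, fejer v := by
  rw [integral_pos_iff_support_of_nonneg fejer_nonneg integrable_fejer]
  refine lt_of_lt_of_le ?_ (measure_mono (s := Ioo 0 1) fun v hv => ?_)
  · simp
  · have : cos v < 1 := by
      have := cos_lt_one_div_sqrt_sq_add_one (x := v) (by linarith [hv.1, pi_gt_three])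
          (by linarith [hv.2, pi_gt_three]) hv.1.ne'
      refine this.trans_le ?_
      rw [div_le_one (by positivity), Real.le_sqrt (by norm_num) (by positivity)]
      nlinarith [sq_nonneg v]
    have hv0 : 0 < v := hv.1
    simp only [fejer, Function.mem_support]
    exact (div_pos (by linarith) (by positivity)).ne'

lemma re_integral_fejer {v : ℝ} (hv : v ≠ 0) :
    (∫ τ in (0 : ℝ)..1, (1 - τ : ℂ) * Complex.exp (Complex.I * τ * v)).re = fejer v := by
  have hc : (v : ℂ) ≠ 0 := by exact_mod_cast hv
  have key : ∫ τ in (0 : ℝ)..1, (1 - τ : ℂ) * Complex.exp (Complex.I * τ * v) =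
      Complex.I / v + (1 - Complex.exp (Complex.I * v)) / v ^ 2 := by
    have hd : ∀ τ ∈ uIcc (0 : ℝ) 1, HasDerivAt
        (fun τ : ℝ => (1 - τ : ℂ) * (Complex.exp (Complex.I * τ * v) / (Complex.I * v))
          - Complex.exp (Complex.I * τ * v) / v ^ 2)
        ((1 - τ : ℂ) * Complex.exp (Complex.I * τ * v)) τ := by
      intro τ _
      have h1 : HasDerivAt (fun τ : ℝ => (τ : ℂ)) 1 τ := Complex.ofRealCLM.hasDerivAt
      have h2 : HasDerivAt (fun τ : ℝ => Complex.exp (Complex.I * τ * v))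
          (Complex.exp (Complex.I * τ * v) * (Complex.I * v)) τ := by
        have := ((h1.const_mul Complex.I).mul_const (v : ℂ)).cexp
        simpa using this
      have h3 := ((h1.const_sub 1).mul (h2.div_const (Complex.I * v))).sub
          (h2.div_const ((v : ℂ) ^ 2))
      refine h3.congr_deriv ?_
      have hI := Complex.I_ne_zero
      field_simp
      ring_nf
      try rw [Complex.I_sq]
      try ring
    rw [intervalIntegral.integral_eq_sub_of_hasDerivAt hd]
    · simp
      field_simp
      ring_nf
    · apply Continuous.intervalIntegrable
      fun_prop
  rw [key]
  have h1 : (Complex.I / v).re = 0 := by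
    simp [Complex.div_re]
  have h2 : ((1 - Complex.exp (Complex.I * v)) / v ^ 2).re = fejer v := by
    rw [← Complex.ofReal_pow, Complex.div_ofReal_re, mul_comm]
    simp [Complex.exp_ofReal_mul_I_re, fejer]
  rw [Complex.add_re, h1, h2, zero_add]

lemma fourier_side {β : ℝ → ℝ} {B : ℝ} (hβm : Measurable β) (hβ : ∀ u, |β u| ≤ B)
    {l : ℝ} (hl : 0 < l) {ε : ℝ} (hε : 0 < ε) (y : ℝ) :
    (∫ τ in (0 : ℝ)..1, (1 - τ : ℂ) * Complex.exp (Complex.I * τ * (l * y)) *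
      ∫ u in Ioi (0 : ℝ), (β u : ℂ) * Complex.exp (-((ε + Complex.I * (l * τ)) * u))).re =
    ∫ u in Ioi (0 : ℝ), β u * rexp (-(ε * u)) * fejer (l * (y - u)) := by
  set K : ℝ → ℝ → ℂ := fun τ u => (β u * rexp (-(ε * u)) : ℝ) *
    ((1 - τ : ℂ) * Complex.exp (Complex.I * τ * (l * (y - u) : ℝ))) with hK
  have hexp : Integrable (fun u => rexp (-(ε * u))) (volume.restrict (Ioi (0 : ℝ))) := by
    have := integrableOn_exp_mul_Ioi (a := -ε) (by linarith) 0
    simpa [IntegrableOn] using this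
  have hInt : Integrable (Function.uncurry K)
      ((volume.restrict (Ioc (0 : ℝ) 1)).prod (volume.restrict (Ioi (0 : ℝ)))) := by
    have h1 : Integrable (fun z : ℝ × ℝ => (1 : ℝ) * (B * rexp (-(ε * z.2))))
        ((volume.restrict (Ioc (0 : ℝ) 1)).prod (volume.restrict (Ioi (0 : ℝ)))) :=
      Integrable.mul_prod (integrable_const (1 : ℝ)) (hexp.const_mul B)
    refine h1.mono' ?_ ?_
    · apply Measurable.aestronglyMeasurable
      simp only [hK, Function.uncurry_def]
      fun_prop
    · have : ∀ᵐ z : ℝ × ℝ ∂((volume.restrict (Ioc (0 : ℝ) 1)).prod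
          (volume.restrict (Ioi (0 : ℝ)))), z.1 ∈ Ioc (0 : ℝ) 1 := by
        rw [Measure.prod_restrict]
        filter_upwards [ae_restrict_mem (measurableSet_Ioc.prod measurableSet_Ioi)] with z hz
        exact hz.1
      filter_upwards [this] with z hz
      simp only [hK, Function.uncurry_def, norm_mul]
      have h2 : ‖Complex.exp (Complex.I * z.1 * (l * (y - z.2) : ℝ))‖ = 1 := by
        rw [mul_comm Complex.I, mul_right_comm, ← Complex.ofReal_mul]
        exact Complex.norm_exp_ofReal_mul_I _
      have h3 : ‖(1 - z.1 : ℂ)‖ ≤ 1 := by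
        rw [← Complex.ofReal_one, ← Complex.ofReal_sub, Complex.norm_real, norm_eq_abs, abs_le]
        constructor <;> linarith [hz.1, hz.2]
      rw [h2, Complex.norm_real, norm_mul, norm_eq_abs, norm_of_nonneg (exp_pos _).le]
      have := hβ z.2
      have h4 := exp_pos (-(ε * z.2))
      have h5 : |β z.2| * rexp (-(ε * z.2)) ≤ B * rexp (-(ε * z.2)) := by gcongr
      have h6 : 0 ≤ |β z.2| * rexp (-(ε * z.2)) := by positivity
      nlinarith [norm_nonneg (1 - z.1 : ℂ)]
  have e1 : (∫ τ in (0 : ℝ)..1, (1 - τ : ℂ) * Complex.exp (Complex.I * τ * (l * y)) *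
      ∫ u in Ioi (0 : ℝ), (β u : ℂ) * Complex.exp (-((ε + Complex.I * (l * τ)) * u))) =
      ∫ u in Ioi (0 : ℝ), ∫ τ in Ioc (0 : ℝ) 1, K τ u := by
    rw [intervalIntegral.integral_of_le zero_le_one, ← integral_integral_swap hInt]
    congr 1; ext τ
    rw [← integral_const_mul]
    congr 1; ext u
    simp only [hK]
    push_cast
    have : Complex.exp (Complex.I * τ * (l * y)) * Complex.exp (-((ε + Complex.I * (l * τ)) * u))
      = Complex.exp (-(ε * u)) * Complex.exp (Complex.I * τ * (l * (y - u))) := by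
      rw [← Complex.exp_add, ← Complex.exp_add]; ring_nf
    linear_combination (1 - τ : ℂ) * β u * this
  rw [e1]
  have hi2 : Integrable (fun u => ∫ τ in Ioc (0 : ℝ) 1, K τ u) (volume.restrict (Ioi (0 : ℝ))) :=
    hInt.integral_prod_right
  rw [← RCLike.re_eq_complex_re, ← integral_re hi2]
  have hae : ∀ᵐ u ∂(volume.restrict (Ioi (0 : ℝ))), u ≠ y :=
    Measure.ae_ne _ y
  refine integral_congr_ae ?_
  filter_upwards [hae] with u hu
  simp only [hK]
  rw [integral_const_mul, RCLike.re_eq_complex_re, Complex.re_ofReal_mul,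
    ← intervalIntegral.integral_of_le zero_le_one, re_integral_fejer]
  exact mul_ne_zero hl.ne' (sub_ne_zero.2 hu.symm)

/-- Smoothed Tauberian statement: the Fejér means of a bounded function whose Laplace transform
extends continuously to the imaginary axis tend to zero. -/
lemma tendsto_fejer_mean {β : ℝ → ℝ} {B : ℝ} (hβm : Measurable β) (hβ : ∀ u, |β u| ≤ B)
    {g : ℂ → ℂ} (hg : ContinuousOn g {z | 0 ≤ z.re})
    (heq : ∀ z : ℂ, 0 < z.re → g z = ∫ u in Ioi (0 : ℝ), (β u : ℂ) * Complex.exp (-(z * u)))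
    {l : ℝ} (hl : 0 < l) :
    Tendsto (fun y => ∫ u in Ioi (0 : ℝ), β u * fejer (l * (y - u))) atTop (𝓝 0) := by
  have hcont : ∀ ε : ℝ, 0 ≤ ε → Continuous fun τ : ℝ => g (ε + Complex.I * (l * τ)) := by
    intro ε hε
    rw [← continuousOn_univ]
    refine hg.comp (by fun_prop) fun τ _ => ?_
    simpa using hε
  have key : ∀ y, ∫ u in Ioi (0 : ℝ), β u * fejer (l * (y - u)) =
      (∫ τ in (0 : ℝ)..1, (1 - τ : ℂ) * Complex.exp (Complex.I * τ * (l * y)) *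
        g (Complex.I * (l * τ))).re := by
    intro y
    have hB : 0 ≤ B := (abs_nonneg _).trans (hβ 0)
    have t1 : Tendsto (fun ε : ℝ => ∫ u in Ioi (0 : ℝ), β u * rexp (-(ε * u)) * fejer (l * (y - u)))
        (𝓝[>] 0) (𝓝 (∫ u in Ioi (0 : ℝ), β u * fejer (l * (y - u)))) := by
      have hfi : Integrable fun u => fejer (l * (y - u)) :=
        (integrable_fejer.comp_mul_left' hl.ne').comp_sub_left y
      refine tendsto_integral_filter_of_dominated_convergence
        (fun u => B * fejer (l * (y - u))) ?_ ?_ (hfi.const_mul B).integrableOn ?_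
      · filter_upwards with ε
        have := measurable_fejer
        exact Measurable.aestronglyMeasurable (by fun_prop)
      · filter_upwards [self_mem_nhdsWithin] with ε hε
        filter_upwards [ae_restrict_mem measurableSet_Ioi] with u hu
        rw [norm_mul, norm_mul, norm_of_nonneg (fejer_nonneg _), norm_of_nonneg (exp_pos _).le]
        have h1 : rexp (-(ε * u)) ≤ 1 := by
          rw [exp_le_one_iff]; have := mul_pos (show 0 < ε from hε) (show 0 < u from hu); linarith
        have h2 : ‖β u‖ ≤ B := hβ u
        have := fejer_nonneg (l * (y - u))
        have := exp_pos (-(ε * u))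
        gcongr
        calc _ ≤ B * 1 := by gcongr
          _ = B := mul_one B
      · filter_upwards with u
        have : Tendsto (fun ε : ℝ => β u * rexp (-(ε * u)) * fejer (l * (y - u))) (𝓝 0)
            (𝓝 (β u * rexp (-(0 * u)) * fejer (l * (y - u)))) := by
          apply Continuous.tendsto
          fun_prop
        simpa using this.mono_left nhdsWithin_le_nhds
    have t2 : Tendsto (fun ε : ℝ => (∫ τ in (0 : ℝ)..1,
          (1 - τ : ℂ) * Complex.exp (Complex.I * τ * (l * y)) * g (ε + Complex.I * (l * τ))).re)
        (𝓝[>] 0) (𝓝 (∫ τ in (0 : ℝ)..1, (1 - τ : ℂ) * Complex.exp (Complex.I * τ * (l * y)) *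
        g (Complex.I * (l * τ))).re) := by
      refine (Complex.continuous_re.tendsto _).comp ?_
      have hc2 : ContinuousOn (fun p : ℝ × ℝ => g (p.1 + Complex.I * (l * p.2)))
          (Icc 0 1 ×ˢ Icc 0 1) := by
        refine hg.comp (by fun_prop) fun p hp => ?_
        simpa using hp.1.1
      obtain ⟨M, hM⟩ := (isCompact_Icc.prod isCompact_Icc).exists_bound_of_continuousOn hc2
      refine intervalIntegral.tendsto_integral_filter_of_dominated_convergence
        (fun _ => M) ?_ ?_ (by simp) ?_
      · filter_upwards [self_mem_nhdsWithin] with ε hε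
        have := hcont ε (le_of_lt hε)
        exact (Continuous.mul (by fun_prop) this).aestronglyMeasurable
      · filter_upwards [Ioo_mem_nhdsGT (zero_lt_one' ℝ)] with ε hε
        filter_upwards with τ hτ
        rw [uIoc_of_le zero_le_one] at hτ
        rw [norm_mul, norm_mul]
        have h2 : ‖Complex.exp (Complex.I * τ * (l * y))‖ = 1 := by
          rw [mul_comm Complex.I, mul_right_comm, ← Complex.ofReal_mul, ← Complex.ofReal_mul]
          exact Complex.norm_exp_ofReal_mul_I _
        have h3 : ‖(1 - τ : ℂ)‖ ≤ 1 := by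
          rw [← Complex.ofReal_one, ← Complex.ofReal_sub, Complex.norm_real, norm_eq_abs, abs_le]
          constructor <;> linarith [hτ.1, hτ.2]
        have h4 := hM (ε, τ) ⟨⟨hε.1.le, hε.2.le⟩, ⟨hτ.1.le, hτ.2⟩⟩
        rw [h2, mul_one]
        simp only at h4
        calc _ ≤ 1 * ‖g (ε + Complex.I * (l * τ))‖ := by gcongr
          _ ≤ M := by rwa [one_mul]
      · filter_upwards with τ hτ
        refine Tendsto.const_mul _ ?_
        have h0 : (Complex.I * (l * τ) : ℂ) ∈ {z : ℂ | 0 ≤ z.re} := by simp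
        refine (hg _ h0).tendsto.comp (tendsto_nhdsWithin_iff.2 ⟨?_, ?_⟩)
        · have : Tendsto (fun ε : ℝ => (ε + Complex.I * (l * τ) : ℂ)) (𝓝 0)
              (𝓝 ((0 : ℝ) + Complex.I * (l * τ))) := by
            apply Continuous.tendsto
            fun_prop
          simpa using this.mono_left nhdsWithin_le_nhds
        · filter_upwards [self_mem_nhdsWithin] with ε hε
          simpa using (show 0 < ε from hε).le
    refine tendsto_nhds_unique (t1.congr' ?_) t2
    filter_upwards [self_mem_nhdsWithin] with ε hε
    rw [← fourier_side hβm hβ hl hε y]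
    congr 1
    refine intervalIntegral.integral_congr fun τ _ => ?_
    rw [heq _ (by simpa using hε)]
  simp only [key]
  have hRL := Real.tendsto_integral_exp_smul_cocompact
    ((Ioc (0 : ℝ) 1).indicator fun τ => (1 - τ : ℂ) * g (Complex.I * (l * τ)))
  have hw : Tendsto (fun y : ℝ => -(l * y) / (2 * π)) atTop (cocompact ℝ) := by
    refine Tendsto.mono_right ?_ atBot_le_cocompact
    refine Tendsto.atBot_div_const (by positivity) ?_
    exact tendsto_neg_atTop_atBot.comp (tendsto_id.const_mul_atTop hl)
  have h3 := (Complex.continuous_re.tendsto _).comp (hRL.comp hw)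
  rw [Complex.zero_re] at h3
  refine h3.congr fun y => ?_
  simp only [Function.comp]
  congr 1
  rw [intervalIntegral.integral_of_le zero_le_one, ← integral_indicator measurableSet_Ioc]
  congr 1; ext τ
  by_cases hτ : τ ∈ Ioc (0 : ℝ) 1
  · simp only [indicator_of_mem hτ, Real.fourierChar_apply, Circle.smul_def, smul_eq_mul]
    have : ((2 * π * -(τ * (-(l * y) / (2 * π))) : ℝ) : ℂ) * Complex.I =
        Complex.I * τ * (l * y) := by
      have hpi : (π : ℝ) ≠ 0 := pi_ne_zero
      have : (2 * π * -(τ * (-(l * y) / (2 * π))) : ℝ) = τ * (l * y) := by field_simp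
      rw [this]; push_cast; ring
    rw [this]; ring
  · simp [indicator_of_notMem hτ]

lemma eventually_not_forall_ge {β : ℝ → ℝ} {B : ℝ} (hβm : Measurable β) (hβ : ∀ u, |β u| ≤ B)
    (hJ : ∀ l : ℝ, 0 < l →
      Tendsto (fun y => ∫ u in Ioi (0 : ℝ), β u * fejer (l * (y - u))) atTop (𝓝 0))
    {δ h : ℝ} (hδ : 0 < δ) (hh : 0 < h) :
    ∀ᶠ y in atTop, ¬ ∀ u ∈ Icc (y - h) (y + h), δ ≤ β u := by
  have hB : 0 ≤ B := (abs_nonneg _).trans (hβ 0)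
  have hI := integral_fejer_pos
  have htail : Tendsto (fun T : ℝ => ∫ v, indicator {v : ℝ | T < |v|} fejer v) atTop
      (𝓝 (∫ _ : ℝ, (0 : ℝ))) := by
    refine tendsto_integral_filter_of_dominated_convergence fejer ?_ ?_ integrable_fejer ?_
    · filter_upwards with T
      exact (measurable_fejer.indicator
        (measurableSet_lt measurable_const measurable_norm)).aestronglyMeasurable
    · filter_upwards with T
      filter_upwards with v
      refine (norm_indicator_le_norm_self _ _).trans ?_
      rw [norm_of_nonneg (fejer_nonneg v)]
    · filter_upwards with v
      refine tendsto_const_nhds.congr' ?_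
      filter_upwards [eventually_ge_atTop |v|] with T hT
      rw [indicator_of_notMem]
      simpa using hT
  rw [integral_zero] at htail
  obtain ⟨T, hT, hT0⟩ := ((htail.eventually_lt_const
    (show (0 : ℝ) < δ * (∫ v, fejer v) / (2 * (δ + B)) by positivity)).and
      (eventually_gt_atTop 0)).exists
  set l := T / h with hl
  have hl0 : 0 < l := by positivity
  have hev := (hJ l hl0).eventually_lt_const
    (show (0 : ℝ) < l⁻¹ * (δ * (∫ v, fejer v) / 2) by positivity)
  filter_upwards [hev, eventually_gt_atTop h] with y hy hyh hall
  refine absurd hy (not_lt.2 ?_)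
  have e1 : ∫ u in Ioi (0 : ℝ), β u * fejer (l * (y - u)) =
      ∫ u, (Ioi (0 : ℝ)).indicator β u * fejer (l * (y - u)) := by
    rw [← integral_indicator measurableSet_Ioi]
    congr 1; ext u
    by_cases hu : u ∈ Ioi (0 : ℝ) <;> simp [hu]
  have e2 : ∫ u, (Ioi (0 : ℝ)).indicator β u * fejer (l * (y - u)) =
      l⁻¹ * ∫ v, (Ioi (0 : ℝ)).indicator β (y - l⁻¹ * v) * fejer v := by
    rw [← integral_sub_left_eq_self _ volume y]
    have := Measure.integral_comp_mul_left
      (fun v => (Ioi (0 : ℝ)).indicator β (y - l⁻¹ * v) * fejer v) l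
    rw [abs_of_pos (by positivity), smul_eq_mul] at this
    rw [← this]
    congr 1; ext u
    rw [inv_mul_cancel_left₀ hl0.ne']
    simp
  rw [e1, e2]
  refine mul_le_mul_of_nonneg_left ?_ (by positivity)
  have hmeas : MeasurableSet {v : ℝ | T < |v|} := measurableSet_lt measurable_const measurable_norm
  have hti : Integrable (indicator {v : ℝ | T < |v|} fejer) := integrable_fejer.indicator hmeas
  have hbd : ∀ u, |(Ioi (0 : ℝ)).indicator β u| ≤ B := fun u => by
    by_cases hu : u ∈ Ioi (0 : ℝ)
    · simpa [hu] using hβ u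
    · simpa [hu] using hB
  have hmi : Measurable ((Ioi (0 : ℝ)).indicator β) := hβm.indicator measurableSet_Ioi
  calc δ * (∫ v, fejer v) / 2 ≤ δ * (∫ v, fejer v) -
        (δ + B) * ∫ v, indicator {v : ℝ | T < |v|} fejer v := by
        rw [lt_div_iff₀ (by positivity)] at hT
        linarith
    _ = ∫ v, (δ * fejer v - (δ + B) * indicator {v : ℝ | T < |v|} fejer v) := by
        rw [integral_sub (integrable_fejer.const_mul _) (hti.const_mul _), integral_const_mul,
          integral_const_mul]
    _ ≤ _ := by
        refine integral_mono ((integrable_fejer.const_mul _).sub (hti.const_mul _)) ?_ ?_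
        · refine (integrable_fejer.const_mul B).mono' ?_ ?_
          · have := measurable_fejer
            exact Measurable.aestronglyMeasurable (by fun_prop)
          · filter_upwards with v
            rw [norm_mul, norm_of_nonneg (fejer_nonneg v)]
            exact mul_le_mul_of_nonneg_right (hbd _) (fejer_nonneg v)
        · intro v
          simp only
          by_cases hv : T < |v|
          · rw [indicator_of_mem (show v ∈ {v : ℝ | T < |v|} from hv)]
            have := (abs_le.1 (hbd (y - l⁻¹ * v))).1
            nlinarith [fejer_nonneg v]
          · rw [indicator_of_notMem (show v ∉ {v : ℝ | T < |v|} from hv), mul_zero, sub_zero]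
            refine mul_le_mul_of_nonneg_right ?_ (fejer_nonneg v)
            have h1 : |l⁻¹ * v| ≤ h := by
              rw [abs_mul, abs_of_pos (by positivity), hl, inv_div, div_mul_eq_mul_div,
                div_le_iff₀ hT0]
              exact mul_le_mul_of_nonneg_left (not_lt.1 hv) hh.le
            have h2 := abs_le.1 h1
            rw [indicator_of_mem (show y - l⁻¹ * v ∈ Ioi (0 : ℝ) by
              simp only [mem_Ioi]; linarith)]
            exact hall _ ⟨by linarith, by linarith⟩

end

section
open Real Set Filter Topology MeasureTheory

open ArithmeticFunction in
lemma LSeries_vonMangoldt_eq_laplace {s : ℂ} (hs : 1 < s.re) :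
    LSeries (fun n => (vonMangoldt n : ℂ)) s =
      s * ∫ u in Ioi (0 : ℝ), (Chebyshev.psi (rexp u) : ℂ) * Complex.exp (-(s * u)) := by
  rw [LSeries_eq_mul_integral_of_nonneg vonMangoldt zero_le_one hs ?_ fun n => vonMangoldt_nonneg]
  · congr 1
    have h0 : Ioi (1 : ℝ) = rexp '' Ioi 0 := by rw [image_exp_Ioi, Real.exp_zero]
    rw [h0, integral_image_eq_integral_abs_deriv_smul measurableSet_Ioi
      (fun x _ => (Real.hasDerivAt_exp x).hasDerivWithinAt) Real.exp_injective.injOn]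
    refine setIntegral_congr_fun measurableSet_Ioi fun u _ => ?_
    rw [abs_of_pos (exp_pos u), Chebyshev.psi_eq_sum_Icc, Complex.real_smul]
    have h1 : ∑ n ∈ Finset.Icc 0 ⌊rexp u⌋₊, vonMangoldt n =
        ∑ n ∈ Finset.Icc 1 ⌊rexp u⌋₊, vonMangoldt n := by
      symm
      refine Finset.sum_subset (Finset.Icc_subset_Icc_left zero_le_one) fun n hn hn' => ?_
      have : n = 0 := by
        simp only [Finset.mem_Icc, not_and, not_le] at hn hn'
        by_contra h
        exact absurd (hn' (by omega)) (by omega)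
      simp [this]
    rw [h1, Complex.ofReal_sum]
    have h2 : ((rexp u : ℝ) : ℂ) ^ (-(s + 1)) = Complex.exp (-(s * u)) * (rexp u : ℂ)⁻¹ := by
      rw [Complex.cpow_def_of_ne_zero (by exact_mod_cast (exp_pos u).ne'), ← Complex.ofReal_log
        (exp_pos u).le, Real.log_exp, Complex.ofReal_exp, ← Complex.exp_neg, ← Complex.exp_add]
      ring_nf
    rw [h2]
    have h3 : (rexp u : ℂ) ≠ 0 := by exact_mod_cast (exp_pos u).ne'
    field_simp
  · refine Asymptotics.IsBigO.of_bound (Real.log 4 + 4) ?_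
    filter_upwards with n
    have h1 := Chebyshev.psi_le_const_mul_self (x := n) (by positivity)
    rw [Chebyshev.psi_eq_sum_Icc, Nat.floor_natCast] at h1
    rw [rpow_one, norm_of_nonneg (Finset.sum_nonneg fun _ _ => vonMangoldt_nonneg),
      norm_of_nonneg (by positivity)]
    refine le_trans (Finset.sum_le_sum_of_subset_of_nonneg
      (Finset.Icc_subset_Icc_left zero_le_one) fun _ _ _ => vonMangoldt_nonneg) h1

/-- Normalised remainder `ψ(eᵘ)e⁻ᵘ - 1` on the positive half-line. -/
noncomputable def psiRemainder (u : ℝ) : ℝ :=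
  if 0 ≤ u then Chebyshev.psi (rexp u) / rexp u - 1 else 0

lemma measurable_psiRemainder : Measurable psiRemainder := by
  refine Measurable.ite measurableSet_Ici ?_ measurable_const
  have : Measurable Chebyshev.psi := Chebyshev.psi_mono.measurable
  fun_prop

lemma abs_psiRemainder_le (u : ℝ) : |psiRemainder u| ≤ log 4 + 4 := by
  have hl : 0 < log 4 := log_pos (by norm_num)
  simp only [psiRemainder]
  split_ifs with hu
  · have h1 : Chebyshev.psi (rexp u) / rexp u ≤ log 4 + 4 := by
      rw [div_le_iff₀ (exp_pos u)]
      exact Chebyshev.psi_le_const_mul_self (exp_pos u).le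
    have h2 : 0 ≤ Chebyshev.psi (rexp u) / rexp u := div_nonneg (Chebyshev.psi_nonneg _)
        (exp_pos u).le
    rw [abs_le]; constructor <;> linarith
  · simp; linarith

open ArithmeticFunction.vonMangoldt in
lemma laplace_psiRemainder {z : ℂ} (hz : 0 < z.re) :
    (LFunctionResidueClassAux (1 : ZMod 1) (1 + z) - 1) / (1 + z) =
      ∫ u in Ioi (0 : ℝ), (psiRemainder u : ℂ) * Complex.exp (-(z * u)) := by
  have hs : 1 < (1 + z).re := by simpa using hz
  have h1 := eqOn_LFunctionResidueClassAux (q := 1) (a := 1) isUnit_one hs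
  have h2 : (fun n => (residueClass (1 : ZMod 1) n : ℂ)) =
      fun n => (ArithmeticFunction.vonMangoldt n : ℂ) := by
    ext n
    rw [residueClass, indicator_of_mem]
    exact Subsingleton.elim _ _
  have hz0 : z ≠ 0 := by rintro rfl; simp at hz
  have hs0 : 1 + z ≠ 0 := by
    intro h; rw [h] at hs; simp at hs; linarith
  have hexp : IntegrableOn (fun u : ℝ => Complex.exp (-z * u)) (Ioi 0) :=
    integrableOn_exp_mul_complex_Ioi (by simpa using hz) 0
  have hexpv : ∫ u in Ioi (0 : ℝ), Complex.exp (-z * u) = z⁻¹ := by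
    rw [integral_exp_mul_complex_Ioi (by simpa using hz) 0]; simp
  have h4 : ∫ u in Ioi (0 : ℝ), (psiRemainder u : ℂ) * Complex.exp (-(z * u)) =
      (∫ u in Ioi (0 : ℝ), (Chebyshev.psi (rexp u) : ℂ) * Complex.exp (-((1 + z) * u))) - z⁻¹ := by
    rw [← hexpv]
    have e : ∀ u ∈ Ioi (0 : ℝ), (psiRemainder u : ℂ) * Complex.exp (-(z * u)) =
        (Chebyshev.psi (rexp u) : ℂ) * Complex.exp (-((1 + z) * u)) - Complex.exp (-z * u) := by
      intro u hu
      simp only [psiRemainder, if_pos (le_of_lt (show 0 < u from hu))]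
      have : Complex.exp (-((1 + z) * u)) = Complex.exp (-(z * u)) * (Complex.exp u)⁻¹ := by
        rw [← Complex.exp_neg, ← Complex.exp_add]; ring_nf
      rw [this]; push_cast
      rw [neg_mul]; ring
    rw [setIntegral_congr_fun measurableSet_Ioi e, integral_sub _ hexp]
    have hi : IntegrableOn (fun u : ℝ => (psiRemainder u : ℂ) * Complex.exp (-(z * u)) +
        Complex.exp (-z * u)) (Ioi 0) := by
      refine Integrable.add ?_ hexp
      refine (hexp.norm.const_mul (log 4 + 4)).mono' ?_ ?_
      · have := measurable_psiRemainder
        exact Measurable.aestronglyMeasurable (by fun_prop)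
      · filter_upwards with u
        rw [norm_mul, Complex.norm_real, neg_mul]
        exact mul_le_mul_of_nonneg_right (abs_psiRemainder_le u) (norm_nonneg _)
    refine IntegrableOn.congr_fun hi (fun u hu => ?_) measurableSet_Ioi
    rw [e u hu]; ring
  rw [h4, h1]
  simp only [h2]
  rw [LSeries_vonMangoldt_eq_laplace hs]
  simp
  field_simp
  ring

/-- The prime number theorem for the Chebyshev function `ψ`. -/
theorem tendsto_psi_div_self : Tendsto (fun x : ℝ => Chebyshev.psi x / x) atTop (𝓝 1) := by
  have hg : ContinuousOn (fun z : ℂ => (ArithmeticFunction.vonMangoldt.LFunctionResidueClassAux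
      (1 : ZMod 1) (1 + z) - 1) / (1 + z)) {z | 0 ≤ z.re} := by
    refine ContinuousOn.div (ContinuousOn.sub ?_ continuousOn_const) (by fun_prop) ?_
    · refine (ArithmeticFunction.vonMangoldt.continuousOn_LFunctionResidueClassAux
        (1 : ZMod 1)).comp (by fun_prop) fun z hz => ?_
      simpa using hz
    · intro z hz h
      have : (1 + z).re = 0 := by rw [h]; simp
      simp only [Complex.add_re, Complex.one_re] at this
      have hz' : 0 ≤ z.re := hz
      linarith
  have hJ : ∀ l : ℝ, 0 < l → Tendsto
      (fun y => ∫ u in Ioi (0 : ℝ), psiRemainder u * fejer (l * (y - u))) atTop (𝓝 0) := fun l hl =>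
    tendsto_fejer_mean measurable_psiRemainder abs_psiRemainder_le hg
      (fun z hz => laplace_psiRemainder hz) hl
  have hJ' : ∀ l : ℝ, 0 < l → Tendsto
      (fun y => ∫ u in Ioi (0 : ℝ), -psiRemainder u * fejer (l * (y - u))) atTop (𝓝 0) := by
    intro l hl
    simpa [integral_neg] using (hJ l hl).neg
  have hslow : ∀ u v, 0 ≤ u → u ≤ v →
      (psiRemainder u + 1) * rexp (u - v) ≤ psiRemainder v + 1 := by
    intro u v hu huv
    simp only [psiRemainder, if_pos hu, if_pos (hu.trans huv)]
    have h1 : Chebyshev.psi (rexp u) ≤ Chebyshev.psi (rexp v) :=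
      Chebyshev.psi_mono (exp_le_exp.2 huv)
    rw [sub_add_cancel, sub_add_cancel, exp_sub, div_mul_div_cancel₀ (exp_pos u).ne']
    gcongr
  have key : Tendsto psiRemainder atTop (𝓝 0) := by
    rw [Metric.tendsto_atTop']
    by_contra! hcon
    obtain ⟨δ', hδ', hcon⟩ := hcon
    set δ := min δ' 1 with hδdef
    have hδ : 0 < δ := lt_min hδ' one_pos
    have hδ1 : δ ≤ 1 := min_le_right _ _
    have hA := eventually_not_forall_ge measurable_psiRemainder abs_psiRemainder_le hJ
      (δ := δ / 2) (h := δ / 8) (by linarith) (by linarith)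
    have hB := eventually_not_forall_ge measurable_psiRemainder.neg (B := log 4 + 4)
      (fun u => (abs_neg (psiRemainder u)).trans_le (abs_psiRemainder_le u)) hJ'
      (δ := δ / 2) (h := δ / 8) (by linarith) (by linarith)
    obtain ⟨N, hN⟩ := eventually_atTop.1 (hA.and (hB.and (eventually_ge_atTop (2 : ℝ))))
    obtain ⟨u, hu, hub⟩ := hcon (max N 2 + 1)
    have huN : N + 1 < u := by linarith [le_max_left N 2]
    have hu2 : 3 < u := by linarith [le_max_right N 2]
    rw [dist_zero_right, norm_eq_abs] at hub
    have hub' : δ ≤ |psiRemainder u| := (min_le_left _ _).trans hub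
    rcases le_abs.1 hub' with h | h
    · refine (hN (u + δ / 8) (by linarith)).1 fun v hv => ?_
      have h1 := hslow u v (by linarith) (by linarith [hv.1])
      have h2 := add_one_le_exp (u - v)
      have h3 : 1 - δ / 4 ≤ rexp (u - v) := by linarith [hv.2]
      nlinarith
    · refine (hN (u - δ / 8) (by linarith)).2.1 fun v hv => ?_
      have h1 := hslow v u (by linarith [hv.1]) (by linarith [hv.2])
      have h2 := add_one_le_exp (v - u)
      have h3 : 1 - δ / 4 ≤ rexp (v - u) := by linarith [hv.1]
      change δ / 2 ≤ -psiRemainder v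
      by_contra! hlt
      have h4 := mul_le_mul_of_nonneg_left h3 (show 0 ≤ psiRemainder v + 1 by linarith)
      nlinarith
  have h := ((key.comp tendsto_log_atTop).add_const 1)
  rw [zero_add] at h
  refine h.congr' ?_
  filter_upwards [eventually_gt_atTop 1] with x hx
  simp only [Function.comp, psiRemainder, if_pos (log_nonneg hx.le), exp_log (zero_lt_one.trans hx)]
  ring

/-- The prime number theorem for the Chebyshev function `θ`. -/
theorem tendsto_theta_div_self : Tendsto (fun x : ℝ => Chebyshev.theta x / x) atTop (𝓝 1) := by
  have h1 : Tendsto (fun x : ℝ => 2 * (log x / x ^ (1 / 2 : ℝ))) atTop (𝓝 (2 * 0)) :=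
    (isLittleO_log_rpow_atTop (by norm_num)).tendsto_div_nhds_zero.const_mul 2
  rw [mul_zero] at h1
  have h2 := tendsto_psi_div_self.sub h1
  rw [sub_zero] at h2
  refine tendsto_of_tendsto_of_tendsto_of_le_of_le' h2 tendsto_psi_div_self ?_ ?_
  · filter_upwards [eventually_ge_atTop 1] with x hx
    have hx0 : 0 < x := by linarith
    have h := Chebyshev.psi_sub_theta_le hx
    rw [← sqrt_eq_rpow]
    have hs : √x * √x = x := mul_self_sqrt hx0.le
    have hs0 : 0 < √x := sqrt_pos.2 hx0
    have e : 2 * (log x / √x) = 2 * √x * log x / x := by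
      field_simp
      rw [sq, hs]
    rw [e, ← sub_div]
    gcongr
    linarith
  · filter_upwards [eventually_gt_atTop 0] with x hx
    gcongr
    exact Chebyshev.theta_le_psi x

end

/-- The integer-valued step function governing the `q`-adic divisibility of the coefficients
of the partial fraction expansion. -/
def stepFn (n q κ : ℤ) : ℤ :=
  3 * (κ / q + (91 * n - κ) / q - (κ - 27 * n) / q - (64 * n - κ) / q - 2 * (27 * n / q)) +
  ∑ i ∈ Finset.range 10, ((91 - 2 * (29 + i)) * n / q - (κ - (29 + i) * n) / q -
    ((91 - (29 + i)) * n - κ) / q)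

lemma ediv_add_le_add_ediv {q : ℤ} (hq : 0 < q) (a b : ℤ) : a / q + b / q ≤ (a + b) / q := by
  rw [Int.le_ediv_iff_mul_le hq, add_mul]
  exact add_le_add (Int.ediv_mul_le a hq.ne') (Int.ediv_mul_le b hq.ne')

lemma stepFn_nonneg {q : ℤ} (hq : 0 < q) (n κ : ℤ) : 0 ≤ stepFn n q κ := by
  unfold stepFn
  refine add_nonneg ?_ (Finset.sum_nonneg fun i _ => ?_)
  · have h1 := ediv_add_le_add_ediv hq (κ - 27 * n) (27 * n)
    have h2 := ediv_add_le_add_ediv hq (64 * n - κ) (27 * n)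
    rw [show κ - 27 * n + 27 * n = κ by ring] at h1
    rw [show 64 * n - κ + 27 * n = 91 * n - κ by ring] at h2
    linarith
  · have h1 := ediv_add_le_add_ediv hq (κ - (29 + i) * n) ((91 - (29 + i)) * n - κ)
    rw [show κ - (29 + i) * n + ((91 - (29 + i)) * n - κ) = (91 - 2 * (29 + i)) * n by ring] at h1
    linarith

lemma stepFn_add_mul_right {q : ℤ} (hq : 0 < q) (n κ m : ℤ) :
    stepFn n q (κ + m * q) = stepFn n q κ := by
  unfold stepFn
  have h0 : (κ + m * q) / q = κ / q + m := Int.add_mul_ediv_right _ _ hq.ne'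
  have h : ∀ a : ℤ, (κ + m * q - a) / q = (κ - a) / q + m := fun a => by
    rw [add_sub_right_comm, Int.add_mul_ediv_right _ _ hq.ne']
  have h' : ∀ a : ℤ, (a - (κ + m * q)) / q = (a - κ) / q - m := fun a => by
    rw [show a - (κ + m * q) = a - κ + -m * q by ring, Int.add_mul_ediv_right _ _ hq.ne']
    ring
  simp only [h0, h, h']
  congr 1
  · ring
  · exact Finset.sum_congr rfl fun i _ => by ring

lemma stepFn_emod {q : ℤ} (hq : 0 < q) (n κ : ℤ) : stepFn (n % q) q κ = stepFn n q κ := by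
  have h : ∀ a d : ℤ, (a + d * n) / q = (a + d * (n % q)) / q + d * (n / q) := fun a d => by
    rw [← Int.add_mul_ediv_right _ _ hq.ne']
    congr 1
    linear_combination (-d) * Int.emod_add_mul_ediv n q
  have h1 := h (-κ) 91
  have h2 := h κ (-27)
  have h3 := h (-κ) 64
  have h4 := h 0 27
  unfold stepFn
  rw [show 91 * n - κ = -κ + 91 * n by ring, show κ - 27 * n = κ + -27 * n by ring,
    show 64 * n - κ = -κ + 64 * n by ring, ← zero_add (27 * n), h1, h2, h3, h4]
  have h5 : ∀ i : ℕ, (91 - 2 * (29 + (i : ℤ))) * n / q - (κ - (29 + i) * n) / q -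
      ((91 - (29 + i)) * n - κ) / q = (91 - 2 * (29 + (i : ℤ))) * (n % q) / q -
      (κ - (29 + i) * (n % q)) / q - ((91 - (29 + i)) * (n % q) - κ) / q := by
    intro i
    have e1 := h 0 (91 - 2 * (29 + (i : ℤ)))
    have e2 := h κ (-(29 + i))
    have e3 := h (-κ) (91 - (29 + i))
    rw [zero_add, zero_add] at e1
    rw [neg_mul, neg_mul, ← sub_eq_add_neg, ← sub_eq_add_neg] at e2
    rw [neg_add_eq_sub, neg_add_eq_sub] at e3
    rw [e1, e2, e3]; ring
  rw [Finset.sum_congr rfl fun i _ => h5 i]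
  ring_nf

lemma sub_one_ediv_of_not_dvd {q a : ℤ} (hq : 0 < q) (h : ¬ q ∣ a) : (a - 1) / q = a / q := by
  have h1 := Int.emod_add_mul_ediv a q
  have h2 := Int.emod_lt_of_pos a hq
  have h3 : 0 < a % q := lt_of_le_of_ne (Int.emod_nonneg a hq.ne')
    fun h0 => h (Int.dvd_of_emod_eq_zero h0.symm)
  rw [← h1, add_sub_right_comm, Int.add_mul_ediv_left _ _ hq.ne', Int.add_mul_ediv_left _ _ hq.ne',
    Int.ediv_eq_zero_of_lt (by omega) (by omega), Int.ediv_eq_zero_of_lt h3.le h2]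

lemma stepFn_congr_of_dvd {q : ℤ} (hq : 0 < q) (n : ℤ) {κ κ' : ℤ} (h : q ∣ κ' - κ) :
    stepFn n q κ = stepFn n q κ' := by
  obtain ⟨m, hm⟩ := h
  rw [show κ' = κ + m * q by linarith [mul_comm q m], stepFn_add_mul_right hq]

/-- The minimum of the step function over `κ` is attained at one of thirteen places. -/
lemma le_stepFn_of_forall {q : ℤ} (hq : 0 < q) (n v : ℤ)
    (h91 : v ≤ stepFn n q (91 * n)) (h64 : v ≤ stepFn n q (64 * n))
    (hj : ∀ i < 10, v ≤ stepFn n q ((91 - (29 + (i : ℕ))) * n)) 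
    (hend : v ≤ 3 * (91 * n / q - 27 * n / q - 64 * n / q) + ∑ i ∈ Finset.range 10,
      (1 + (91 - 2 * (29 + i)) * n / q + (29 + i) * n / q - (91 - (29 + i)) * n / q)) (κ : ℤ) :
    v ≤ stepFn n q κ := by
  have main : ∀ d : ℕ, ∀ κ : ℤ, 0 ≤ κ → q - 1 - κ = d → v ≤ stepFn n q κ := by
    intro d
    induction d with
    | zero =>
      intro κ h0 hd
      by_cases c91 : q ∣ 91 * n - κ
      · rwa [stepFn_congr_of_dvd hq n c91]
      by_cases c64 : q ∣ 64 * n - κ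
      · rwa [stepFn_congr_of_dvd hq n c64]
      by_cases cj : ∃ i < 10, q ∣ (91 - (29 + (i : ℕ))) * n - κ
      · obtain ⟨i, hi, hdv⟩ := cj
        rw [stepFn_congr_of_dvd hq n hdv]
        exact hj i hi
      push Not at cj
      refine hend.trans (le_of_eq ?_)
      unfold stepFn
      have hκ : κ = q - 1 := by push_cast at hd; linarith
      have e1 : κ / q = 0 := Int.ediv_eq_zero_of_lt h0 (by omega)
      have e2 : ∀ a, ¬ q ∣ a - κ → (a - κ) / q = a / q - 1 := fun a ha => by
        rw [← sub_one_ediv_of_not_dvd hq ha, hκ, show a - (q - 1) - 1 = a + -1 * q by ring,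
          Int.add_mul_ediv_right _ _ hq.ne']
        ring
      have e3 : ∀ a, (κ - a) / q = -(a / q) := fun a => by
        have h1 := Int.emod_add_mul_ediv a q
        have h2 := Int.emod_lt_of_pos a hq
        have h3 := Int.emod_nonneg a hq.ne'
        rw [Int.ediv_eq_iff_of_pos hq, hκ]
        constructor <;> linarith
      simp only [e1, e2 _ c91, e2 _ c64, e3]
      congr 1
      · ring
      · refine Finset.sum_congr rfl fun i hi => ?_
        rw [e2 _ (cj i (Finset.mem_range.1 hi))]
        ring
    | succ d ih =>
      intro κ h0 hd
      push_cast at hd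
      by_cases c91 : q ∣ 91 * n - κ
      · rwa [stepFn_congr_of_dvd hq n c91]
      by_cases c64 : q ∣ 64 * n - κ
      · rwa [stepFn_congr_of_dvd hq n c64]
      by_cases cj : ∃ i < 10, q ∣ (91 - (29 + (i : ℕ))) * n - κ
      · obtain ⟨i, hi, hdv⟩ := cj
        rw [stepFn_congr_of_dvd hq n hdv]
        exact hj i hi
      push Not at cj
      refine (ih (κ + 1) (by omega) (by omega)).trans ?_
      unfold stepFn
      have e1 : (κ + 1) / q = κ / q := by
        rw [Int.ediv_eq_zero_of_lt (by omega) (by omega), Int.ediv_eq_zero_of_lt (by omega)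
          (by omega)]
      have e2 : (91 * n - (κ + 1)) / q = (91 * n - κ) / q := by
        rw [← sub_sub, sub_one_ediv_of_not_dvd hq c91]
      have e3 : (64 * n - (κ + 1)) / q = (64 * n - κ) / q := by
        rw [← sub_sub, sub_one_ediv_of_not_dvd hq c64]
      have e4 : ∀ d, (κ - d) / q ≤ (κ + 1 - d) / q := fun d =>
        Int.ediv_le_ediv hq (by omega)
      rw [e1, e2, e3]
      refine add_le_add (by linarith [e4 (27 * n)]) (Finset.sum_le_sum fun i hi => ?_)
      have e5 : ((91 - (29 + (i : ℤ))) * n - (κ + 1)) / q = ((91 - (29 + i)) * n - κ) / q := by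
        rw [← sub_sub, sub_one_ediv_of_not_dvd hq (cj i (Finset.mem_range.1 hi))]
      rw [e5]
      linarith [e4 ((29 + i) * n)]
  have h1 := Int.emod_nonneg κ hq.ne'
  have h2 := Int.emod_lt_of_pos κ hq
  have h3 := main (q - 1 - κ % q).toNat (κ % q) h1 (by omega)
  rwa [stepFn_congr_of_dvd hq n (κ' := κ)] at h3
  exact ⟨κ / q, by linarith [Int.emod_add_mul_ediv κ q]⟩

/-- Small multiples of a point of a Farey interval have the same integer part as those of the
mediant. -/
lemma farey_bounds {a b c d : ℕ} (hdet : b * c = a * d + 1) (hbd : 91 < b + d) {n q : ℤ}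
    (hq : 0 < q) (h1 : a * q < b * n) (h2 : d * n < c * q) {m : ℕ} (hm : m ≤ 91) (hm0 : 0 < m) :
    ((m * (a + c) / (b + d) : ℕ) : ℤ) * q < m * n ∧
      m * n < (((m * (a + c) / (b + d) : ℕ) : ℤ) + 1) * q := by
  have hdet' : (b * c : ℤ) = a * d + 1 := by exact_mod_cast hdet
  have hm' : (m : ℤ) ≤ 91 := by exact_mod_cast hm
  have hm0' : (0 : ℤ) < m := by exact_mod_cast hm0
  have hbd' : (91 : ℤ) < b + d := by exact_mod_cast hbd
  have key : ∀ g : ℤ, a * m < b * g → d * g < c * m → False := by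
    intro g hg1 hg2
    have e : (m : ℤ) = b * (c * m - d * g) + d * (b * g - a * m) := by
      linear_combination (-m : ℤ) * hdet'
    have e1 : (b : ℤ) * 1 ≤ b * (c * m - d * g) :=
      mul_le_mul_of_nonneg_left (by linarith) (by positivity)
    have e2 : (d : ℤ) * 1 ≤ d * (b * g - a * m) :=
      mul_le_mul_of_nonneg_left (by linarith) (by positivity)
    linarith
  set f := m * (a + c) / (b + d) with hf
  have hf1 : (f * (b + d) : ℤ) ≤ m * (a + c) := by exact_mod_cast Nat.div_mul_le_self _ _
  have hf2 : (m * (a + c) : ℤ) < (f + 1) * (b + d) := by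
    have := Nat.lt_mul_div_succ (m * (a + c)) (show 0 < b + d by omega)
    rw [← hf, mul_comm (b + d)] at this
    exact_mod_cast this
  constructor
  · by_contra! h
    have g1 : (a * m : ℤ) < b * f := by
      have := mul_lt_mul_of_pos_right h1 hm0'
      have := mul_le_mul_of_nonneg_left h (show (0 : ℤ) ≤ b by positivity)
      refine lt_of_mul_lt_mul_right (a := q) ?_ hq.le
      linarith
    exact key f g1 (by linarith)
  · by_contra! h
    have g1 : (d * (f + 1) : ℤ) < c * m := by
      have := mul_lt_mul_of_pos_right h2 hm0'
      have := mul_le_mul_of_nonneg_left h (show (0 : ℤ) ≤ d by positivity)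
      refine lt_of_mul_lt_mul_right (a := q) ?_ hq.le
      linarith
    exact key (f + 1) (by linarith) g1

lemma ediv_eq_of_farey {a b c d : ℕ} (hdet : b * c = a * d + 1) (hbd : 91 < b + d) {n q : ℤ}
    (hq : 0 < q) (h1 : a * q < b * n) (h2 : d * n < c * q) {m : ℕ} (hm : m ≤ 91) :
    (m * n) / q = ((m * (a + c) / (b + d) : ℕ) : ℤ) := by
  rcases Nat.eq_zero_or_pos m with rfl | hm0
  · simp
  obtain ⟨e1, e2⟩ := farey_bounds hdet hbd hq h1 h2 hm hm0
  rw [Int.ediv_eq_iff_of_pos hq]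
  constructor <;> linarith

lemma neg_ediv_eq_of_farey {a b c d : ℕ} (hdet : b * c = a * d + 1) (hbd : 91 < b + d) {n q : ℤ}
    (hq : 0 < q) (h1 : a * q < b * n) (h2 : d * n < c * q) {m : ℕ} (hm : m ≤ 91) (hm0 : 0 < m) :
    (-m * n) / q = -((m * (a + c) / (b + d) : ℕ) : ℤ) - 1 := by
  obtain ⟨e1, e2⟩ := farey_bounds hdet hbd hq h1 h2 hm hm0
  rw [Int.ediv_eq_iff_of_pos hq]
  constructor <;> linarith

/-- Evaluate a natural number before substituting it. -/
def forceNat {α : Type} (n : ℕ) (f : ℕ → α) : α :=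
  Nat.rec (f 0) (fun k _ => f (Nat.succ k)) n

lemma forceNat_eq {α : Type} (n : ℕ) (f : ℕ → α) : forceNat n f = f n := by
  cases n <;> rfl

/-- `⌊d p / q⌋`. -/
def floorMul (p q d : ℕ) : ℕ := Nat.div (Nat.mul d p) q

/-- `f a + f (a + 1) + ... + f (a + m - 1)`. -/
def windowSum (f : ℕ → ℕ) (m a : ℕ) : ℕ :=
  Nat.rec (fun _ => nat_lit 0) (fun _ ih a => Nat.add (f a) (ih (Nat.succ a))) m a

lemma windowSum_zero (f : ℕ → ℕ) (a : ℕ) : windowSum f 0 a = 0 := rfl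

lemma windowSum_succ (f : ℕ → ℕ) (m a : ℕ) :
    windowSum f (m + 1) a = f a + windowSum f m (a + 1) := rfl

def valueAtEnd (p q s : ℕ) : ℕ :=
  Nat.sub (Nat.add s (Nat.add (Nat.mul (nat_lit 3) (floorMul p q (nat_lit 91)))
      (Nat.add (nat_lit 10) (windowSum (floorMul p q) (nat_lit 10) (nat_lit 29)))))
    (Nat.add (Nat.mul (nat_lit 3) (Nat.add (floorMul p q (nat_lit 27)) (floorMul p q (nat_lit 64))))
      (windowSum (floorMul p q) (nat_lit 10) (nat_lit 53)))

def valueAtSixtyFour (p q s : ℕ) : ℕ :=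
  Nat.sub (Nat.add s (Nat.add (Nat.mul (nat_lit 3)
        (Nat.add (floorMul p q (nat_lit 64)) (floorMul p q (nat_lit 27))))
      (Nat.add (nat_lit 10) (windowSum (floorMul p q) (nat_lit 10) (nat_lit 2)))))
    (Nat.add (Nat.mul (nat_lit 3) (Nat.add (floorMul p q (nat_lit 37))
        (Nat.mul (nat_lit 2) (floorMul p q (nat_lit 27)))))
      (windowSum (floorMul p q) (nat_lit 10) (nat_lit 26)))

def valueAt (p q s j : ℕ) : ℕ :=
  Nat.sub (Nat.add s (Nat.add (Nat.mul (nat_lit 3) (Nat.add (floorMul p q (Nat.add (nat_lit 53) j))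
        (floorMul p q (Nat.sub (nat_lit 38) j))))
      (Nat.add j (windowSum (floorMul p q) j (nat_lit 1)))))
    (Nat.add (Nat.mul (nat_lit 3) (Nat.add (floorMul p q (Nat.add (nat_lit 26) j))
        (Nat.add (floorMul p q (Nat.sub (nat_lit 11) j))
          (Nat.mul (nat_lit 2) (floorMul p q (nat_lit 27))))))
      (Nat.add (windowSum (floorMul p q) (nat_lit 10) (Nat.add (nat_lit 15) j))
        (windowSum (floorMul p q) (Nat.sub (nat_lit 9) j) (nat_lit 1))))

def minNat (a b : ℕ) : ℕ := Bool.rec b a (Nat.ble a b)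

lemma minNat_eq (a b : ℕ) : minNat a b = min a b := by
  unfold minNat
  rcases h : Nat.ble a b with _ | _
  · have : ¬ a ≤ b := fun h' => by rw [Nat.ble_eq_true_of_le h'] at h; cases h
    rw [min_eq_right (by omega)]
  · rw [min_eq_left (Nat.le_of_ble_eq_true h)]

/-- Minimum of `acc` and `f a, ..., f (a + m - 1)`. -/
def windowMin (f : ℕ → ℕ) (m a acc : ℕ) : ℕ :=
  Nat.rec (fun _ acc => acc)
    (fun _ ih a acc => forceNat (f a) fun t => ih (Nat.succ a) (minNat acc t)) m a acc

lemma windowMin_le (f : ℕ → ℕ) (m a acc : ℕ) :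
    windowMin f m a acc ≤ acc ∧ ∀ i < m, windowMin f m a acc ≤ f (a + i) := by
  induction m generalizing a acc with
  | zero => exact ⟨le_refl _, by simp⟩
  | succ m ih =>
    have e : windowMin f (m + 1) a acc = windowMin f m (a + 1) (min acc (f a)) := by
      rw [← minNat_eq]
      exact forceNat_eq (f a) (fun t => windowMin f m (a + 1) (minNat acc t))
    rw [e]
    obtain ⟨h1, h2⟩ := ih (a + 1) (min acc (f a))
    refine ⟨h1.trans (min_le_left _ _), fun i hi => ?_⟩
    rcases i with _ | i
    · exact h1.trans (min_le_right _ _)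
    · have := h2 i (by omega)
      rwa [show a + 1 + i = a + (i + 1) by ring] at this

def weightAux (p q : ℕ) : ℕ :=
  forceNat (windowSum (fun e => floorMul p q (Nat.succ (Nat.add e e))) (nat_lit 10) (nat_lit 7))
    fun s => windowMin (valueAt p q s) (nat_lit 10) (nat_lit 0)
      (minNat (valueAtSixtyFour p q s) (valueAtEnd p q s))

/-- Lower bound for the step function on the Farey interval with mediant `p / q`. -/
def weight (p q : ℕ) : ℕ := forceNat p fun p => forceNat q fun q => weightAux p q

lemma add_ediv_le {q : ℤ} (hq : 0 < q) (a b : ℤ) : (a + b) / q ≤ 1 + a / q + b / q := by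
  have h1 := Int.lt_mul_ediv_self_add (x := a) hq
  have h2 := Int.lt_mul_ediv_self_add (x := b) hq
  rw [← Int.lt_add_one_iff, Int.ediv_lt_iff_lt_mul hq]
  linarith

set_option maxHeartbeats 4000000 in
lemma weight_le_stepFn_of_lt {a b c d : ℕ} (hdet : b * c = a * d + 1) (hbd : 91 < b + d) {n q : ℤ}
    (hq : 0 < q) (h1 : a * q < b * n) (h2 : d * n < c * q) (κ : ℤ) :
    (weight (a + c) (b + d) : ℤ) ≤ stepFn n q κ := by
  set P := a + c with hP
  set Q := b + d with hQ
  have hw : weight P Q = weightAux P Q := by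
    unfold weight; rw [forceNat_eq, forceNat_eq]
  set s := windowSum (fun e => floorMul P Q (Nat.succ (Nat.add e e))) 10 7 with hs
  have hw' : weightAux P Q = windowMin (valueAt P Q s) 10 0
      (min (valueAtSixtyFour P Q s) (valueAtEnd P Q s)) := by
    unfold weightAux; rw [forceNat_eq, minNat_eq]
  have hpos : ∀ m : ℕ, m ≤ 91 → (m * n) / q = (floorMul P Q m : ℤ) := fun m hm =>
    ediv_eq_of_farey hdet hbd hq h1 h2 hm
  have hneg : ∀ m : ℕ, m ≤ 91 → 0 < m → (-m * n) / q = -(floorMul P Q m : ℤ) - 1 := fun m hm h0 =>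
    neg_ediv_eq_of_farey hdet hbd hq h1 h2 hm h0
  have hf0 : floorMul P Q 0 = 0 := by
    show (0 * P) / Q = 0
    simp
  set g : ℤ → ℤ := fun m => if 0 ≤ m then (floorMul P Q m.toNat : ℤ)
    else -(floorMul P Q (-m).toNat : ℤ) - 1 with hg
  have hdiv : ∀ m : ℤ, -91 ≤ m → m ≤ 91 → m * n / q = g m := by
    intro m hm1 hm2
    simp only [hg]
    split_ifs with h
    · rw [← hpos _ (by omega), Int.toNat_of_nonneg h]
    · rw [← hneg _ (by omega) (by omega), Int.toNat_of_nonneg (by omega), neg_neg]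
  have hval : ∀ c : ℤ, 53 ≤ c → c ≤ 91 → stepFn n q (c * n) =
      3 * (g c + g (91 - c) - g (c - 27) - g (64 - c) - 2 * g 27) +
      ∑ i ∈ Finset.range 10, (g (91 - 2 * (29 + i)) - g (c - (29 + i)) -
        g (91 - (29 + i) - c)) := by
    intro c hc1 hc2
    unfold stepFn
    simp only [← sub_mul]
    congr 1
    · rw [hdiv _ (by omega) (by omega), hdiv _ (by omega) (by omega), hdiv _ (by omega) (by omega),
        hdiv _ (by omega) (by omega), hdiv _ (by omega) (by omega)]
    · refine Finset.sum_congr rfl fun i hi => ?_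
      rw [Finset.mem_range] at hi
      rw [hdiv _ (by omega) (by omega), hdiv _ (by omega) (by omega), hdiv _ (by omega) (by omega)]
  obtain ⟨hmin, hminj⟩ := windowMin_le (valueAt P Q s) 10 0
    (min (valueAtSixtyFour P Q s) (valueAtEnd P Q s))
  rw [← hw', ← hw] at hmin hminj
  have hend : (valueAtEnd P Q s : ℤ) ≤ 3 * (91 * n / q - 27 * n / q - 64 * n / q) +
      ∑ i ∈ Finset.range 10,
        (1 + (91 - 2 * (29 + i)) * n / q + (29 + i) * n / q - (91 - (29 + i)) * n / q) := by
    have h0 : 0 ≤ 3 * (91 * n / q - 27 * n / q - 64 * n / q) + ∑ i ∈ Finset.range 10,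
        (1 + (91 - 2 * (29 + (i : ℤ))) * n / q + (29 + i) * n / q - (91 - (29 + i)) * n / q) := by
      refine add_nonneg ?_ (Finset.sum_nonneg fun i _ => ?_)
      · have := ediv_add_le_add_ediv hq (27 * n) (64 * n)
        rw [← add_mul] at this
        norm_num at this
        linarith
      · have := add_ediv_le hq ((91 - 2 * (29 + (i : ℤ))) * n) ((29 + i) * n)
        rw [← add_mul, show 91 - 2 * (29 + (i : ℤ)) + (29 + i) = 91 - (29 + i) by ring] at this
        linarith
    simp only [Finset.sum_range_succ, Finset.sum_range_zero] at h0 ⊢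
    norm_num at h0 ⊢
    repeat rw [hdiv _ (by norm_num) (by norm_num)] at h0 ⊢
    simp [hg, valueAtEnd, hs, windowSum_succ, windowSum_zero] at h0 ⊢
    omega
  have h64 : (valueAtSixtyFour P Q s : ℤ) ≤ stepFn n q (64 * n) := by
    have h0 := stepFn_nonneg hq n (64 * n)
    rw [hval 64 (by norm_num) (by norm_num)] at h0 ⊢
    simp [hg, Finset.sum_range_succ, valueAtSixtyFour, hs, windowSum_succ, windowSum_zero] at h0 ⊢
    omega
  have h91 : (valueAtEnd P Q s : ℤ) ≤ stepFn n q (91 * n) := by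
    have h0 := stepFn_nonneg hq n (91 * n)
    rw [hval 91 (by norm_num) (by norm_num)] at h0 ⊢
    simp [hg, Finset.sum_range_succ, valueAtEnd, hs, windowSum_succ, windowSum_zero] at h0 ⊢
    omega
  have hj : ∀ j < 10, (valueAt P Q s j : ℤ) ≤ stepFn n q ((53 + (j : ℤ)) * n) := by
    intro j hj
    have h0 := stepFn_nonneg hq n ((53 + (j : ℤ)) * n)
    rw [hval _ (by omega) (by omega)] at h0 ⊢
    interval_cases j <;>
    · simp [hg, Finset.sum_range_succ, valueAt, hs, windowSum_succ, windowSum_zero] at h0 ⊢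
      omega
  refine le_stepFn_of_forall hq n _ ?_ ?_ ?_ ?_ κ
  · exact le_trans (by exact_mod_cast hmin.trans (min_le_right _ _)) h91
  · exact le_trans (by exact_mod_cast hmin.trans (min_le_left _ _)) h64
  · intro i hi
    have h := hminj (9 - i) (by omega)
    rw [zero_add] at h
    have := hj (9 - i) (by omega)
    rw [show ((91 - (29 + (i : ℕ))) : ℤ) = 53 + ((9 - i : ℕ) : ℤ) by omega]
    exact le_trans (by exact_mod_cast h) this
  · exact le_trans (by exact_mod_cast hmin.trans (min_le_right _ _)) hend

section
open Filter Topology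

/-- The largest exponent (for the prime `p`) that is guaranteed for every `κ`. -/
noncomputable def minStep (n p : ℕ) : ℕ := ⨅ κ : ℤ, (stepFn n p κ).toNat

lemma minStep_le {p : ℕ} (hp : 0 < p) (n : ℕ) (κ : ℤ) : (minStep n p : ℤ) ≤ stepFn n p κ := by
  have h1 : minStep n p ≤ (stepFn n p κ).toNat := ciInf_le (OrderBot.bddBelow _) κ
  have h2 := stepFn_nonneg (q := p) (by exact_mod_cast hp) n κ
  omega

lemma le_minStep {n p v : ℕ} (h : ∀ κ, (v : ℤ) ≤ stepFn n p κ) : v ≤ minStep n p :=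
  le_ciInf fun κ => by have := h κ; omega

/-- The primes `p ≤ 33 n` with `x₀ ≤ n / p < x₁`. -/
noncomputable def primeWindow (x₀ x₁ : ℝ) (n : ℕ) : Finset ℕ := by
  classical
  exact (Finset.range (33 * n + 1)).filter fun p => p.Prime ∧ x₀ * p ≤ n ∧ n < x₁ * p

lemma mem_primeWindow {x₀ x₁ : ℝ} {n p : ℕ} :
    p ∈ primeWindow x₀ x₁ n ↔ p ≤ 33 * n ∧ p.Prime ∧ x₀ * p ≤ n ∧ n < x₁ * p := by
  unfold primeWindow
  rw [Finset.mem_filter, Finset.mem_range, Nat.lt_succ_iff]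

/-- The primes in a window contribute at least the density `s`. -/
def HasDensityGE (x₀ x₁ s : ℝ) : Prop :=
  ∀ ε > 0, ∀ᶠ n : ℕ in atTop,
    (s - ε) * n ≤ ∑ p ∈ primeWindow x₀ x₁ n, (minStep n p : ℝ) * Real.log p

lemma sum_window_nonneg (x₀ x₁ : ℝ) (n : ℕ) :
    0 ≤ ∑ p ∈ primeWindow x₀ x₁ n, (minStep n p : ℝ) * Real.log p :=
  Finset.sum_nonneg fun p _ => mul_nonneg (Nat.cast_nonneg _) (Real.log_natCast_nonneg p)

lemma hasDensityGE_zero (x₀ x₁ : ℝ) : HasDensityGE x₀ x₁ 0 := fun ε hε => by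
  filter_upwards with n
  refine le_trans ?_ (sum_window_nonneg x₀ x₁ n)
  nlinarith [Nat.cast_nonneg (α := ℝ) n]

lemma HasDensityGE.mono {x₀ x₁ s t : ℝ} (h : HasDensityGE x₀ x₁ s) (hst : t ≤ s) :
    HasDensityGE x₀ x₁ t := fun ε hε => by
  filter_upwards [h ε hε] with n hn
  exact le_trans (mul_le_mul_of_nonneg_right (by linarith) (Nat.cast_nonneg _)) hn

lemma HasDensityGE.add {x₀ x₁ x₂ s t : ℝ} (h01 : x₀ ≤ x₁) (h12 : x₁ ≤ x₂)
    (hs : HasDensityGE x₀ x₁ s) (ht : HasDensityGE x₁ x₂ t) : HasDensityGE x₀ x₂ (s + t) := by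
  intro ε hε
  filter_upwards [hs (ε / 2) (by positivity), ht (ε / 2) (by positivity)] with n h1 h2
  have hd : Disjoint (primeWindow x₀ x₁ n) (primeWindow x₁ x₂ n) := by
    rw [Finset.disjoint_left]
    intro p hp hp'
    rw [mem_primeWindow] at hp hp'
    linarith [hp.2.2.2, hp'.2.2.1]
  have hsub : primeWindow x₀ x₁ n ∪ primeWindow x₁ x₂ n ⊆ primeWindow x₀ x₂ n := by
    intro p hp
    rw [Finset.mem_union, mem_primeWindow, mem_primeWindow] at hp
    rw [mem_primeWindow]
    have hp0 : (0 : ℝ) ≤ p := Nat.cast_nonneg _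
    rcases hp with ⟨h1, h2, h3, h4⟩ | ⟨h1, h2, h3, h4⟩
    · exact ⟨h1, h2, h3, h4.trans_le (mul_le_mul_of_nonneg_right h12 hp0)⟩
    · exact ⟨h1, h2, (mul_le_mul_of_nonneg_right h01 hp0).trans h3, h4⟩
  calc (s + t - ε) * n = (s - ε / 2) * n + (t - ε / 2) * n := by ring
    _ ≤ _ := add_le_add h1 h2
    _ = ∑ p ∈ primeWindow x₀ x₁ n ∪ primeWindow x₁ x₂ n, (minStep n p : ℝ) * Real.log p :=
      (Finset.sum_union hd).symm
    _ ≤ _ := Finset.sum_le_sum_of_subset_of_nonneg hsub fun p _ _ =>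
      mul_nonneg (Nat.cast_nonneg _) (Real.log_natCast_nonneg p)

lemma tendsto_theta_mul_div {β : ℝ} (hβ : 0 < β) :
    Tendsto (fun n : ℕ => Chebyshev.theta (β * n) / n) atTop (𝓝 β) := by
  have h1 : Tendsto (fun n : ℕ => β * (n : ℝ)) atTop atTop :=
    tendsto_natCast_atTop_atTop.const_mul_atTop hβ
  have h2 := (tendsto_theta_div_self.comp h1).mul_const β
  rw [one_mul] at h2
  refine h2.congr' ?_
  filter_upwards [eventually_gt_atTop 0] with n hn
  have : (n : ℝ) ≠ 0 := by positivity
  simp only [Function.comp_apply]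
  field_simp

lemma tendsto_log_mul_div {β : ℝ} (hβ : 0 < β) :
    Tendsto (fun n : ℕ => Real.log (β * n) / n) atTop (𝓝 0) := by
  have h1 : Tendsto (fun n : ℕ => β * (n : ℝ)) atTop atTop :=
    tendsto_natCast_atTop_atTop.const_mul_atTop hβ
  have h0 : Tendsto (fun x : ℝ => Real.log x / x) atTop (𝓝 0) :=
    Real.isLittleO_log_id_atTop.tendsto_div_nhds_zero
  have h2 := (h0.comp h1).mul_const β
  rw [zero_mul] at h2
  refine h2.congr' ?_
  filter_upwards [eventually_gt_atTop 0] with n hn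
  have : (n : ℝ) ≠ 0 := by positivity
  simp only [Function.comp_apply]
  field_simp

lemma theta_sub_theta_sub_log_le {α β : ℝ} (hβ : 1 ≤ β) {t : Finset ℕ}
    (ht : ∀ p : ℕ, p.Prime → α < p → (p : ℝ) < β → p ∈ t) :
    Chebyshev.theta β - Chebyshev.theta α - Real.log β ≤ ∑ p ∈ t, Real.log p := by
  classical
  unfold Chebyshev.theta
  set A := (Finset.Ioc 0 ⌊α⌋₊).filter Nat.Prime
  set B := (Finset.Ioc 0 ⌊β⌋₊).filter Nat.Prime
  have hsub : B ⊆ (A ∪ t) ∪ {⌊β⌋₊} := by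
    intro p hp
    simp only [B, A, Finset.mem_filter, Finset.mem_Ioc, Finset.mem_union,
      Finset.mem_singleton] at hp ⊢
    by_cases h1 : p ≤ ⌊α⌋₊
    · exact Or.inl (Or.inl ⟨⟨hp.1.1, h1⟩, hp.2⟩)
    have h1' : α < p := Nat.lt_of_floor_lt (not_le.1 h1)
    rcases hp.1.2.lt_or_eq with h2 | h2
    · refine Or.inl (Or.inr (ht p hp.2 h1' ?_))
      exact lt_of_lt_of_le (by exact_mod_cast h2) (Nat.floor_le (by linarith))
    · exact Or.inr h2
  have hpos : ∀ p : ℕ, 0 ≤ Real.log p := Real.log_natCast_nonneg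
  have h1 : ∑ p ∈ B, Real.log p ≤ ∑ p ∈ A, Real.log p + ∑ p ∈ t, Real.log p +
      Real.log (⌊β⌋₊ : ℕ) := by
    refine (Finset.sum_le_sum_of_subset_of_nonneg hsub fun p _ _ => hpos p).trans ?_
    have e1 := Finset.sum_union_inter (s₁ := A ∪ t) (s₂ := {⌊β⌋₊}) (f := fun p : ℕ => Real.log p)
    have e2 := Finset.sum_union_inter (s₁ := A) (s₂ := t) (f := fun p : ℕ => Real.log p)
    have e3 := Finset.sum_nonneg (s := (A ∪ t) ∩ {⌊β⌋₊}) fun p _ => hpos p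
    have e4 := Finset.sum_nonneg (s := A ∩ t) fun p _ => hpos p
    rw [Finset.sum_singleton] at e1
    linarith
  have h2 : Real.log (⌊β⌋₊ : ℕ) ≤ Real.log β :=
    Real.log_le_log (by exact_mod_cast Nat.floor_pos.2 hβ) (Nat.floor_le (by linarith))
  linarith

lemma hasDensityGE_of_forall {x₀ x₁ : ℝ} {w : ℕ} (h0 : 0 < x₀) (h01 : x₀ < x₁) (h33 : 1 ≤ 33 * x₀)
    (hw : ∀ n p : ℕ, 0 < p → x₀ * p < n → n < x₁ * p → w ≤ minStep n p) :
    HasDensityGE x₀ x₁ (w * (x₀⁻¹ - x₁⁻¹)) := by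
  intro ε hε
  have h1 : 0 < x₁ := h0.trans h01
  have lim := (((tendsto_theta_mul_div (inv_pos.2 h0)).sub (tendsto_theta_mul_div
      (inv_pos.2 h1))).sub
    (tendsto_log_mul_div (inv_pos.2 h0))).const_mul (w : ℝ)
  rw [sub_zero] at lim
  filter_upwards [lim.eventually_const_lt (show w * (x₀⁻¹ - x₁⁻¹) - ε < _ by linarith),
    eventually_gt_atTop 0, (tendsto_natCast_atTop_atTop.const_mul_atTop
      (inv_pos.2 h0)).eventually_ge_atTop 1]
    with n hn hn0 hn1
  have hn0' : (0 : ℝ) < n := by exact_mod_cast hn0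
  have key := theta_sub_theta_sub_log_le (α := x₁⁻¹ * n) (t := (primeWindow x₀ x₁ n).filter
    fun p => w ≤ minStep n p) hn1 (by
      intro p hp hp1 hp2
      have e2 : x₀ * p < n := by rwa [lt_inv_mul_iff₀ h0] at hp2
      have e1 : n < x₁ * p := by rwa [inv_mul_lt_iff₀ h1] at hp1
      rw [Finset.mem_filter, mem_primeWindow]
      refine ⟨⟨?_, hp, e2.le, e1⟩, hw n p hp.pos e2 e1⟩
      have : (p : ℝ) ≤ 33 * n := by nlinarith [Nat.cast_nonneg (α := ℝ) p]
      exact_mod_cast this)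
  have hsum : ∑ p ∈ (primeWindow x₀ x₁ n).filter (fun p => w ≤ minStep n p), (w : ℝ) * Real.log p ≤
      ∑ p ∈ primeWindow x₀ x₁ n, (minStep n p : ℝ) * Real.log p := by
    refine le_trans (Finset.sum_le_sum (g := fun p : ℕ => (minStep n p : ℝ) * Real.log p)
      fun p hp => ?_) (Finset.sum_le_sum_of_subset_of_nonneg
      (Finset.filter_subset _ _) fun p _ _ => mul_nonneg (Nat.cast_nonneg _)
        (Real.log_natCast_nonneg p))
    exact mul_le_mul_of_nonneg_right (by exact_mod_cast (Finset.mem_filter.1 hp).2)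
      (Real.log_natCast_nonneg p)
  refine le_trans ?_ hsum
  rw [← Finset.mul_sum]
  refine le_trans ?_ (mul_le_mul_of_nonneg_left key (Nat.cast_nonneg w))
  rw [← sub_div, ← sub_div, ← mul_div_assoc] at hn
  exact ((lt_div_iff₀ hn0').1 hn).le

/-- `10⁹` times the length of the set of `1 / x` with `x` in `k` plus the Farey interval. -/
def gainAt (a b c d k : ℕ) : ℕ :=
  Nat.div (nat_lit 1000000000) (Nat.mul (Nat.add a (Nat.mul k b)) (Nat.add c (Nat.mul k d)))

def gain (a b c d : ℕ) : ℕ :=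
  Nat.add (Bool.rec (nat_lit 0) (gainAt a b c d (nat_lit 0)) (Nat.ble b (Nat.mul (nat_lit 33) a)))
    (windowSum (gainAt a b c d) (nat_lit 10) (nat_lit 1))

lemma windowSum_eq (f : ℕ → ℕ) (m a : ℕ) : windowSum f m a = ∑ i ∈ Finset.range m, f (a + i) := by
  induction m generalizing a with
  | zero => rfl
  | succ m ih =>
    rw [windowSum_succ, ih, Finset.sum_range_succ', add_comm]
    simp only [add_zero, add_assoc, add_comm 1]

/-- The summands of `gain`. -/
def gainTerm (a b c d k : ℕ) : ℕ := if k = 0 ∧ 33 * a < b then 0 else gainAt a b c d k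

lemma gain_eq (a b c d : ℕ) : gain a b c d = ∑ k ∈ Finset.range 11, gainTerm a b c d k := by
  unfold gain
  rw [Finset.sum_range_succ', windowSum_eq, add_comm (Finset.sum _ _)]
  show (Bool.rec 0 (gainAt a b c d 0) (Nat.ble b (33 * a)) : ℕ) + _ = _
  congr 1
  · unfold gainTerm
    rcases h : Nat.ble b (33 * a) with _ | _
    · have : ¬ b ≤ 33 * a := fun h' => by rw [Nat.ble_eq_true_of_le h'] at h; cases h
      rw [if_pos ⟨rfl, by omega⟩]
    · have := Nat.le_of_ble_eq_true h
      rw [if_neg (by omega)]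

/-- Sum of the weights times gains over the Farey intervals of order `91` from `a / b, c / d` on. -/
def fareyTotal (m a b c d acc : ℕ) : ℕ :=
  Nat.rec (fun _ _ _ _ acc => acc)
    (fun _ ih a b c d acc => forceNat (weight (Nat.add a c) (Nat.add b d)) fun w =>
      forceNat (gain a b c d) fun g => forceNat (Nat.add acc (Nat.mul w g)) fun acc =>
      Bool.rec (forceNat (Nat.div (Nat.add (nat_lit 91) b) d) fun k =>
        forceNat (Nat.sub (Nat.mul k c) a) fun c' => forceNat (Nat.sub (Nat.mul k d) b) fun d' =>
        ih c d c' d' acc) acc (Nat.beq c d)) m a b c d acc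

lemma fareyTotal_succ (m a b c d acc : ℕ) : fareyTotal (m + 1) a b c d acc =
    if c = d then acc + weight (a + c) (b + d) * gain a b c d
    else fareyTotal m c d ((91 + b) / d * c - a) ((91 + b) / d * d - b)
      (acc + weight (a + c) (b + d) * gain a b c d) := by
  have e : fareyTotal (m + 1) a b c d acc = forceNat (weight (a + c) (b + d)) fun w =>
      forceNat (gain a b c d) fun g => forceNat (acc + w * g) fun acc =>
      Bool.rec (forceNat ((91 + b) / d) fun k =>
        forceNat (k * c - a) fun c' => forceNat (k * d - b) fun d' =>
        fareyTotal m c d c' d' acc) acc (Nat.beq c d) := rfl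
  rw [e]
  simp only [forceNat_eq]
  rcases h : Nat.beq c d with _ | _
  · rw [if_neg (Nat.ne_of_beq_eq_false h)]
  · rw [if_pos (Nat.eq_of_beq_eq_true h)]

lemma hasDensityGE_farey {a b c d : ℕ} (hb : 0 < b) (hd : 0 < d) (hdet : b * c = a * d + 1)
    (hbd : 91 < b + d) (k : ℕ) : HasDensityGE (k + a / b) (k + c / d)
      (weight (a + c) (b + d) * (gainTerm a b c d k / 10 ^ 9)) := by
  by_cases h0 : k = 0 ∧ 33 * a < b
  · have : gainTerm a b c d k = 0 := if_pos h0
    rw [this]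
    simpa using hasDensityGE_zero _ _
  have hg : gainTerm a b c d k = 10 ^ 9 / ((a + k * b) * (c + k * d)) := if_neg h0
  have hb' : (0 : ℝ) < b := by exact_mod_cast hb
  have hd' : (0 : ℝ) < d := by exact_mod_cast hd
  have hdet' : (b * c : ℝ) = a * d + 1 := by exact_mod_cast hdet
  have h33 : b ≤ 33 * (a + k * b) := by
    rcases Nat.eq_zero_or_pos k with rfl | hk
    · omega
    · nlinarith [Nat.mul_le_mul_right b hk]
  have h33' : (b : ℝ) ≤ 33 * (a + k * b) := by exact_mod_cast h33
  have e0 : (k + a / b : ℝ) = (a + k * b) / b := by field_simp; ring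
  have e1 : (k + c / d : ℝ) = (c + k * d) / d := by field_simp; ring
  have p0 : (0 : ℝ) < a + k * b := by linarith
  have p1 : (0 : ℝ) < c + k * d := by
    have : 0 < c := Nat.pos_of_ne_zero fun h => by simp [h] at hdet
    positivity
  have main : HasDensityGE (k + a / b) (k + c / d)
      (weight (a + c) (b + d) * ((k + a / b : ℝ)⁻¹ - (k + c / d : ℝ)⁻¹)) := by
    refine hasDensityGE_of_forall ?_ ?_ ?_ ?_
    · rw [e0]; positivity
    · rw [add_lt_add_iff_left, div_lt_div_iff₀ hb' hd']; linarith
    · rw [e0, ← mul_div_assoc, le_div_iff₀ hb']; linarith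
    · intro n p hp h1 h2
      refine le_minStep fun κ => ?_
      have hp' : (0 : ℤ) < p := by exact_mod_cast hp
      have hmod : stepFn n p κ = stepFn (n - k * p) p κ := by
        rw [← stepFn_emod hp' n, ← stepFn_emod hp' (n - k * p), Int.sub_mul_emod_self_right]
      rw [hmod]
      refine weight_le_stepFn_of_lt hdet hbd hp' ?_ ?_ κ
      · rw [e0, div_mul_eq_mul_div, div_lt_iff₀ hb'] at h1
        have : (a * p : ℝ) < b * (n - k * p) := by linarith
        exact_mod_cast this
      · rw [e1, div_mul_eq_mul_div, lt_div_iff₀ hd'] at h2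
        have : (d * (n - k * p) : ℝ) < c * p := by linarith
        exact_mod_cast this
  refine main.mono (mul_le_mul_of_nonneg_left ?_ (Nat.cast_nonneg _))
  have h1 : (gainTerm a b c d k : ℝ) ≤ 10 ^ 9 / ((a + k * b) * (c + k * d)) := by
    rw [hg]
    refine Nat.cast_div_le.trans (le_of_eq ?_)
    push_cast
    norm_num
  have h2 : ((k + a / b : ℝ)⁻¹ - (k + c / d : ℝ)⁻¹) = 1 / ((a + k * b) * (c + k * d)) := by
    rw [e0, e1, inv_div, inv_div, div_sub_div _ _ p0.ne' p1.ne']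
    congr 1
    linear_combination hdet'
  rw [h2]
  rw [div_le_iff₀ (by positivity)]
  calc _ ≤ _ := h1
    _ = _ := by ring

lemma fareyTotal_le (m a b c d acc : ℕ) (hb : 0 < b) (hd : 0 < d) (hdet : b * c = a * d + 1)
    (hd91 : d ≤ 91) (hbd : 91 < b + d) (hcd : c ≤ d) :
    ∃ s : ℕ → ℝ, (∀ k : ℕ, HasDensityGE (k + a / b) (k + 1) (s k)) ∧
      (fareyTotal m a b c d acc : ℝ) ≤ acc + 10 ^ 9 * ∑ k ∈ Finset.range 11, s k := by
  induction m generalizing a b c d acc with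
  | zero =>
    exact ⟨fun _ => 0, fun k => hasDensityGE_zero _ _, by simp [show fareyTotal 0 a b c d acc =
      acc from rfl]⟩
  | succ m ih =>
    rw [fareyTotal_succ]
    have hd' : (0 : ℝ) < d := by exact_mod_cast hd
    have hb' : (0 : ℝ) < b := by exact_mod_cast hb
    set W := weight (a + c) (b + d)
    have hsum : (W * gain a b c d : ℝ) =
        10 ^ 9 * ∑ k ∈ Finset.range 11, W * ((gainTerm a b c d k : ℝ) / 10 ^ 9) := by
      rw [gain_eq, Finset.mul_sum]
      push_cast
      rw [Finset.mul_sum]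
      exact Finset.sum_congr rfl fun k _ => by ring
    split_ifs with h
    · refine ⟨fun k => W * ((gainTerm a b c d k : ℝ) / 10 ^ 9), fun k => ?_, ?_⟩
      · have := hasDensityGE_farey hb hd hdet hbd k
        have e : (c / d : ℝ) = 1 := by rw [h, div_self hd'.ne']
        rwa [e] at this
      · push_cast
        rw [← hsum]
    · have hcd' : c < d := lt_of_le_of_ne hcd h
      set k := (91 + b) / d
      have k1 : k * d ≤ 91 + b := Nat.div_mul_le_self _ _
      have k2 : 91 + b < (k + 1) * d := by
        have := Nat.lt_mul_div_succ (91 + b) hd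
        rwa [mul_comm] at this
      have k3 : b < k * d := by nlinarith
      have hc : 0 < c := Nat.pos_of_ne_zero fun h => by simp [h] at hdet
      have k4 : a ≤ k * c := by
        by_contra! hlt
        have : b * c < k * d * c := Nat.mul_lt_mul_of_pos_right k3 hc
        nlinarith
      obtain ⟨c', hc'⟩ := Nat.exists_eq_add_of_le k4
      obtain ⟨d', hd''⟩ := Nat.exists_eq_add_of_lt k3
      have ec : k * c - a = c' := by omega
      have ed : k * d - b = d' + 1 := by omega
      rw [ec, ed]
      have det' : d * c' = c * (d' + 1) + 1 := by
        have e1 : d * (k * c) = d * a + d * c' := by rw [hc']; ring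
        have e2 : c * (k * d) = c * b + c * (d' + 1) := by rw [hd'']; ring
        nlinarith
      obtain ⟨s, hs1, hs2⟩ := ih c d c' (d' + 1) (acc + W * gain a b c d) hd (by omega) det'
        (by omega) (by nlinarith) (by
          by_contra! hlt
          nlinarith [Nat.mul_le_mul (show c + 1 ≤ d from hcd') (show d' + 2 ≤ c' from hlt)])
      refine ⟨fun k => W * ((gainTerm a b c d k : ℝ) / 10 ^ 9) + s k, fun k => ?_, ?_⟩
      · refine (hasDensityGE_farey hb hd hdet hbd k).add ?_ ?_ (hs1 k)
        · rw [add_le_add_iff_left, div_le_div_iff₀ hb' hd']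
          have : (b * c : ℝ) = a * d + 1 := by exact_mod_cast hdet
          linarith
        · rw [add_le_add_iff_left, div_le_one hd']
          exact_mod_cast hcd
      · refine hs2.trans (le_of_eq ?_)
        push_cast
        rw [hsum, Finset.sum_add_distrib]
        ring

set_option maxRecDepth 100000 in
lemma le_fareyTotal : 176300000000 ≤ fareyTotal 2552 0 1 1 91 0 := by
  refine Nat.le_of_ble_eq_true ?_
  decide +kernel

/-- The primes `p ≤ 33 n` save at least `176.3 n` in the logarithm of the denominator. -/
theorem hasDensityGE_total : HasDensityGE 0 11 (1763 / 10) := by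
  obtain ⟨s, hs1, hs2⟩ := fareyTotal_le 2552 0 1 1 91 0 (by norm_num) (by norm_num) (by norm_num)
    (by norm_num) (by norm_num) (by norm_num)
  have h : ∀ m : ℕ, HasDensityGE 0 m (∑ k ∈ Finset.range m, s k) := by
    intro m
    induction m with
    | zero => simpa using hasDensityGE_zero 0 0
    | succ m ih =>
      rw [Finset.sum_range_succ]
      push_cast
      refine ih.add (Nat.cast_nonneg m) (by linarith) ?_
      simpa using hs1 m
  have h11 := h 11
  norm_num only at h11
  refine h11.mono ?_
  have : ((176300000000 : ℕ) : ℝ) ≤ fareyTotal 2552 0 1 1 91 0 := by exact_mod_cast le_fareyTotal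
  push_cast at this hs2
  linarith

end

section
open Polynomial

/-- The numerator of a proper fraction with denominator `∏ (X + k) ^ m` is recovered from the
truncated local expansions at the poles. -/
theorem eq_sum_trunc_mul_prod {F : Type*} [Field F] {ι : Type*} [DecidableEq ι] (K : Finset ι)
    (v : ι → F)
    (hv : Set.InjOn v K) (m : ℕ) (N : F[X]) (hN : N.degree < (m * K.card : ℕ))
    (f : ι → PowerSeries F)
    (hf : ∀ k ∈ K, f k * (((∏ j ∈ K.erase k, (X + C (v j)) ^ m).comp (X - C (v k)) : F[X]) :
      PowerSeries F) = (N.comp (X - C (v k)) : F[X])) :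
    N = ∑ k ∈ K, ((f k).trunc m).comp (X + C (v k)) * ∏ j ∈ K.erase k, (X + C (v j)) ^ m := by
  set E : ι → F[X] := fun k => ∏ j ∈ K.erase k, (X + C (v j)) ^ m with hE
  have hEdeg : ∀ k ∈ K, (E k).degree = (m * (K.card - 1) : ℕ) := by
    intro k hk
    rw [hE, degree_prod]
    simp only [degree_pow, degree_X_add_C, nsmul_eq_mul, mul_one, Finset.sum_const,
      Finset.card_erase_of_mem hk]
    push_cast
    ring
  rw [← sub_eq_zero]
  set D := N - ∑ k ∈ K, ((f k).trunc m).comp (X + C (v k)) * E k with hD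
  have hDdeg : D.degree < (m * K.card : ℕ) := by
    refine lt_of_le_of_lt (degree_sub_le _ _) (max_lt hN ?_)
    refine lt_of_le_of_lt (degree_sum_le _ _) ?_
    rw [Finset.sup_lt_iff (WithBot.bot_lt_coe _)]
    intro k hk
    by_cases h0 : ((f k).trunc m).comp (X + C (v k)) = 0
    · rw [h0, zero_mul, degree_zero]; exact WithBot.bot_lt_coe _
    rw [degree_mul, hEdeg k hk]
    have h1 : (((f k).trunc m).comp (X + C (v k))).degree < (m : ℕ) := by
      rw [degree_eq_natDegree h0, natDegree_comp, natDegree_X_add_C, mul_one]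
      rcases Nat.eq_zero_or_pos m with rfl | hm
      · exact absurd (by rw [show (f k).trunc 0 = 0 from PowerSeries.trunc_zero' .., zero_comp]) h0
      · have : (f k).trunc m ≠ 0 := fun h => h0 (by rw [h, zero_comp])
        exact Nat.cast_lt.2 ((natDegree_lt_iff_degree_lt this).2 (PowerSeries.degree_trunc_lt _ _))
    have hc : 0 < K.card := Finset.card_pos.2 ⟨k, hk⟩
    rw [degree_eq_natDegree h0] at h1 ⊢
    norm_cast at h1 ⊢
    calc _ < m + m * (K.card - 1) := by omega
      _ = m * (K.card - 1 + 1) := by ring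
      _ = _ := by rw [Nat.sub_add_cancel hc]
  have hdvd : ∀ k ∈ K, (X + C (v k)) ^ m ∣ D := by
    intro k hk
    have h1 : D = (N - ((f k).trunc m).comp (X + C (v k)) * E k) -
        ∑ j ∈ K.erase k, ((f j).trunc m).comp (X + C (v j)) * E j := by
      rw [hD, ← Finset.add_sum_erase _ _ hk]; ring
    rw [h1]
    refine dvd_sub ?_ (Finset.dvd_sum fun j hj => ?_)
    · have h2 : (X : F[X]) ^ m ∣
          (N - ((f k).trunc m).comp (X + C (v k)) * E k).comp (X - C (v k)) := by
        rw [sub_comp, mul_comp, comp_assoc]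
        have : ((X + C (v k)).comp (X - C (v k)) : F[X]) = X := by simp
        rw [this, comp_X]
        have h3 : (PowerSeries.X : PowerSeries F) ^ m ∣
            ((N.comp (X - C (v k)) - (f k).trunc m * (E k).comp (X - C (v k)) : F[X]) :
              PowerSeries F) := by
          rw [coe_sub, coe_mul, ← hf k hk, ← sub_mul]
          refine Dvd.dvd.mul_right ?_ _
          rw [PowerSeries.X_pow_dvd_iff]
          intro j hj
          rw [map_sub, Polynomial.coeff_coe, PowerSeries.coeff_trunc, if_pos hj, sub_self]
        rw [PowerSeries.X_pow_dvd_iff] at h3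
        rw [X_pow_dvd_iff]
        intro j hj
        rw [← Polynomial.coeff_coe]
        exact h3 j hj
      obtain ⟨q, hq⟩ := h2
      refine ⟨q.comp (X + C (v k)), ?_⟩
      have h4 := congrArg (fun r : F[X] => r.comp (X + C (v k))) hq
      simp only [comp_assoc, mul_comp, pow_comp, X_comp] at h4
      have : ((X - C (v k)).comp (X + C (v k)) : F[X]) = X := by simp
      rwa [this, comp_X] at h4
    · refine Dvd.dvd.mul_left (Finset.dvd_prod_of_mem _ (Finset.mem_erase.2 ⟨?_, hk⟩)) _
      exact (Finset.mem_erase.1 hj).1.symm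
  have hcop : (K : Set ι).Pairwise (Function.onFun IsCoprime fun k => (X + C (v k)) ^ m) := by
    intro i hi j hj hij
    have := pairwise_coprime_X_sub_C (K := F) (s := fun x : F => -x) neg_injective
      (i := v i) (j := v j) (fun h => hij (hv hi hj h))
    simp only [Function.onFun, map_neg, sub_neg_eq_add] at this
    exact this.pow
  have hprod : ∏ k ∈ K, (X + C (v k)) ^ m ∣ D := Finset.prod_dvd_of_coprime hcop hdvd
  by_contra hne
  have h5 := degree_le_of_dvd hprod hne
  rw [degree_prod] at h5
  simp only [degree_pow, degree_X_add_C, nsmul_eq_mul, mul_one, Finset.sum_const] at h5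
  refine absurd (h5.trans_lt hDdeg) (not_lt.2 (le_of_eq ?_))
  push_cast; ring

/-- The sum of the coefficients of the simple poles vanishes when the degree is at most `-2`. -/
theorem sum_coeff_eq_zero_of_degree_lt {F : Type*} [Field F] {ι : Type*} [DecidableEq ι]
    (K : Finset ι) (v : ι → F)
    (m : ℕ) (N : F[X]) (hN : N.degree < (m * K.card - 1 : ℕ)) (hm : 0 < m)
    (f : ι → PowerSeries F)
    (h : N = ∑ k ∈ K, ((f k).trunc m).comp (X + C (v k)) * ∏ j ∈ K.erase k, (X + C (v j)) ^ m) :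
    ∑ k ∈ K, PowerSeries.coeff (m - 1) (f k) = 0 := by
  have h1 := coeff_eq_zero_of_degree_lt hN
  rw [h, finsetSum_coeff] at h1
  rw [← h1]
  refine Finset.sum_congr rfl fun k hk => ?_
  have hc : 0 < K.card := Finset.card_pos.2 ⟨k, hk⟩
  have hmon : (∏ j ∈ K.erase k, (X + C (v j)) ^ m : F[X]).Monic :=
    monic_prod_of_monic _ _ fun j _ => (monic_X_add_C _).pow m
  have hdeg : (∏ j ∈ K.erase k, (X + C (v j)) ^ m : F[X]).natDegree = m * (K.card - 1) := by
    rw [natDegree_prod_of_monic _ _ fun j _ => (monic_X_add_C _).pow m]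
    simp [natDegree_pow, Finset.card_erase_of_mem hk, mul_comm]
  have hlow : (((f k).trunc m).comp (X + C (v k))).natDegree ≤ m - 1 := by
    rw [natDegree_comp, natDegree_X_add_C, mul_one]
    exact Nat.le_sub_one_of_lt (by
      have := PowerSeries.natDegree_trunc_lt (f k) (m - 1)
      rwa [Nat.sub_add_cancel hm] at this)
  have e : m * K.card - 1 = (m - 1) + m * (K.card - 1) := by
    obtain ⟨c, hc'⟩ := Nat.exists_eq_add_of_lt hc
    rw [hc', show 0 + c + 1 - 1 = c by omega, show 0 + c + 1 = c + 1 by omega, mul_add,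
      mul_one]; omega
  rw [e, coeff_mul_add_eq_of_natDegree_le hlow hdeg.le, ← hdeg, hmon.coeff_natDegree, mul_one]
  have h3 : ((f k).trunc m).natDegree ≤ m - 1 := by
    have := PowerSeries.natDegree_trunc_lt (f k) (m - 1)
    rw [Nat.sub_add_cancel hm] at this
    omega
  have h4 : ((f k).trunc m).coeff (m - 1) = PowerSeries.coeff (m - 1) (f k) := by
    rw [PowerSeries.coeff_trunc, if_pos (by omega)]
  rw [← h4]
  rcases h3.lt_or_eq with h5 | h5
  · rw [coeff_eq_zero_of_natDegree_lt h5, coeff_eq_zero_of_natDegree_lt]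
    rwa [natDegree_comp, natDegree_X_add_C, mul_one]
  · rw [← h5]
    have h6 : (((f k).trunc m).comp (X + C (v k))).natDegree = ((f k).trunc m).natDegree := by
      rw [natDegree_comp, natDegree_X_add_C, mul_one]
    conv_rhs => rw [← h6]
    rw [coeff_natDegree, coeff_natDegree, leadingCoeff_comp (by simp), leadingCoeff_X_add_C,
      one_pow,
      mul_one]

end

section
open PowerSeries

/-- Power series whose `l`-th coefficient has `p`-adic valuation at least `ν - l L`. -/
def InLattice (p L : ℕ) (ν : ℤ) (f : PowerSeries ℚ) : Prop :=
  ∀ l : ℕ, padicNorm p (coeff l f) ≤ (p : ℚ) ^ ((l : ℤ) * L - ν)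

section
variable {p L : ℕ} [hp : Fact p.Prime]

lemma InLattice.mono {ν ν' : ℤ} {f : PowerSeries ℚ} (hf : InLattice p L ν f) (h : ν' ≤ ν) :
    InLattice p L ν' f := fun l =>
  (hf l).trans (zpow_le_zpow_right₀ (by exact_mod_cast hp.out.one_lt.le) (by linarith))

lemma InLattice.mul {ν μ : ℤ} {f g : PowerSeries ℚ} (hf : InLattice p L ν f)
    (hg : InLattice p L μ g) : InLattice p L (ν + μ) (f * g) := by
  intro l
  have hp0 : (p : ℚ) ≠ 0 := by exact_mod_cast hp.out.ne_zero
  rw [coeff_mul]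
  refine padicNorm.sum_le' (fun x hx => ?_) (by positivity)
  rw [Finset.HasAntidiagonal.mem_antidiagonal] at hx
  rw [padicNorm.mul]
  calc _ ≤ (p : ℚ) ^ ((x.1 : ℤ) * L - ν) * (p : ℚ) ^ ((x.2 : ℤ) * L - μ) :=
        mul_le_mul (hf _) (hg _) (padicNorm.nonneg _) (by positivity)
    _ = _ := by
        rw [← zpow_add₀ hp0, ← hx]
        congr 1
        push_cast
        ring

lemma inLattice_one {p L : ℕ} : InLattice p L 0 1 := by
  intro l
  rw [coeff_one]
  split_ifs with h
  · simp [h]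
  · rw [padicNorm.zero]; positivity

lemma InLattice.prod {ι : Type*} {s : Finset ι} {ν : ι → ℤ} {f : ι → PowerSeries ℚ}
    (h : ∀ i ∈ s, InLattice p L (ν i) (f i)) : InLattice p L (∑ i ∈ s, ν i) (∏ i ∈ s, f i) := by
  classical
  induction s using Finset.induction_on with
  | empty => simpa using inLattice_one
  | insert a s ha ih =>
    rw [Finset.sum_insert ha, Finset.prod_insert ha]
    exact (h a (Finset.mem_insert_self _ _)).mul (ih fun i hi => h i (Finset.mem_insert_of_mem hi))

lemma InLattice.pow {ν : ℤ} {f : PowerSeries ℚ} (hf : InLattice p L ν f) (m : ℕ) :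
    InLattice p L (m * ν) (f ^ m) := by
  have := InLattice.prod (s := Finset.range m) (ν := fun _ => ν) (f := fun _ => f) fun _ _ => hf
  simpa using this

lemma inLattice_C {p L : ℕ} {ν : ℤ} {c : ℚ} (hc : padicNorm p c ≤ (p : ℚ) ^ (-ν)) :
    InLattice p L ν (C c) := by
  intro l
  rw [coeff_C]
  split_ifs with h
  · simpa [h] using hc
  · rw [padicNorm.zero]; positivity

lemma InLattice.inv {ν : ℤ} {f : PowerSeries ℚ} (hf : InLattice p L ν f)
    (h0 : padicNorm p (constantCoeff f) = (p : ℚ) ^ (-ν)) : InLattice p L (-ν) f⁻¹ := by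
  have hp0 : (p : ℚ) ≠ 0 := by exact_mod_cast hp.out.ne_zero
  intro l
  induction l using Nat.strong_induction_on with
  | _ l ih =>
    rw [coeff_inv]
    have hi : padicNorm p (constantCoeff f)⁻¹ = (p : ℚ) ^ ν := by
      rw [inv_eq_one_div, padicNorm.div, padicNorm.one, h0, zpow_neg, one_div, inv_inv]
    split_ifs with hl
    · rw [hi, hl]; simp
    · rw [padicNorm.mul, padicNorm.neg, hi]
      have : padicNorm p (∑ x ∈ Finset.HasAntidiagonal.antidiagonal l, if x.2 < l then coeff x.1 f *
          coeff x.2 f⁻¹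
          else 0) ≤ (p : ℚ) ^ ((l : ℤ) * L) := by
        refine padicNorm.sum_le' (fun x hx => ?_) (by positivity)
        rw [Finset.HasAntidiagonal.mem_antidiagonal] at hx
        split_ifs with hlt
        · rw [padicNorm.mul]
          calc _ ≤ (p : ℚ) ^ ((x.1 : ℤ) * L - ν) * (p : ℚ) ^ ((x.2 : ℤ) * L - -ν) :=
                mul_le_mul (hf _) (ih _ hlt) (padicNorm.nonneg _) (by positivity)
            _ = _ := by
                rw [← zpow_add₀ hp0, ← hx]
                congr 1
                push_cast
                ring
        · rw [padicNorm.zero]; positivity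
      calc _ ≤ (p : ℚ) ^ ν * (p : ℚ) ^ ((l : ℤ) * L) :=
            mul_le_mul_of_nonneg_left this (by positivity)
        _ = _ := by rw [← zpow_add₀ hp0]; congr 1; ring

/-- The `p`-adic valuation truncated at `L`, which is `L` at zero. -/
def truncVal (p L : ℕ) (m : ℤ) : ℕ := ((Finset.Icc 1 L).filter fun j => ((p ^ j : ℕ) : ℤ) ∣ m).card

lemma truncVal_le {p L : ℕ} (m : ℤ) : truncVal p L m ≤ L := by
  refine (Finset.card_filter_le _ _).trans ?_
  simp

lemma truncVal_zero {p L : ℕ} : truncVal p L 0 = L := by simp [truncVal]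

lemma padicNorm_eq_truncVal {m : ℤ} (hm : m ≠ 0) (hlt : |m| < (p : ℤ) ^ (L + 1)) :
    padicNorm p m = (p : ℚ) ^ (-(truncVal p L m : ℤ)) := by
  have hdvd : ∀ j : ℕ, ((p ^ j : ℕ) : ℤ) ∣ m ↔ j ≤ padicValInt p m := fun j => by
    push_cast
    rw [padicValInt_dvd_iff]
    simp [hm]
  have hv : padicValInt p m ≤ L := by
    by_contra! h
    have h1 := Int.le_of_dvd (abs_pos.2 hm) ((dvd_abs _ _).2 ((hdvd (L + 1)).2 h))
    push_cast at h1
    linarith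
  have : truncVal p L m = padicValInt p m := by
    unfold truncVal
    rw [show (Finset.Icc 1 L).filter (fun j => ((p ^ j : ℕ) : ℤ) ∣ m) =
      Finset.Icc 1 (padicValInt p m) by
        ext j
        simp only [Finset.mem_filter, Finset.mem_Icc, hdvd]
        omega]
    simp
  rw [this, padicNorm.eq_zpow_of_nonzero (by exact_mod_cast hm), padicValRat.of_int]

/-- The linear power series `X + m`. -/
noncomputable def lin (m : ℤ) : PowerSeries ℚ := X + C (m : ℚ)

lemma constantCoeff_lin (m : ℤ) : constantCoeff (lin m) = m := by simp [lin]

lemma inLattice_lin {m : ℤ} (hlt : |m| < (p : ℤ) ^ (L + 1)) :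
    InLattice p L (truncVal p L m) (lin m) := by
  intro l
  unfold lin
  rw [map_add, coeff_X, coeff_C]
  rcases l with _ | _ | l
  · simp only [zero_add, Nat.cast_zero, zero_mul, zero_sub, if_true, if_neg zero_ne_one]
    rcases eq_or_ne m 0 with rfl | hm
    · simp only [Int.cast_zero, padicNorm.zero]; positivity
    · exact (padicNorm_eq_truncVal hm hlt).le
  · simp only [zero_add, if_true, if_neg one_ne_zero, add_zero, padicNorm.one, Nat.cast_one,
      one_mul]
    refine one_le_zpow₀ (by exact_mod_cast hp.out.one_lt.le) ?_
    have := truncVal_le (p := p) (L := L) m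
    omega
  · simp only [show l + 1 + 1 ≠ 1 by omega, show l + 1 + 1 ≠ 0 by omega, if_false, add_zero,
      padicNorm.zero]
    positivity

lemma inLattice_lin_inv {m : ℤ} (hm : m ≠ 0) (hlt : |m| < (p : ℤ) ^ (L + 1)) :
    InLattice p L (-(truncVal p L m : ℤ)) (lin m)⁻¹ :=
  (inLattice_lin hlt).inv (by rw [constantCoeff_lin, padicNorm_eq_truncVal hm hlt])

end

lemma sum_ite_dvd_Icc {q : ℤ} (hq : 0 < q) (k : ℤ) (a m : ℕ) :
    ((∑ j ∈ Finset.Ico a (a + m), if q ∣ (j : ℤ) - k then 1 else 0 : ℕ) : ℤ) =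
      (a + m - 1 - k) / q - (a - 1 - k) / q := by
  induction m with
  | zero => simp
  | succ m ih =>
    rw [← add_assoc, Finset.sum_Ico_succ_top (by omega), Nat.cast_add, ih]
    push_cast
    rw [show (a + (m + 1) - 1 - k : ℤ) = a + m - k by ring,
      show (a + m - 1 - k : ℤ) = a + m - k - 1 by ring]
    split_ifs with h
    · obtain ⟨c, hc⟩ := h
      have : (a + m - k - 1 : ℤ) / q = c - 1 := by
        rw [Int.ediv_eq_iff_of_pos hq, hc]
        constructor <;> linarith
      rw [this, hc, Int.mul_ediv_cancel_left _ hq.ne']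
      ring
    · rw [sub_one_ediv_of_not_dvd hq h]
      simp

lemma neg_add_one_ediv {q : ℤ} (hq : 0 < q) (a : ℤ) : (-(a + 1)) / q = -(a / q) - 1 := by
  have h1 := Int.emod_add_mul_ediv a q
  have h2 := Int.emod_lt_of_pos a hq
  have h3 := Int.emod_nonneg a hq.ne'
  rw [Int.ediv_eq_iff_of_pos hq]
  constructor <;> linarith

lemma sum_truncVal_Icc {p L : ℕ} (hp : 0 < p) (k : ℤ) {a b : ℕ} (hab : a ≤ b + 1) :
    ((∑ j ∈ Finset.Icc a b, truncVal p L (j - k) : ℕ) : ℤ) =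
      ∑ i ∈ Finset.Icc 1 L, ((b - k) / ((p : ℤ) ^ i) + (k - a) / ((p : ℤ) ^ i) + 1) := by
  unfold truncVal
  simp only [Finset.card_filter]
  rw [Finset.sum_comm]
  push_cast
  refine Finset.sum_congr rfl fun i _ => ?_
  have hq : (0 : ℤ) < (p : ℤ) ^ i := by positivity
  obtain ⟨m, hm⟩ := Nat.exists_eq_add_of_le hab
  have h := sum_ite_dvd_Icc hq k a m
  push_cast at h
  rw [← Finset.Ico_add_one_right_eq_Icc, hm, h]
  have e1 : (a - 1 - k : ℤ) = -((k - a) + 1) := by ring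
  have e2 : (a + m - 1 - k : ℤ) = b - k := by
    have : (b + 1 : ℤ) = a + m := by exact_mod_cast hm
    linarith
  rw [e1, e2, neg_add_one_ediv hq]
  ring

lemma padicNorm_factorial {p L m : ℕ} [hp : Fact p.Prime] (hm : m < p ^ (L + 1)) :
    padicNorm p (m.factorial : ℚ) = (p : ℚ) ^ (-∑ i ∈ Finset.Icc 1 L, (m : ℤ) / (p : ℤ) ^ i) := by
  rw [padicNorm.eq_zpow_of_nonzero (by exact_mod_cast m.factorial_ne_zero), padicValRat.of_nat,
    padicValNat_factorial (b := L + 1) (Nat.log_lt_of_lt_pow' (by omega) hm)]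
  push_cast
  rw [← Finset.Ico_add_one_right_eq_Icc]

end

section
open PowerSeries

/-- The poles of the rational function, up to sign. -/
def poles (n : ℕ) : Finset ℕ := Finset.Icc (29 * n + 1) (62 * n + 1)

/-- The poles of the `i`-th denominator block, up to sign. -/
def poleBlock (n i : ℕ) : Finset ℕ := Finset.Icc ((29 + i) * n + 1) ((62 - i) * n + 1)

/-- The normalizing constant of the rational function. -/
def normConst (n : ℕ) : ℚ :=
  (∏ i ∈ Finset.range 10, (((33 - 2 * i) * n).factorial : ℚ)) / ((27 * n).factorial : ℚ) ^ 6

/-- The expansion of `s ^ 10 R(s - k)` at `s = 0`. -/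
noncomputable def localSeries (n k : ℕ) : PowerSeries ℚ :=
  C (normConst n) * (C 2 * X + C ((91 * n + 2 - 2 * k : ℤ) : ℚ)) *
    ((∏ a ∈ Finset.Icc 1 (27 * n + 1), lin (a - k)) *
      ∏ b ∈ Finset.Icc (64 * n + 1) (91 * n + 1), lin (b - k)) ^ 3 *
    (∏ i ∈ Finset.range 10, ∏ j ∈ poles n \ poleBlock n i, lin (j - k)) *
    (∏ j ∈ (poles n).erase k, (lin (j - k))⁻¹) ^ 10

/-- The coefficient of `(t + k) ^ (-i)` in the partial fraction expansion. -/
noncomputable def pfCoeff (n i k : ℕ) : ℚ := coeff (10 - i) (localSeries n k)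

lemma poleBlock_subset {n i : ℕ} : poleBlock n i ⊆ poles n := by
  unfold poles poleBlock
  refine Finset.Icc_subset_Icc ?_ ?_
  · have := Nat.mul_le_mul_right n (show 29 ≤ 29 + i by omega); omega
  · have := Nat.mul_le_mul_right n (show 62 - i ≤ 62 by omega); omega

section
variable {p L : ℕ} [hp : Fact p.Prime]

lemma padicNorm_prod {ι : Type*} (s : Finset ι) (f : ι → ℚ) :
    padicNorm p (∏ i ∈ s, f i) = ∏ i ∈ s, padicNorm p (f i) := by
  classical
  induction s using Finset.induction_on with
  | empty => simp
  | insert a s ha ih => rw [Finset.prod_insert ha, Finset.prod_insert ha, padicNorm.mul, ih]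

lemma padicNorm_pow (x : ℚ) (m : ℕ) : padicNorm p (x ^ m) = padicNorm p x ^ m := by
  have := padicNorm_prod (p := p) (Finset.range m) fun _ => x
  simpa using this

lemma prod_zpow_neg {ι : Type*} (s : Finset ι) (f : ι → ℤ) {x : ℚ} (hx : x ≠ 0) :
    ∏ i ∈ s, x ^ (-f i) = x ^ (-∑ i ∈ s, f i) := by
  classical
  induction s using Finset.induction_on with
  | empty => simp
  | insert a s ha ih =>
    rw [Finset.prod_insert ha, Finset.sum_insert ha, ih, ← zpow_add₀ hx, neg_add]

lemma padicNorm_normConst {n : ℕ} (hL : 91 * n + 2 < p ^ (L + 1)) :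
    padicNorm p (normConst n) = (p : ℚ) ^ (-∑ j ∈ Finset.Icc 1 L,
      ((∑ i ∈ Finset.range 10, (91 - 2 * (29 + i)) * (n : ℤ) / (p : ℤ) ^ j) -
        6 * (27 * n / (p : ℤ) ^ j))) := by
  have hp0 : (p : ℚ) ≠ 0 := by exact_mod_cast hp.out.ne_zero
  unfold normConst
  rw [padicNorm.div, padicNorm_prod, padicNorm_pow, padicNorm_factorial (L := L) (by omega)]
  have h1 : ∀ i ∈ Finset.range 10, padicNorm p (((33 - 2 * i) * n).factorial : ℚ) =
      (p : ℚ) ^ (-∑ j ∈ Finset.Icc 1 L, (91 - 2 * (29 + i)) * (n : ℤ) / (p : ℤ) ^ j) := by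
    intro i hi
    rw [Finset.mem_range] at hi
    rw [padicNorm_factorial (L := L)]
    · congr 3
      funext j
      push_cast [show 2 * i ≤ 33 by omega]
      congr 2
      ring
    · refine lt_of_le_of_lt ?_ hL
      have := Nat.mul_le_mul_right n (show 33 - 2 * i ≤ 91 by omega)
      omega
  rw [Finset.prod_congr rfl h1, prod_zpow_neg _ _ hp0, ← zpow_natCast, ← zpow_mul, ← zpow_sub₀ hp0,
    Finset.sum_comm, Finset.sum_sub_distrib, ← Finset.mul_sum]
  congr 1
  push_cast
  ring

lemma inLattice_int_linear (a b : ℤ) : InLattice p L 0 (C (a : ℚ) * X + C (b : ℚ)) := by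
  have hInt : ∀ m : ℤ, padicNorm p m ≤ 1 := padicNorm.of_int
  intro l
  rw [map_add, coeff_C_mul, coeff_X, coeff_C]
  have h1 : (1 : ℚ) ≤ (p : ℚ) ^ ((l : ℤ) * L - 0) := by
    refine one_le_zpow₀ (by exact_mod_cast hp.out.one_lt.le) ?_
    rw [sub_zero]; positivity
  refine le_trans ?_ h1
  rcases l with _ | _ | l
  · simpa using hInt b
  · simpa using hInt a
  · simp

lemma inLattice_localSeries {n k : ℕ} (hL : 91 * n + 2 < p ^ (L + 1)) (hk : k ∈ poles n) :
    InLattice p L (∑ j ∈ Finset.Icc 1 L, stepFn n ((p : ℤ) ^ j) (k - 1)) (localSeries n k) := by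
  have hL' : (91 * n + 2 : ℤ) < (p : ℤ) ^ (L + 1) := by exact_mod_cast hL
  have hk' : 29 * n + 1 ≤ k ∧ k ≤ 62 * n + 1 := Finset.mem_Icc.1 hk
  have hlt : ∀ j : ℕ, j ≤ 91 * n + 1 → |(j : ℤ) - k| < (p : ℤ) ^ (L + 1) := by
    intro j hj
    refine lt_of_le_of_lt ?_ hL'
    rw [abs_le]; omega
  have hpole : ∀ j ∈ poles n, j ≤ 91 * n + 1 := fun j hj => by
    have := Finset.mem_Icc.1 hj; omega
  set V : ℕ → ℤ := fun j => (truncVal p L (j - k) : ℤ) with hV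
  have h1 : InLattice p L (∑ a ∈ Finset.Icc 1 (27 * n + 1), V a)
      (∏ a ∈ Finset.Icc 1 (27 * n + 1), lin (a - k)) := InLattice.prod fun a ha =>
    inLattice_lin (hlt a (by have := Finset.mem_Icc.1 ha; omega))
  have h2 : InLattice p L (∑ a ∈ Finset.Icc (64 * n + 1) (91 * n + 1), V a)
      (∏ a ∈ Finset.Icc (64 * n + 1) (91 * n + 1), lin (a - k)) := InLattice.prod fun a ha =>
    inLattice_lin (hlt a (by have := Finset.mem_Icc.1 ha; omega))
  have h3 : InLattice p L (∑ i ∈ Finset.range 10, ∑ j ∈ poles n \ poleBlock n i, V j)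
      (∏ i ∈ Finset.range 10, ∏ j ∈ poles n \ poleBlock n i, lin (j - k)) :=
    InLattice.prod fun i _ => InLattice.prod fun j hj =>
      inLattice_lin (hlt j (hpole j (Finset.mem_sdiff.1 hj).1))
  have h4 : InLattice p L (∑ j ∈ (poles n).erase k, -V j)
      (∏ j ∈ (poles n).erase k, (lin (j - k))⁻¹) := InLattice.prod fun j hj => by
    rw [Finset.mem_erase] at hj
    exact inLattice_lin_inv (by have := hj.1; omega) (hlt j (hpole j hj.2))
  have h5 := inLattice_C (L := L) (padicNorm_normConst hL).le
  have h6 : InLattice p L 0 (C 2 * X + C ((91 * n + 2 - 2 * k : ℤ) : ℚ)) :=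
    inLattice_int_linear 2 _
  refine ((((h5.mul h6).mul ((h1.mul h2).pow 3)).mul h3).mul (h4.pow 10)).mono ?_
  have e1 : ∀ i ∈ Finset.range 10, ∑ j ∈ poles n \ poleBlock n i, V j =
      ∑ j ∈ poles n, V j - ∑ j ∈ poleBlock n i, V j := fun i _ => by
    rw [← Finset.sum_sdiff (poleBlock_subset (n := n) (i := i)), add_sub_cancel_right]
  have e2 : ∑ j ∈ (poles n).erase k, -V j = L - ∑ j ∈ poles n, V j := by
    rw [← Finset.add_sum_erase _ _ hk, Finset.sum_neg_distrib]
    have : V k = L := by simp [hV, truncVal_zero]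
    rw [this]; ring
  have e3 : ∀ a b : ℕ, a ≤ b + 1 → ∑ j ∈ Finset.Icc a b, V j = ∑ i ∈ Finset.Icc 1 L,
      ((b - k : ℤ) / ((p : ℤ) ^ i) + (k - a : ℤ) / ((p : ℤ) ^ i) + 1) := fun a b hab => by
    rw [← sum_truncVal_Icc hp.out.pos _ hab]
    push_cast
    rfl
  have e4 : (L : ℤ) = ∑ j ∈ Finset.Icc 1 L, (1 : ℤ) := by simp
  have e6 : ∑ i ∈ Finset.range 10, ∑ j ∈ poles n \ poleBlock n i, V j =
      10 * ∑ j ∈ poles n, V j - ∑ i ∈ Finset.range 10, ∑ j ∈ poleBlock n i, V j := by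
    rw [Finset.sum_congr rfl e1, Finset.sum_sub_distrib, Finset.sum_const, Finset.card_range,
      nsmul_eq_mul]
    push_cast
    ring
  have e5 : ∀ i ∈ Finset.range 10, ∑ j ∈ poleBlock n i, V j = ∑ j ∈ Finset.Icc 1 L,
      (((91 - (29 + i)) * n - (k - 1 : ℤ)) / ((p : ℤ) ^ j) +
        ((k - 1 : ℤ) - (29 + i) * n) / ((p : ℤ) ^ j) + 1) := fun i hi => by
    rw [Finset.mem_range] at hi
    unfold poleBlock
    rw [e3]
    · refine Finset.sum_congr rfl fun j _ => ?_
      push_cast [show i ≤ 62 by omega]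
      congr 3 <;> ring
    · have := Nat.mul_le_mul_right n (show 29 + i ≤ 62 - i by omega); omega
  have e7 := Finset.sum_congr rfl e5
  rw [Finset.sum_comm] at e7
  rw [e6, e2, e7, e3 _ _ (by omega), e3 _ _ (by omega)]
  have key : ∑ j ∈ Finset.Icc 1 L, stepFn n ((p : ℤ) ^ j) (k - 1) ≤ ∑ j ∈ Finset.Icc 1 L,
      (((∑ i ∈ Finset.range 10, (91 - 2 * (29 + i)) * (n : ℤ) / (p : ℤ) ^ j) -
        6 * (27 * n / (p : ℤ) ^ j)) +
        3 * (((((27 * n + 1 : ℕ) : ℤ) - k : ℤ) / ((p : ℤ) ^ j) + (k - (1 : ℕ) : ℤ) / ((p : ℤ) ^ j) +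
          1) +
        ((((91 * n + 1 : ℕ) : ℤ) - k : ℤ) / ((p : ℤ) ^ j) +
          (k - (64 * n + 1 : ℕ) : ℤ) / ((p : ℤ) ^ j) + 1)) -
        (∑ i ∈ Finset.range 10, (((91 - (29 + i)) * n - (k - 1 : ℤ)) / ((p : ℤ) ^ j) +
        ((k - 1 : ℤ) - (29 + i) * n) / ((p : ℤ) ^ j) + 1)) + 10 * 1) := by
    refine Finset.sum_le_sum fun j _ => ?_
    have hq : (0 : ℤ) < (p : ℤ) ^ j := pow_pos (by exact_mod_cast hp.out.pos) _
    generalize (p : ℤ) ^ j = q at hq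
    have hneg : ∀ a : ℤ, -(a / q) ≤ -a / q + 1 := fun a => by
      have := add_ediv_le hq a (-a)
      rw [add_neg_cancel, Int.zero_ediv] at this
      linarith
    have g1 := hneg ((k - 1 : ℤ) - 27 * n)
    have g2 := hneg (64 * n - (k - 1 : ℤ))
    unfold stepFn
    simp only [Finset.sum_add_distrib, Finset.sum_sub_distrib]
    push_cast
    rw [show (27 * n + 1 - k : ℤ) = -((k - 1 : ℤ) - 27 * n) by ring,
      show (k - (64 * n + 1) : ℤ) = -(64 * n - (k - 1 : ℤ)) by ring,
      show (91 * n + 1 - k : ℤ) = 91 * n - (k - 1) by ring]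
    simp only [Finset.sum_const, Finset.card_range, nsmul_eq_mul]
    push_cast
    linarith
  refine key.trans (le_of_eq ?_)
  rw [Finset.sum_add_distrib, Finset.sum_sub_distrib, Finset.sum_add_distrib, ← Finset.mul_sum,
    ← Finset.mul_sum, ← e4, Finset.sum_add_distrib (f := fun j : ℕ => _ + 1)]
  push_cast
  ring

lemma padicNorm_pfCoeff_le {n i k : ℕ} (hi : i ≤ 10) (hL : 91 * n + 2 < p ^ (L + 1))
    (hk : k ∈ poles n) : padicNorm p (pfCoeff n i k) ≤
      (p : ℚ) ^ ((10 - i : ℤ) * L - ∑ j ∈ Finset.Icc 1 L, stepFn n ((p : ℤ) ^ j) (k - 1)) := by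
  have := inLattice_localSeries hL hk (10 - i)
  push_cast [hi] at this
  exact this

end

end

section
open PowerSeries

lemma rescale_neg_one_lin (m : ℤ) : rescale (-1 : ℚ) (lin m) = -lin (-m) := by
  have hC : rescale (-1 : ℚ) (C (m : ℚ)) = C (m : ℚ) := by
    ext l
    rw [coeff_rescale, coeff_C]
    split_ifs with h <;> simp [h]
  unfold lin
  rw [map_add, rescale_neg_one_X, hC, Int.cast_neg, map_neg]
  ring

lemma rescale_C_int (a m : ℚ) : rescale a (C m) = C m := by
  ext l
  rw [coeff_rescale, coeff_C]
  split_ifs with h <;> simp [h]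

lemma lin_mul_inv {m : ℤ} (hm : m ≠ 0) : lin m * (lin m)⁻¹ = 1 :=
  PowerSeries.mul_inv_cancel _ (by rw [constantCoeff_lin]; exact_mod_cast hm)

lemma rescale_neg_one_lin_inv {m : ℤ} (hm : m ≠ 0) :
    rescale (-1 : ℚ) (lin m)⁻¹ = -(lin (-m))⁻¹ := by
  have h1 : rescale (-1 : ℚ) (lin m)⁻¹ * -lin (-m) = 1 := by
    rw [← rescale_neg_one_lin, ← map_mul, mul_comm, lin_mul_inv hm, map_one]
  have h2 := lin_mul_inv (neg_ne_zero.2 hm)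
  linear_combination -(lin (-m))⁻¹ * h1 - rescale (-1 : ℚ) (lin m)⁻¹ * h2

lemma prod_neg_lin {s : Finset ℕ} (hs : Even s.card) (f : ℕ → ℤ) :
    ∏ j ∈ s, -lin (f j) = ∏ j ∈ s, lin (f j) := by
  rw [Finset.prod_neg, hs.neg_one_pow, one_mul]

lemma prod_reflect {s t : Finset ℕ} {h : ℕ} (hs : ∀ j ∈ s, j ≤ h ∧ h - j ∈ t)
    (ht : ∀ j ∈ t, j ≤ h ∧ h - j ∈ s) {M : Type*} [CommMonoid M] (f g : ℕ → M)
    (hfg : ∀ j ∈ s, f j = g (h - j)) : ∏ j ∈ s, f j = ∏ j ∈ t, g j := by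
  refine Finset.prod_bij' (fun j _ => h - j) (fun j _ => h - j) (fun j hj => (hs j hj).2)
    (fun j hj => (ht j hj).2) (fun j hj => ?_) (fun j hj => ?_) hfg
  · have := (hs j hj).1; omega
  · have := (ht j hj).1; omega

lemma card_poles (n : ℕ) : (poles n).card = 33 * n + 1 := by
  simp only [poles, Nat.card_Icc]; omega

lemma mem_poles_reflect {n k : ℕ} (hk : k ∈ poles n) :
    k ≤ 91 * n + 2 ∧ 91 * n + 2 - k ∈ poles n := by
  simp only [poles, Finset.mem_Icc] at hk ⊢
  omega

lemma mem_poleBlock_reflect {n i k : ℕ} (hi : i ∈ Finset.range 10) (hk : k ∈ poles n) :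
    91 * n + 2 - k ∈ poleBlock n i ↔ k ∈ poleBlock n i := by
  simp only [poles, poleBlock, Finset.mem_Icc, Finset.mem_range] at hi hk ⊢
  have : (29 + i) * n + (62 - i) * n = 91 * n := by rw [← add_mul]; congr 1; omega
  omega

lemma card_poles_sdiff {n i : ℕ} (hi : i ∈ Finset.range 10) :
    (poles n \ poleBlock n i).card = 2 * (i * n) := by
  rw [Finset.card_sdiff_of_subset poleBlock_subset, card_poles]
  rw [Finset.mem_range] at hi
  have h2 : (62 - i) * n = (29 + i) * n + (33 - 2 * i) * n := by rw [← add_mul]; congr 1; omega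
  have h1 : (33 - 2 * i) * n + 2 * (i * n) = 33 * n := by
    rw [← mul_assoc, ← add_mul]; congr 1; omega
  simp only [poleBlock, Nat.card_Icc]
  omega

lemma localSeries_reflect {n k : ℕ} (hk : k ∈ poles n) :
    localSeries n (91 * n + 2 - k) = -rescale (-1 : ℚ) (localSeries n k) := by
  have hk' : 29 * n + 1 ≤ k ∧ k ≤ 62 * n + 1 := Finset.mem_Icc.1 hk
  have hcast : ((91 * n + 2 - k : ℕ) : ℤ) = 91 * n + 2 - k := by
    have := (mem_poles_reflect hk).1
    push_cast [this]
    ring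
  have hrefl : ∀ j : ℕ, j ≤ 91 * n + 2 → lin (j - (91 * n + 2 - k : ℕ)) =
      lin (-((91 * n + 2 - j : ℕ) - k : ℤ)) := fun j hj => by
    rw [hcast]; push_cast [hj]; congr 1; ring
  have h1 : (∏ a ∈ Finset.Icc 1 (27 * n + 1), lin (a - (91 * n + 2 - k : ℕ))) =
      ∏ b ∈ Finset.Icc (64 * n + 1) (91 * n + 1), lin (-(b - k)) := by
    refine prod_reflect (h := 91 * n + 2) (fun j hj => ?_) (fun j hj => ?_) _ _ fun j hj => ?_
    · rw [Finset.mem_Icc] at *; omega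
    · rw [Finset.mem_Icc] at *; omega
    · exact hrefl j (by rw [Finset.mem_Icc] at hj; omega)
  have h2 : (∏ a ∈ Finset.Icc (64 * n + 1) (91 * n + 1), lin (a - (91 * n + 2 - k : ℕ))) =
      ∏ b ∈ Finset.Icc 1 (27 * n + 1), lin (-(b - k)) := by
    refine prod_reflect (h := 91 * n + 2) (fun j hj => ?_) (fun j hj => ?_) _ _ fun j hj => ?_
    · rw [Finset.mem_Icc] at *; omega
    · rw [Finset.mem_Icc] at *; omega
    · exact hrefl j (by rw [Finset.mem_Icc] at hj; omega)
  have h3 : ∀ i ∈ Finset.range 10, ∏ j ∈ poles n \ poleBlock n i,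
      lin (j - (91 * n + 2 - k : ℕ)) = ∏ j ∈ poles n \ poleBlock n i, lin (-(j - k)) := by
    intro i hi
    have : ∀ j ∈ poles n \ poleBlock n i, j ≤ 91 * n + 2 ∧
        91 * n + 2 - j ∈ poles n \ poleBlock n i := fun j hj => by
      rw [Finset.mem_sdiff] at *
      exact ⟨(mem_poles_reflect hj.1).1, (mem_poles_reflect hj.1).2,
        by rw [mem_poleBlock_reflect hi hj.1]; exact hj.2⟩
    exact prod_reflect this this _ _ fun j hj => hrefl j (this j hj).1
  have h4 : ∏ j ∈ (poles n).erase (91 * n + 2 - k), (lin (j - (91 * n + 2 - k : ℕ)))⁻¹ =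
      ∏ j ∈ (poles n).erase k, (lin (-(j - k)))⁻¹ := by
    refine prod_reflect (h := 91 * n + 2) (fun j hj => ?_) (fun j hj => ?_) _ _ fun j hj => ?_
    · rw [Finset.mem_erase] at *
      refine ⟨(mem_poles_reflect hj.2).1, ?_, (mem_poles_reflect hj.2).2⟩
      have := (mem_poles_reflect hj.2).1
      have := hj.1
      omega
    · rw [Finset.mem_erase] at *
      refine ⟨(mem_poles_reflect hj.2).1, ?_, (mem_poles_reflect hj.2).2⟩
      have := (mem_poles_reflect hj.2).1
      omega
    · rw [Finset.mem_erase] at hj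
      rw [hrefl j (mem_poles_reflect hj.2).1]
  have h12 : rescale (-1 : ℚ) ((∏ a ∈ Finset.Icc 1 (27 * n + 1), lin (a - k)) *
      ∏ b ∈ Finset.Icc (64 * n + 1) (91 * n + 1), lin (b - k)) =
      (∏ b ∈ Finset.Icc (64 * n + 1) (91 * n + 1), lin (-(b - k))) *
      ∏ a ∈ Finset.Icc 1 (27 * n + 1), lin (-(a - k)) := by
    simp only [map_mul, map_prod, rescale_neg_one_lin, Finset.prod_neg, Nat.card_Icc]
    rw [show 27 * n + 1 + 1 - 1 = 27 * n + 1 by omega,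
      show 91 * n + 1 + 1 - (64 * n + 1) = 27 * n + 1 by omega]
    have : ((-1 : PowerSeries ℚ) ^ (27 * n + 1)) * (-1) ^ (27 * n + 1) = 1 := by
      rw [← mul_pow]; simp
    linear_combination ((∏ b ∈ Finset.Icc (64 * n + 1) (91 * n + 1), lin (-(b - k))) *
      ∏ a ∈ Finset.Icc 1 (27 * n + 1), lin (-(a - k))) * this
  have h33 : rescale (-1 : ℚ) (∏ i ∈ Finset.range 10, ∏ j ∈ poles n \ poleBlock n i,
      lin (j - k)) = ∏ i ∈ Finset.range 10, ∏ j ∈ poles n \ poleBlock n i, lin (-(j - k)) := by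
    rw [map_prod]
    refine Finset.prod_congr rfl fun i hi => ?_
    simp only [map_prod, rescale_neg_one_lin]
    exact prod_neg_lin (by rw [card_poles_sdiff hi]; exact even_two_mul _) _
  have h44 : rescale (-1 : ℚ) (∏ j ∈ (poles n).erase k, (lin (j - k))⁻¹) ^ 10 =
      (∏ j ∈ (poles n).erase k, (lin (-(j - k)))⁻¹) ^ 10 := by
    rw [map_prod, Finset.prod_congr rfl fun (j : ℕ) hj => rescale_neg_one_lin_inv (m := (j : ℤ) - k)
      (by have := (Finset.mem_erase.1 hj).1; omega), Finset.prod_neg, mul_pow, ← pow_mul,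
      (show Even (((poles n).erase k).card * 10) from ⟨((poles n).erase k).card * 5,
        by ring⟩).neg_one_pow,
      one_mul]
  have h0 : rescale (-1 : ℚ) (C 2 * X + C ((91 * n + 2 - 2 * k : ℤ) : ℚ)) =
      -(C 2 * X + C ((91 * n + 2 - 2 * (91 * n + 2 - k : ℕ) : ℤ) : ℚ)) := by
    rw [hcast, map_add, map_mul, rescale_neg_one_X, rescale_C_int, rescale_C_int,
      show (91 * n + 2 - 2 * (91 * n + 2 - k) : ℤ) = -(91 * n + 2 - 2 * k) by ring, Int.cast_neg,
      map_neg]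
    ring
  unfold localSeries
  rw [map_mul, map_mul, map_mul, map_mul, map_pow, map_pow, h12, h33, h44, h0, rescale_C_int, h1,
    h2,
    Finset.prod_congr rfl h3, h4]
  ring

lemma pfCoeff_reflect {n i k : ℕ} (hi : i ≤ 10) (hk : k ∈ poles n) :
    pfCoeff n i (91 * n + 2 - k) = -(-1) ^ i * pfCoeff n i k := by
  unfold pfCoeff
  rw [localSeries_reflect hk, map_neg, coeff_rescale]
  have : (-1 : ℚ) ^ (10 - i) = (-1) ^ i := by
    interval_cases i <;> norm_num
  rw [this]; ring

lemma sum_pfCoeff_of_even {n i : ℕ} (hi : i ≤ 10) (he : Even i) :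
    ∑ k ∈ poles n, pfCoeff n i k = 0 := by
  have h : ∑ k ∈ poles n, pfCoeff n i k = ∑ k ∈ poles n, -pfCoeff n i k := by
    refine Finset.sum_bij' (fun j _ => 91 * n + 2 - j) (fun j _ => 91 * n + 2 - j)
      (fun j hj => (mem_poles_reflect hj).2) (fun j hj => (mem_poles_reflect hj).2)
      (fun j hj => ?_) (fun j hj => ?_) fun j hj => ?_
    · have := (mem_poles_reflect hj).1; omega
    · have := (mem_poles_reflect hj).1; omega
    · rw [pfCoeff_reflect hi hj, he.neg_one_pow]; ring
  rw [Finset.sum_neg_distrib] at h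
  linarith

lemma prod_poles_sdiff_eq (n k : ℕ) : ∏ i ∈ Finset.range 10, ∏ j ∈ poles n \ poleBlock n i,
    lin (j - k) = X ^ ((Finset.range 10).filter fun i => k ∈ poles n \ poleBlock n i).card *
    ∏ i ∈ Finset.range 10, ∏ j ∈ (poles n \ poleBlock n i).erase k, lin (j - k) := by
  rw [← Finset.prod_const, Finset.prod_filter, ← Finset.prod_mul_distrib]
  refine Finset.prod_congr rfl fun i _ => ?_
  split_ifs with h
  · rw [← Finset.mul_prod_erase _ _ h]
    congr 1
    simp [lin]
  · rw [Finset.erase_eq_of_notMem h, one_mul]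

/-- The local expansion with its power of `X` removed. -/
noncomputable def regularSeries (n k : ℕ) : PowerSeries ℚ :=
  C (normConst n) * (C 2 * X + C ((91 * n + 2 - 2 * k : ℤ) : ℚ)) *
    ((∏ a ∈ Finset.Icc 1 (27 * n + 1), lin (a - k)) *
      ∏ b ∈ Finset.Icc (64 * n + 1) (91 * n + 1), lin (b - k)) ^ 3 *
    (∏ i ∈ Finset.range 10, ∏ j ∈ (poles n \ poleBlock n i).erase k, lin (j - k)) *
    (∏ j ∈ (poles n).erase k, (lin (j - k))⁻¹) ^ 10

lemma localSeries_eq (n k : ℕ) : localSeries n k =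
    X ^ ((Finset.range 10).filter fun i => k ∈ poles n \ poleBlock n i).card *
      regularSeries n k := by
  unfold localSeries regularSeries
  rw [prod_poles_sdiff_eq]
  ring

lemma pfCoeff_eq_zero {n i k : ℕ} (hi : 0 < i) (hi' : i ≤ 10) (hk : k ∈ poles n)
    (h : (63 - i) * n + 1 < k) : pfCoeff n i k = 0 := by
  unfold pfCoeff
  rw [localSeries_eq]
  rw [coeff_X_pow_mul', if_neg]
  rw [not_le]
  have hsub : Finset.Ico (i - 1) 10 ⊆
      (Finset.range 10).filter fun i => k ∈ poles n \ poleBlock n i := fun j hj => by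
    rw [Finset.mem_Ico] at hj
    rw [Finset.mem_filter, Finset.mem_range, Finset.mem_sdiff]
    refine ⟨hj.2, hk, fun hkj => ?_⟩
    have h1 := (Finset.mem_Icc.1 hkj).2
    have h2 := Nat.mul_le_mul_right n (show 62 - j ≤ 63 - i by omega)
    omega
  have := Finset.card_le_card hsub
  rw [Nat.card_Ico] at this
  omega

section
variable {p : ℕ} [hp : Fact p.Prime]

lemma padicNorm_normConst_of_gt {n : ℕ} (h : 33 * n < p) : padicNorm p (normConst n) = 1 := by
  have hf : ∀ m : ℕ, m < p → padicNorm p (m.factorial : ℚ) = 1 := fun m hm => by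
    rw [padicNorm_factorial (L := 0) (by simpa using hm)]
    simp
  unfold normConst
  rw [padicNorm.div, padicNorm_prod, padicNorm_pow, hf _ (by omega), one_pow, div_one]
  refine Finset.prod_eq_one fun i _ => hf _ (lt_of_le_of_lt ?_ h)
  exact Nat.mul_le_mul_right n (by omega)

lemma abs_sub_lt_of_mem_poles {p n j k : ℕ} (h : 33 * n < p) (hj : j ∈ poles n) (hk : k ∈ poles n) :
    |(j : ℤ) - k| < (p : ℤ) ^ (0 + 1) := by
  rw [poles, Finset.mem_Icc] at hj hk
  rw [zero_add, pow_one, abs_lt]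
  constructor <;> omega

lemma inLattice_lin_zero (m : ℤ) : InLattice p 0 0 (lin m) := by
  simpa [lin] using inLattice_int_linear (p := p) (L := 0) 1 m

lemma truncVal_zero_left {p : ℕ} (m : ℤ) : truncVal p 0 m = 0 := by simp [truncVal]

lemma inLattice_zero_lin_inv {n j k : ℕ} (h : 33 * n < p) (hj : j ∈ poles n) (hk : k ∈ poles n)
    (hjk : j ≠ k) : InLattice p 0 0 (lin (j - k))⁻¹ := by
  have := inLattice_lin_inv (p := p) (L := 0) (m := j - k) (by omega)
    (abs_sub_lt_of_mem_poles h hj hk)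
  rwa [truncVal_zero_left, Nat.cast_zero, neg_zero] at this

lemma InLattice.prod_zero {ι : Type*} {s : Finset ι} {L : ℕ} {f : ι → PowerSeries ℚ}
    (h : ∀ i ∈ s, InLattice p L 0 (f i)) : InLattice p L 0 (∏ i ∈ s, f i) := by
  simpa using InLattice.prod (ν := fun _ => 0) h

lemma InLattice.pow_zero {L : ℕ} {f : PowerSeries ℚ} (h : InLattice p L 0 f) (m : ℕ) :
    InLattice p L 0 (f ^ m) := by
  simpa using h.pow m

lemma InLattice.mul_zero {L : ℕ} {f g : PowerSeries ℚ} (hf : InLattice p L 0 f)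
    (hg : InLattice p L 0 g) : InLattice p L 0 (f * g) := by
  simpa using hf.mul hg

lemma inLattice_zero_localSeries {n k : ℕ} (h : 33 * n < p) (hk : k ∈ poles n) :
    InLattice p 0 0 (localSeries n k) := by
  unfold localSeries
  refine ((((inLattice_C ?_).mul_zero (inLattice_int_linear 2 _)).mul_zero
    (InLattice.pow_zero (InLattice.mul_zero (InLattice.prod_zero fun a _ => inLattice_lin_zero _)
      (InLattice.prod_zero fun a _ => inLattice_lin_zero _)) 3)).mul_zero
    (InLattice.prod_zero fun i _ => InLattice.prod_zero fun a _ => inLattice_lin_zero _)).mul_zero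
    (InLattice.pow_zero (InLattice.prod_zero fun j hj => ?_) 10)
  · rw [padicNorm_normConst_of_gt h]; simp
  · rw [Finset.mem_erase] at hj
    exact inLattice_zero_lin_inv h hj.2 hk hj.1

lemma padicNorm_pfCoeff_le_one {n i k : ℕ} (h : 33 * n < p) (hk : k ∈ poles n) :
    padicNorm p (pfCoeff n i k) ≤ 1 := by
  unfold pfCoeff
  simpa using inLattice_zero_localSeries h hk (10 - i)

lemma padicNorm_int_eq_one {m : ℤ} (h : ¬ (p : ℤ) ∣ m) : padicNorm p m = 1 :=
  (padicNorm.int_eq_one_iff m).2 h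

lemma padicNorm_pfCoeff_last {n : ℕ} (hn : 0 < n) (hpn : p + 1 = 35 * n) :
    padicNorm p (pfCoeff n 1 (62 * n + 1)) = 1 := by
  have h33 : 33 * n < p := by omega
  have hk : 62 * n + 1 ∈ poles n := by rw [poles, Finset.mem_Icc]; omega
  have hcard : ((Finset.range 10).filter fun i => 62 * n + 1 ∈ poles n \ poleBlock n i).card =
      9 := by
    have : ((Finset.range 10).filter fun i => 62 * n + 1 ∈ poles n \ poleBlock n i) =
        Finset.Ico 1 10 := by
      ext i
      rw [Finset.mem_filter, Finset.mem_range, Finset.mem_sdiff, Finset.mem_Ico, poleBlock,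
        Finset.mem_Icc]
      constructor
      · rintro ⟨h1, -, h2⟩
        refine ⟨Nat.pos_of_ne_zero ?_, h1⟩
        rintro rfl
        apply h2
        omega
      · rintro ⟨h1, h2⟩
        refine ⟨h2, hk, fun h => ?_⟩
        have := Nat.mul_le_mul_right n (show 62 - i ≤ 61 by omega)
        omega
    rw [this, Nat.card_Ico]
  have hlin : ∀ j : ℕ, (¬ (p : ℤ) ∣ (j - (62 * n + 1 : ℕ) : ℤ)) →
      padicNorm p (constantCoeff (lin (j - (62 * n + 1 : ℕ)))) = 1 := fun j hj => by
    rw [constantCoeff_lin]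
    exact padicNorm_int_eq_one hj
  have hsmall : ∀ m : ℤ, 0 < |m| → |m| < p → ¬ (p : ℤ) ∣ m := fun m h0 h1 hd => by
    have := Int.le_of_dvd h0 ((dvd_abs _ _).2 hd)
    omega
  have hpole : ∀ j ∈ poles n, j ≠ 62 * n + 1 → ¬ (p : ℤ) ∣ (j - (62 * n + 1 : ℕ) : ℤ) := by
    intro j hj hjk
    refine hsmall _ (abs_pos.2 (by omega)) ?_
    simpa using abs_sub_lt_of_mem_poles h33 hj hk
  unfold pfCoeff
  rw [localSeries_eq, hcard, coeff_X_pow_mul', if_pos (by norm_num), Nat.sub_self,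
    coeff_zero_eq_constantCoeff]
  unfold regularSeries
  simp only [map_mul, map_pow, map_prod, map_add, padicNorm.mul, padicNorm_pow, padicNorm_prod,
    constantCoeff_C, constantCoeff_X, mul_zero, zero_add]
  rw [padicNorm_normConst_of_gt h33, Finset.prod_eq_one, Finset.prod_eq_one, Finset.prod_eq_one,
    Finset.prod_eq_one, padicNorm_int_eq_one]
  · norm_num
  · refine hsmall _ (abs_pos.2 (by push_cast; omega)) ?_
    rw [abs_lt]
    push_cast
    constructor <;> omega
  · intro j hj
    rw [Finset.mem_erase] at hj
    rw [constantCoeff_inv, inv_eq_one_div, padicNorm.div, hlin j (hpole j hj.2 hj.1), padicNorm.one,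
      div_one]
  · intro i _
    refine Finset.prod_eq_one fun j hj => hlin j ?_
    rw [Finset.mem_erase, Finset.mem_sdiff] at hj
    exact hpole j hj.2.1 hj.1
  · intro j hj
    rw [Finset.mem_Icc] at hj
    refine hlin j (hsmall _ (abs_pos.2 (by push_cast; omega)) ?_)
    rw [abs_lt]
    push_cast
    constructor <;> omega
  · intro j hj
    rw [Finset.mem_Icc] at hj
    refine hlin j fun hd => ?_
    have hd' : (p : ℤ) ∣ (62 * n + 1 - j - p : ℤ) := by
      have := dvd_sub ((dvd_neg (a := (p : ℤ))).2 hd) (dvd_refl (p : ℤ))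
      rwa [show -((j : ℤ) - (62 * n + 1 : ℕ)) - p = 62 * n + 1 - j - p by push_cast; ring] at this
    refine hsmall _ (abs_pos.2 (by omega)) ?_ hd'
    rw [abs_lt]
    constructor <;> omega

end

end

section
open Polynomial

/-- The numerator of the rational function, as a polynomial. -/
noncomputable def numPoly (n : ℕ) : ℚ[X] :=
  C (normConst n) * (C 2 * X + C ((91 * n + 2 : ℕ) : ℚ)) *
    ((∏ a ∈ Finset.Icc 1 (27 * n + 1), (X + C (a : ℚ))) *
      ∏ b ∈ Finset.Icc (64 * n + 1) (91 * n + 1), (X + C (b : ℚ))) ^ 3 *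
    ∏ i ∈ Finset.range 10, ∏ j ∈ poles n \ poleBlock n i, (X + C (j : ℚ))

lemma sum_two_mul_mul_range (n : ℕ) : ∑ i ∈ Finset.range 10, 2 * (i * n) = 90 * n := by
  simp only [Finset.sum_range_succ, Finset.sum_range_zero]
  ring

lemma degree_numPoly_le (n : ℕ) : (numPoly n).degree ≤ (252 * n + 7 : ℕ) := by
  refine degree_le_of_natDegree_le ?_
  unfold numPoly
  have h1 : ∀ s : Finset ℕ, (∏ a ∈ s, (X + C (a : ℚ))).natDegree ≤ s.card := fun s => by
    refine (natDegree_prod_le _ _).trans ?_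
    simp only [natDegree_X_add_C, Finset.sum_const, smul_eq_mul, mul_one, le_refl]
  have h2 : (∏ i ∈ Finset.range 10, ∏ j ∈ poles n \ poleBlock n i,
      (X + C (j : ℚ))).natDegree ≤ 90 * n := by
    refine (natDegree_prod_le _ _).trans ?_
    rw [← sum_two_mul_mul_range]
    refine Finset.sum_le_sum fun i hi => (h1 _).trans (card_poles_sdiff hi).le
  have h3 := h1 (Finset.Icc 1 (27 * n + 1))
  have h4 := h1 (Finset.Icc (64 * n + 1) (91 * n + 1))
  rw [Nat.card_Icc] at h3 h4
  have h5 : (C (normConst n) * (C 2 * X + C ((91 * n + 2 : ℕ) : ℚ))).natDegree ≤ 1 := by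
    refine (natDegree_C_mul_le _ _).trans natDegree_linear_le
  refine (natDegree_mul_le_of_le (natDegree_mul_le_of_le h5 (natDegree_pow_le_of_le 3
    (natDegree_mul_le_of_le h3 h4))) h2).trans ?_
  omega

/-- Expansion of a polynomial around `-k`, as a power series. -/
noncomputable def expandAt (k : ℕ) : ℚ[X] →+* PowerSeries ℚ :=
  coeToPowerSeries.ringHom.comp (compRingHom (X - C (k : ℚ)))

lemma expandAt_apply (k : ℕ) (P : ℚ[X]) :
    expandAt k P = ((P.comp (X - C (k : ℚ)) : ℚ[X]) : PowerSeries ℚ) := rfl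

lemma expandAt_linear (k j : ℕ) : expandAt k (X + C (j : ℚ)) = lin (j - k) := by
  rw [expandAt_apply, add_comp, X_comp, C_comp,
    show (X - C (k : ℚ) + C (j : ℚ)) = X + C ((j : ℚ) - k) by rw [C_sub]; ring]
  unfold lin
  push_cast
  simp

lemma expandAt_C (k : ℕ) (c : ℚ) : expandAt k (C c) = PowerSeries.C c := by
  rw [expandAt_apply, C_comp, coe_C]

lemma expandAt_X (k : ℕ) : expandAt k X = PowerSeries.X - PowerSeries.C (k : ℚ) := by
  rw [expandAt_apply, X_comp, coe_sub, coe_X, coe_C]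

lemma expandAt_numPoly (n k : ℕ) : expandAt k (numPoly n) =
    PowerSeries.C (normConst n) * (PowerSeries.C 2 * PowerSeries.X +
      PowerSeries.C ((91 * n + 2 - 2 * k : ℤ) : ℚ)) *
    ((∏ a ∈ Finset.Icc 1 (27 * n + 1), lin (a - k)) *
      ∏ b ∈ Finset.Icc (64 * n + 1) (91 * n + 1), lin (b - k)) ^ 3 *
    (∏ i ∈ Finset.range 10, ∏ j ∈ poles n \ poleBlock n i, lin (j - k)) := by
  unfold numPoly
  simp only [map_mul, map_pow, map_prod, expandAt_linear]
  congr 3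
  · exact expandAt_C _ _
  rw [map_add, map_mul, expandAt_C, expandAt_C, expandAt_X]
  push_cast
  simp only [map_add, map_sub, map_mul]
  ring

lemma injOn_cast (s : Finset ℕ) : Set.InjOn (fun j : ℕ => (j : ℚ)) s :=
  fun _ _ _ _ h => Nat.cast_injective h

lemma numPoly_eq_sum (n : ℕ) : numPoly n = ∑ k ∈ poles n,
    ((localSeries n k).trunc 10).comp (X + C (k : ℚ)) *
      ∏ j ∈ (poles n).erase k, (X + C (j : ℚ)) ^ 10 := by
  refine eq_sum_trunc_mul_prod (poles n) (fun j : ℕ => (j : ℚ)) (injOn_cast _) 10 (numPoly n) ?_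
    (localSeries n) fun k _ => ?_
  · refine lt_of_le_of_lt (degree_numPoly_le n) ?_
    rw [card_poles]
    exact_mod_cast (by omega : 252 * n + 7 < 10 * (33 * n + 1))
  · rw [← expandAt_apply, ← expandAt_apply, expandAt_numPoly]
    simp only [map_pow, map_prod, expandAt_linear, localSeries]
    have h : (∏ j ∈ (poles n).erase k, (lin (j - k))⁻¹) *
        ∏ j ∈ (poles n).erase k, lin (j - k) = 1 := by
      rw [← Finset.prod_mul_distrib]
      refine Finset.prod_eq_one fun j hj => ?_
      rw [mul_comm]
      exact lin_mul_inv (by have := (Finset.mem_erase.1 hj).1; omega)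
    rw [Finset.prod_pow, mul_assoc, ← mul_pow, h, one_pow, mul_one]

lemma sum_pfCoeff_one (n : ℕ) : ∑ k ∈ poles n, pfCoeff n 1 k = 0 := by
  refine sum_coeff_eq_zero_of_degree_lt (poles n) (fun j : ℕ => (j : ℚ)) 10 (numPoly n) ?_
    (by norm_num)
    (localSeries n) (numPoly_eq_sum n)
  refine lt_of_le_of_lt (degree_numPoly_le n) ?_
  rw [card_poles]
  exact_mod_cast (by omega : 252 * n + 7 < 10 * (33 * n + 1) - 1)

lemma sum_range_sub_eq_sum_Icc {M : Type*} [AddCommMonoid M] (g : ℕ → M) :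
    ∑ l ∈ Finset.range 10, g (10 - l) = ∑ i ∈ Finset.Icc 1 10, g i := by
  refine Finset.sum_bij' (fun l _ => 10 - l) (fun i _ => 10 - i) ?_ ?_ ?_ ?_ fun _ _ => rfl <;>
  · intro a ha
    simp only [Finset.mem_range, Finset.mem_Icc] at *
    omega

lemma map_numPoly_mul_prod {S : Type*} [CommRing S] (φ : ℚ[X] →+* S) (n : ℕ) (u : ℕ → S)
    (hu : ∀ j ∈ poles n, φ (X + C (j : ℚ)) * u j = 1) :
    φ (numPoly n) * ∏ j ∈ poles n, u j ^ 10 =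
      ∑ k ∈ poles n, ∑ i ∈ Finset.Icc 1 10, φ (C (pfCoeff n i k)) * u k ^ i := by
  conv_lhs => rw [numPoly_eq_sum, map_sum, Finset.sum_mul]
  refine Finset.sum_congr rfl fun k hk => ?_
  rw [← sum_range_sub_eq_sum_Icc, map_mul, map_prod, ← Finset.mul_prod_erase _ _ hk]
  have h1 : (∏ j ∈ (poles n).erase k, φ ((X + C (j : ℚ)) ^ 10)) *
      ∏ j ∈ (poles n).erase k, u j ^ 10 = 1 := by
    rw [← Finset.prod_mul_distrib]
    refine Finset.prod_eq_one fun j hj => ?_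
    rw [map_pow, ← mul_pow, hu j (Finset.mem_of_mem_erase hj), one_pow]
  have h2 : φ (((localSeries n k).trunc 10).comp (X + C (k : ℚ))) =
      ∑ l ∈ Finset.range 10, φ (C (pfCoeff n (10 - l) k)) * φ (X + C (k : ℚ)) ^ l := by
    rw [as_sum_range' _ 10 (PowerSeries.natDegree_trunc_lt _ 9), Polynomial.sum_comp, map_sum]
    refine Finset.sum_congr rfl fun l hl => ?_
    rw [monomial_comp, map_mul, map_pow, PowerSeries.coeff_trunc, if_pos (Finset.mem_range.1 hl)]
    unfold pfCoeff
    rw [Nat.sub_sub_self (Finset.mem_range.1 hl).le]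
  have h3 : ∀ l ∈ Finset.range 10, φ (X + C (k : ℚ)) ^ l * u k ^ 10 = u k ^ (10 - l) := by
    intro l hl
    rw [← Nat.sub_add_cancel (Finset.mem_range.1 hl).le, pow_add, mul_left_comm, ← mul_pow, hu k hk,
      one_pow, mul_one, Nat.sub_add_cancel (Finset.mem_range.1 hl).le]
  rw [mul_mul_mul_comm, h1, mul_one, h2, Finset.sum_mul]
  refine Finset.sum_congr rfl fun l hl => ?_
  rw [mul_assoc, h3 l hl]

lemma coeff_two_pow {a : ℚ} (f : PowerSeries ℚ) (h0 : PowerSeries.coeff 0 f = a)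
    (h1 : PowerSeries.coeff 1 f = -a ^ 2) (h2 : PowerSeries.coeff 2 f = a ^ 3) (i : ℕ) :
    PowerSeries.coeff 0 (f ^ i) = a ^ i ∧ PowerSeries.coeff 1 (f ^ i) = -i * a ^ (i + 1) ∧
      PowerSeries.coeff 2 (f ^ i) = (i * (i + 1) / 2) * a ^ (i + 2) := by
  induction i with
  | zero => simp [PowerSeries.coeff_one]
  | succ i ih =>
    obtain ⟨e0, e1, e2⟩ := ih
    rw [pow_succ]
    refine ⟨?_, ?_, ?_⟩
    · rw [PowerSeries.coeff_mul, Finset.Nat.antidiagonal_zero, Finset.sum_singleton, e0, h0]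
      ring
    · rw [PowerSeries.coeff_mul, show Finset.HasAntidiagonal.antidiagonal 1 =
        {(0, 1), (1, 0)} from rfl, Finset.sum_pair (by decide), e0, h1, e1, h0]
      push_cast
      ring
    · rw [PowerSeries.coeff_mul, show Finset.HasAntidiagonal.antidiagonal 2 =
        {(0, 2), (1, 1), (2, 0)} from rfl, Finset.sum_insert (by decide),
        Finset.sum_pair (by decide), e0, h2, e1, h1, e2, h0]
      push_cast
      ring

lemma coeff_lin_inv {m : ℤ} (hm : m ≠ 0) :
    PowerSeries.coeff 0 (lin m)⁻¹ = (m : ℚ)⁻¹ ∧ PowerSeries.coeff 1 (lin m)⁻¹ = -(m : ℚ)⁻¹ ^ 2 ∧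
      PowerSeries.coeff 2 (lin m)⁻¹ = (m : ℚ)⁻¹ ^ 3 := by
  have hm' : (m : ℚ) ≠ 0 := by exact_mod_cast hm
  have h : ∀ l, PowerSeries.coeff l ((lin m)⁻¹ * (PowerSeries.X + PowerSeries.C (m : ℚ))) =
      PowerSeries.coeff l 1 := fun l => by
    rw [← lin_mul_inv hm, mul_comm]; rfl
  have h0 : PowerSeries.coeff 0 (lin m)⁻¹ = (m : ℚ)⁻¹ := by
    rw [PowerSeries.coeff_zero_eq_constantCoeff, PowerSeries.constantCoeff_inv, constantCoeff_lin]
  have h1 := h 1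
  have h2 := h 2
  rw [mul_add, map_add, PowerSeries.coeff_succ_mul_X, PowerSeries.coeff_mul_C,
    PowerSeries.coeff_one, if_neg (by norm_num)] at h1 h2
  rw [h0] at h1
  have e1 : PowerSeries.coeff 1 (lin m)⁻¹ = -(m : ℚ)⁻¹ ^ 2 := by
    have : PowerSeries.coeff 1 (lin m)⁻¹ * m = -(m : ℚ)⁻¹ := by linarith
    rw [← eq_div_iff hm'] at this
    rw [this]; ring
  rw [e1] at h2
  refine ⟨h0, e1, ?_⟩
  have : PowerSeries.coeff 2 (lin m)⁻¹ * m = (m : ℚ)⁻¹ ^ 2 := by linarith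
  rw [← eq_div_iff hm'] at this
  rw [this]; ring

lemma sum_pfCoeff_mul_eq_zero {n a : ℕ} (hn : 0 < n) (ha : a ∈ Finset.Icc 1 (27 * n + 1)) :
    ∑ k ∈ poles n, ∑ i ∈ Finset.Icc 1 10,
      pfCoeff n i k * ((i * (i + 1) / 2 : ℚ) * ((k - a : ℚ)⁻¹) ^ (i + 2)) = 0 := by
  have ha' := Finset.mem_Icc.1 ha
  have hne : ∀ j ∈ poles n, ((j : ℤ) - a) ≠ 0 := fun j hj => by
    rw [poles, Finset.mem_Icc] at hj; omega
  have h := map_numPoly_mul_prod (expandAt a) n (fun j => (lin (j - a))⁻¹) fun j hj => by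
    rw [expandAt_linear]
    exact lin_mul_inv (hne j hj)
  have h1 := congrArg (PowerSeries.coeff 2) h
  have h2 : PowerSeries.coeff 2 (expandAt a (numPoly n) *
      ∏ j ∈ poles n, (lin (j - a))⁻¹ ^ 10) = 0 := by
    have hX : lin ((a : ℤ) - a) = PowerSeries.X := by simp [lin]
    refine (PowerSeries.X_pow_dvd_iff (n := 3)).1 (Dvd.dvd.mul_right ?_ _) 2 (by norm_num)
    rw [expandAt_numPoly, ← Finset.mul_prod_erase _ _ ha, hX]
    refine Dvd.dvd.mul_right (Dvd.dvd.mul_left (pow_dvd_pow_of_dvd ?_ 3) _) _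
    rw [mul_assoc]
    exact dvd_mul_right _ _
  rw [h2, map_sum] at h1
  rw [h1]
  refine Finset.sum_congr rfl fun k hk => ?_
  rw [map_sum]
  refine Finset.sum_congr rfl fun i _ => ?_
  obtain ⟨e0, e1, e2⟩ := coeff_lin_inv (hne k hk)
  rw [expandAt_C, PowerSeries.coeff_C_mul, (coeff_two_pow _ e0 e1 e2 i).2.2]
  push_cast
  ring

lemma eval_numPoly_div {n : ℕ} {z : ℂ} (hz : ∀ j ∈ poles n, z + j ≠ 0) :
    aeval z (numPoly n) * ∏ j ∈ poles n, ((z + j)⁻¹) ^ 10 =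
      ∑ k ∈ poles n, ∑ i ∈ Finset.Icc 1 10, (pfCoeff n i k : ℂ) * ((z + k)⁻¹) ^ i := by
  have := map_numPoly_mul_prod (aeval z : ℚ[X] →ₐ[ℚ] ℂ).toRingHom n (fun j => (z + j)⁻¹)
    fun j hj => by simpa using mul_inv_cancel₀ (hz j hj)
  simpa using this

end

/-- The coefficient of `ζ(i + 2)` in the linear form. -/
noncomputable def zetaCoeff (n i : ℕ) : ℚ := (i + 1).choose 2 * ∑ k ∈ poles n, pfCoeff n i k

/-- The contribution of one partial fraction to the rational part of the linear form. -/
noncomputable def ratTerm (n k i : ℕ) : ℚ :=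
  pfCoeff n i k * ((i + 1).choose 2 * ∑ l ∈ Finset.Icc 1 (k - 27 * n - 2), ((l : ℚ) ^ (i + 2))⁻¹)

/-- The rational part of the linear form. -/
noncomputable def ratPart (n : ℕ) : ℚ :=
  ∑ x ∈ poles n ×ˢ Finset.Icc 1 10, ratTerm n x.1 x.2

section
variable {p : ℕ} [hp : Fact p.Prime]

lemma padicNorm_nat_le_one (m : ℕ) : padicNorm p (m : ℚ) ≤ 1 := padicNorm.of_nat m

lemma padicNorm_inv_pow (l m : ℕ) : padicNorm p ((l : ℚ) ^ m)⁻¹ = (padicNorm p l ^ m)⁻¹ := by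
  rw [inv_eq_one_div, padicNorm.div, padicNorm.one, padicNorm_pow, one_div]

lemma padicNorm_inv_pow_le {l L m : ℕ} (hl : 0 < l) (hL : l < p ^ (L + 1)) :
    padicNorm p ((l : ℚ) ^ m)⁻¹ ≤ (p : ℚ) ^ ((m : ℤ) * L) := by
  have h := padicNorm_eq_truncVal (p := p) (L := L) (m := l) (by omega)
    (by rw [abs_of_nonneg (by omega)]; exact_mod_cast hL)
  rw [Int.cast_natCast] at h
  rw [padicNorm_inv_pow, h, ← zpow_natCast, ← zpow_mul, ← zpow_neg]
  refine zpow_le_zpow_right₀ (by exact_mod_cast hp.out.one_lt.le) ?_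
  have := truncVal_le (p := p) (L := L) (l : ℤ)
  have h1 : ((truncVal p L (l : ℤ) : ℕ) : ℤ) ≤ L := by exact_mod_cast this
  nlinarith [Int.natCast_nonneg m]

lemma padicNorm_choose_mul_le {i : ℕ} {x c : ℚ} (h : padicNorm p x ≤ c) :
    padicNorm p ((i + 1).choose 2 * x) ≤ c := by
  rw [padicNorm.mul]
  exact (mul_le_of_le_one_left (padicNorm.nonneg _) (padicNorm_nat_le_one _)).trans h

lemma padicNorm_zetaCoeff_le_of_forall {n i : ℕ} {c : ℚ} (hc : 0 ≤ c)
    (h : ∀ k ∈ poles n, padicNorm p (pfCoeff n i k) ≤ c) : padicNorm p (zetaCoeff n i) ≤ c := by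
  exact padicNorm_choose_mul_le (padicNorm.sum_le' h hc)

lemma padicNorm_zetaCoeff_le {n i L : ℕ} {V : ℤ} (hi : i ∈ Finset.Icc 1 10)
    (hL : 91 * n + 2 < p ^ (L + 1))
    (hV : ∀ k ∈ poles n, V ≤ ∑ j ∈ Finset.Icc 1 L, stepFn n ((p : ℤ) ^ j) (k - 1)) :
    padicNorm p (zetaCoeff n i) ≤ (p : ℚ) ^ (12 * L - V) := by
  rw [Finset.mem_Icc] at hi
  refine padicNorm_zetaCoeff_le_of_forall (by positivity) fun k hk =>
    (padicNorm_pfCoeff_le hi.2 hL hk).trans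
      (zpow_le_zpow_right₀ (by exact_mod_cast hp.out.one_lt.le) ?_)
  have := hV k hk
  have : (0 : ℤ) ≤ i * L := by positivity
  linarith

lemma padicNorm_ratTerm_le {n k i L : ℕ} {V : ℤ} (hk : k ∈ poles n) (hi : i ∈ Finset.Icc 1 10)
    (hL : 91 * n + 2 < p ^ (L + 1))
    (hV : V ≤ ∑ j ∈ Finset.Icc 1 L, stepFn n ((p : ℤ) ^ j) (k - 1)) :
    padicNorm p (ratTerm n k i) ≤ (p : ℚ) ^ (12 * L - V) := by
  rw [Finset.mem_Icc] at hi
  have hp0 : (p : ℚ) ≠ 0 := by exact_mod_cast hp.out.ne_zero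
  have h1 := padicNorm_pfCoeff_le hi.2 hL hk
  have h2 : padicNorm p (∑ l ∈ Finset.Icc 1 (k - 27 * n - 2), ((l : ℚ) ^ (i + 2))⁻¹) ≤
      (p : ℚ) ^ (((i + 2 : ℕ) : ℤ) * L) := by
    refine padicNorm.sum_le' (fun l hl => ?_) (by positivity)
    rw [Finset.mem_Icc] at hl
    rw [poles, Finset.mem_Icc] at hk
    exact padicNorm_inv_pow_le hl.1 (by omega)
  have h3 := padicNorm_nat_le_one (p := p) ((i + 1).choose 2)
  unfold ratTerm
  rw [padicNorm.mul, padicNorm.mul]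
  calc _ ≤ (p : ℚ) ^ ((10 - i : ℤ) * L - ∑ j ∈ Finset.Icc 1 L, stepFn n ((p : ℤ) ^ j) (k - 1)) *
        (1 * (p : ℚ) ^ (((i + 2 : ℕ) : ℤ) * L)) := by
        gcongr
        · exact mul_nonneg (padicNorm.nonneg _) (padicNorm.nonneg _)
        · exact padicNorm.nonneg _
    _ = (p : ℚ) ^ (12 * L - ∑ j ∈ Finset.Icc 1 L, stepFn n ((p : ℤ) ^ j) (k - 1)) := by
        rw [one_mul, ← zpow_add₀ hp0]
        congr 1
        push_cast
        ring
    _ ≤ _ := zpow_le_zpow_right₀ (by exact_mod_cast hp.out.one_lt.le) (by linarith)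

lemma padicNorm_ratPart_le_of_forall {n : ℕ} {c : ℚ} (hc : 0 ≤ c)
    (h : ∀ k ∈ poles n, ∀ i ∈ Finset.Icc 1 10, padicNorm p (ratTerm n k i) ≤ c) :
    padicNorm p (ratPart n) ≤ c :=
  padicNorm.sum_le' (fun x hx => h x.1 (Finset.mem_product.1 hx).1 x.2
    (Finset.mem_product.1 hx).2) hc

lemma padicNorm_natCast_of_lt {l : ℕ} (h0 : 0 < l) (h1 : l < p) : padicNorm p (l : ℚ) = 1 := by
  rw [padicNorm.nat_eq_one_iff]
  exact Nat.not_dvd_of_pos_of_lt h0 h1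

lemma padicNorm_inv_pow_le_one {l m : ℕ} (h0 : 0 < l) (h1 : l < 2 * p) (h2 : l ≠ p) :
    padicNorm p ((l : ℚ) ^ m)⁻¹ ≤ 1 := by
  have : padicNorm p (l : ℚ) = 1 := by
    rw [padicNorm.nat_eq_one_iff]
    rintro ⟨c, rfl⟩
    have h3 : c < 2 := by
      by_contra! h
      have := Nat.mul_le_mul_left p h
      omega
    interval_cases c
    · omega
    · omega
  rw [padicNorm_inv_pow, this]
  simp

/-- Only poles with `k ≥ p + 27 n + 2` contribute denominators divisible by a large prime `p`. -/
lemma padicNorm_ratTerm_le_one {n k i : ℕ} (hp33 : 33 * n < p) (hk : k ∈ poles n)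
    (hi : i ∈ Finset.Icc 1 10) (h : k < p + 27 * n + 2 ∨ (36 - i) * n ≤ p) :
    padicNorm p (ratTerm n k i) ≤ 1 := by
  have hi' := Finset.mem_Icc.1 hi
  have hk' := hk
  rw [poles, Finset.mem_Icc] at hk'
  rcases le_or_gt k ((63 - i) * n + 1) with hki | hki
  · have hlt : k < p + 27 * n + 2 := by
      rcases h with h | h
      · exact h
      · have : (63 - i) * n = (36 - i) * n + 27 * n := by rw [← add_mul]; congr 1; omega
        omega
    unfold ratTerm
    rw [padicNorm.mul]
    refine mul_le_one₀ (padicNorm_pfCoeff_le_one hp33 hk) (padicNorm.nonneg _)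
      (padicNorm_choose_mul_le (padicNorm.sum_le' (fun l hl => ?_) zero_le_one))
    rw [Finset.mem_Icc] at hl
    exact padicNorm_inv_pow_le_one hl.1 (by omega) (by omega)
  · unfold ratTerm
    rw [pfCoeff_eq_zero hi'.1 hi'.2 hk hki, zero_mul, padicNorm.zero]
    exact zero_le_one

lemma padicNorm_ratTerm_le_pow {n k i e : ℕ} (hp33 : 33 * n < p) (hk : k ∈ poles n)
    (hi : i ∈ Finset.Icc 1 10) (h : (35 - e) * n ≤ p) (he : e ≤ 3) :
    padicNorm p (ratTerm n k i) ≤ (p : ℚ) ^ (e + 2) := by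
  have hp1 : (1 : ℚ) ≤ p := by exact_mod_cast hp.out.one_lt.le
  have hp2 := hp.out.two_le
  have hk' := hk
  rw [poles, Finset.mem_Icc] at hk'
  rcases le_or_gt i e with hie | hie
  · unfold ratTerm
    rw [padicNorm.mul]
    refine (mul_le_of_le_one_left (padicNorm.nonneg _) (padicNorm_pfCoeff_le_one hp33 hk)).trans
      (padicNorm_choose_mul_le (padicNorm.sum_le' (fun l hl => ?_) (by positivity)))
    rw [Finset.mem_Icc] at hl
    refine (padicNorm_inv_pow_le (L := 1) hl.1 ?_).trans ?_
    · rw [one_add_one_eq_two, sq]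
      have := Nat.mul_le_mul_right p hp2
      omega
    · rw [Nat.cast_one, mul_one, zpow_natCast]
      exact pow_le_pow_right₀ hp1 (by omega)
  · refine (padicNorm_ratTerm_le_one hp33 hk hi (Or.inr ?_)).trans (one_le_pow₀ hp1)
    exact (Nat.mul_le_mul_right n (by omega)).trans h

lemma padicNorm_ratTerm_last {n : ℕ} (hn : 0 < n) (hpn : p + 1 = 35 * n) :
    padicNorm p (ratTerm n (62 * n + 1) 1) = (p : ℚ) ^ 3 := by
  have hp1 : (1 : ℚ) < p := by exact_mod_cast hp.out.one_lt
  unfold ratTerm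
  rw [padicNorm.mul, padicNorm_pfCoeff_last hn hpn, one_mul, show (1 + 1 : ℕ).choose 2 = 1 from rfl,
    Nat.cast_one, one_mul, show 62 * n + 1 - 27 * n - 2 = (p - 1) + 1 by omega,
    Finset.sum_Icc_succ_top (by omega), show p - 1 + 1 = p by omega]
  have h1 : padicNorm p ((p : ℚ) ^ (1 + 2))⁻¹ = (p : ℚ) ^ 3 := by
    rw [padicNorm_inv_pow (p := p), padicNorm.padicNorm_p_of_prime, inv_pow, inv_inv]
  have h2 : padicNorm p (∑ l ∈ Finset.Icc 1 (p - 1), ((l : ℚ) ^ (1 + 2))⁻¹) ≤ 1 := by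
    refine padicNorm.sum_le' (fun l hl => ?_) zero_le_one
    rw [Finset.mem_Icc] at hl
    exact padicNorm_inv_pow_le_one hl.1 (by omega) (by omega)
  have h3 := one_lt_pow₀ hp1 (by norm_num : 3 ≠ 0)
  rw [padicNorm.add_eq_max_of_ne (by rw [h1]; exact (h2.trans_lt h3).ne), h1,
    max_eq_right (h2.trans h3.le)]

lemma padicNorm_ratPart_last {n : ℕ} (hn : 0 < n) (hpn : p + 1 = 35 * n) :
    padicNorm p (ratPart n) = (p : ℚ) ^ 3 := by
  have hp1 : (1 : ℚ) < p := by exact_mod_cast hp.out.one_lt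
  have hmem : ((62 * n + 1, 1) : ℕ × ℕ) ∈ poles n ×ˢ Finset.Icc 1 10 := by
    rw [Finset.mem_product, poles, Finset.mem_Icc, Finset.mem_Icc]
    dsimp only
    omega
  unfold ratPart
  rw [← Finset.add_sum_erase _ _ hmem]
  have h1 := padicNorm_ratTerm_last hn hpn
  have h2 : padicNorm p (∑ x ∈ (poles n ×ˢ Finset.Icc 1 10).erase (62 * n + 1, 1),
      ratTerm n x.1 x.2) ≤ 1 := by
    refine padicNorm.sum_le' (fun x hx => ?_) zero_le_one
    rw [Finset.mem_erase, Finset.mem_product] at hx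
    refine padicNorm_ratTerm_le_one (by omega) hx.2.1 hx.2.2 ?_
    have hk := hx.2.1
    have hi := hx.2.2
    rw [poles, Finset.mem_Icc] at hk
    rw [Finset.mem_Icc] at hi
    by_contra! hcon
    obtain ⟨hc1, hc2⟩ := hcon
    have hi1 : x.2 = 1 := by
      by_contra hne
      have := Nat.mul_le_mul_right n (show 36 - x.2 ≤ 34 by omega)
      omega
    exact hx.1 (Prod.ext (by dsimp only; omega) hi1)
  have h3 := one_lt_pow₀ hp1 (by norm_num : 3 ≠ 0)
  rw [padicNorm.add_eq_max_of_ne (by rw [h1]; exact (h2.trans_lt h3).ne'), h1,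
    max_eq_left (h2.trans h3.le)]

lemma padicNorm_zetaCoeff_le_one {n i : ℕ} (hp33 : 33 * n < p) :
    padicNorm p (zetaCoeff n i) ≤ 1 :=
  padicNorm_zetaCoeff_le_of_forall zero_le_one fun _ hk => padicNorm_pfCoeff_le_one hp33 hk

end

/-- Exponent of the prime `p` in a common denominator of the linear form. -/
noncomputable def denExp (n p : ℕ) : ℤ :=
  if 35 * n ≤ p then 0 else if 34 * n ≤ p then 3 else if 33 * n < p then 4 else
    if 91 * n + 2 < p ^ 2 then 12 - minStep n p else 12 * Nat.log p (91 * n + 2)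

section
variable {p : ℕ} [hp : Fact p.Prime]

lemma denExp_cases {P : ℤ → Prop} {n : ℕ} (h0 : 33 * n < p → 35 * n ≤ p → P 0)
    (h3 : 33 * n < p → 34 * n ≤ p → P 3) (h4 : 33 * n < p → P 4)
    (h1 : ∀ (L : ℕ) (V : ℤ), 91 * n + 2 < p ^ (L + 1) → (∀ k ∈ poles n,
      V ≤ ∑ j ∈ Finset.Icc 1 L, stepFn n ((p : ℤ) ^ j) (k - 1)) → P (12 * L - V)) :
    P (denExp n p) := by
  have hp0 := hp.out.pos
  unfold denExp
  split_ifs with a b c d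
  · exact h0 (by omega) a
  · exact h3 (by omega) b
  · exact h4 c
  · have := h1 1 (minStep n p) d fun k _ => by
      rw [Finset.Icc_self, Finset.sum_singleton, pow_one]
      exact minStep_le hp0 n _
    simpa using this
  · have := h1 (Nat.log p (91 * n + 2)) 0 (Nat.lt_pow_succ_log_self hp.out.one_lt _) fun k _ =>
      Finset.sum_nonneg fun j _ => stepFn_nonneg (pow_pos (by exact_mod_cast hp0) _) _ _
    simpa using this

lemma padicNorm_ratPart_le (n : ℕ) : padicNorm p (ratPart n) ≤ (p : ℚ) ^ denExp n p := by
  refine denExp_cases (P := fun e => padicNorm p (ratPart n) ≤ (p : ℚ) ^ e) (fun h1 h2 => ?_)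
    (fun h1 h2 => ?_) (fun h1 => ?_) fun L V h1 h2 => ?_
  · refine padicNorm_ratPart_le_of_forall (by positivity) fun k hk i hi => ?_
    rw [zpow_zero]
    rw [Finset.mem_Icc] at hi
    refine padicNorm_ratTerm_le_one h1 hk (Finset.mem_Icc.2 hi) (Or.inr (le_trans ?_ h2))
    exact Nat.mul_le_mul_right n (by omega)
  · exact padicNorm_ratPart_le_of_forall (by positivity) fun k hk i hi =>
      padicNorm_ratTerm_le_pow (e := 1) h1 hk hi h2 (by norm_num)
  · exact padicNorm_ratPart_le_of_forall (by positivity) fun k hk i hi =>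
      padicNorm_ratTerm_le_pow (e := 2) h1 hk hi h1.le (by norm_num)
  · exact padicNorm_ratPart_le_of_forall (by positivity) fun k hk i hi =>
      padicNorm_ratTerm_le hk hi h1 (h2 k hk)

lemma padicNorm_zetaCoeff_le_zpow {n i : ℕ} (hi : i ∈ Finset.Icc 1 10) :
    padicNorm p (zetaCoeff n i) ≤ (p : ℚ) ^ denExp n p := by
  have hp1 : (1 : ℚ) ≤ p := by exact_mod_cast hp.out.one_lt.le
  refine denExp_cases (P := fun e => padicNorm p (zetaCoeff n i) ≤ (p : ℚ) ^ e) (fun h1 _ => ?_)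
    (fun h1 _ => ?_) (fun h1 => ?_) fun L V h1 h2 => ?_
  · exact (padicNorm_zetaCoeff_le_one h1).trans (one_le_zpow₀ hp1 (by norm_num))
  · exact (padicNorm_zetaCoeff_le_one h1).trans (one_le_zpow₀ hp1 (by norm_num))
  · exact (padicNorm_zetaCoeff_le_one h1).trans (one_le_zpow₀ hp1 (by norm_num))
  · exact padicNorm_zetaCoeff_le hi h1 h2

end

lemma padicNorm_zpow {p : ℕ} [Fact p.Prime] (x : ℚ) (m : ℤ) :
    padicNorm p (x ^ m) = padicNorm p x ^ m := by
  obtain ⟨l, rfl | rfl⟩ := m.eq_nat_or_neg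
  · rw [zpow_natCast, zpow_natCast, padicNorm_pow]
  · rw [zpow_neg, zpow_neg, zpow_natCast, zpow_natCast, ← padicNorm_pow, inv_eq_one_div,
      padicNorm.div, padicNorm.one, one_div]

lemma den_eq_one_of_padicNorm_le_one {y : ℚ} (h : ∀ p, p.Prime → padicNorm p y ≤ 1) :
    y.den = 1 := by
  by_contra hden
  obtain ⟨p, hp, hpd⟩ := Nat.exists_prime_and_dvd hden
  have := Fact.mk hp
  have h1 : padicNorm p (y.num : ℚ) = 1 := by
    rw [padicNorm.int_eq_one_iff, Int.natCast_dvd]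
    exact fun hpn => hp.one_lt.ne' (Nat.dvd_one.1 (y.reduced ▸ Nat.dvd_gcd hpn hpd))
  have h2 : padicNorm p (y.den : ℚ) < 1 := (padicNorm.nat_lt_one_iff _).2 hpd
  rw [← Rat.mul_den_eq_num, padicNorm.mul] at h1
  have h3 := h p hp
  nlinarith [padicNorm.nonneg (p := p) y, padicNorm.nonneg (p := p) (y.den : ℚ)]

lemma one_le_abs_mul_prod_zpow {x : ℚ} (hx : x ≠ 0) (S : Finset ℕ) (e : ℕ → ℤ)
    (hS : ∀ p ∈ S, p.Prime) (h1 : ∀ p, p.Prime → p ∈ S → padicNorm p x ≤ (p : ℚ) ^ e p)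
    (h2 : ∀ p, p.Prime → p ∉ S → padicNorm p x ≤ 1) :
    1 ≤ |x| * ∏ p ∈ S, (p : ℚ) ^ e p := by
  have hpos : 0 < ∏ p ∈ S, (p : ℚ) ^ e p := Finset.prod_pos fun p hp =>
    zpow_pos (by exact_mod_cast (hS p hp).pos) _
  have hnorm : ∀ p, p.Prime → padicNorm p (x * ∏ p ∈ S, (p : ℚ) ^ e p) ≤ 1 := fun p hp => by
    have := Fact.mk hp
    have hp0 : (p : ℚ) ≠ 0 := by exact_mod_cast hp.ne_zero
    have hone : ∀ q ∈ S, q ≠ p → padicNorm p ((q : ℚ) ^ e q) = 1 := fun q hq hqp => by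
      rw [padicNorm_zpow, (padicNorm.nat_eq_one_iff q).2, one_zpow]
      rw [Nat.prime_dvd_prime_iff_eq hp (hS q hq)]
      exact hqp.symm
    rw [padicNorm.mul, padicNorm_prod]
    by_cases hpS : p ∈ S
    · rw [← Finset.mul_prod_erase _ _ hpS, Finset.prod_eq_one fun q hq =>
        hone q (Finset.mem_of_mem_erase hq) (Finset.ne_of_mem_erase hq), mul_one, padicNorm_zpow,
        padicNorm.padicNorm_p_of_prime, inv_zpow, ← div_eq_mul_inv, div_le_one (by positivity)]
      exact h1 p hp hpS
    · rw [Finset.prod_eq_one fun q hq => hone q hq (ne_of_mem_of_not_mem hq hpS), mul_one]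
      exact h2 p hp hpS
  have hInt := den_eq_one_of_padicNorm_le_one hnorm
  rw [← abs_of_pos hpos, ← abs_mul, ← Rat.coe_int_num_of_den_eq_one hInt]
  exact_mod_cast Int.one_le_abs (Rat.num_ne_zero.2 (mul_ne_zero hx hpos.ne'))

section
open Filter Topology

/-- The primes that may divide the denominators of the linear form. -/
def denPrimes (n : ℕ) : Finset ℕ := Nat.primesLE (35 * n)

lemma mem_denPrimes {n p : ℕ} : p ∈ denPrimes n ↔ p ≤ 35 * n ∧ p.Prime := Nat.mem_primesLE

lemma denExp_mul_log_le {n p : ℕ} (hn : 12000 ≤ n) (hp : p ∈ denPrimes n) :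
    (denExp n p : ℝ) * Real.log p ≤
      12 * (if p ≤ 33 * n then Real.log p else 0) + 4 * (if 33 * n < p then Real.log p else 0)
      - (if 34 * n < p then Real.log p else 0)
      + (if p ^ 2 ≤ 91 * n + 2 then 12 * Real.log (91 * n + 2) else 0)
      - (if p ∈ primeWindow 0 11 n then (minStep n p : ℝ) * Real.log p else 0) := by
  rw [mem_denPrimes] at hp
  have hlog : 0 ≤ Real.log p := Real.log_natCast_nonneg p
  have hp2 := hp.2.two_le
  have hlogn : 0 ≤ Real.log (91 * n + 2) := by
    have : (0 : ℝ) ≤ n := Nat.cast_nonneg n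
    exact Real.log_nonneg (by linarith)
  have hsmall : p ^ 2 ≤ 91 * n + 2 → p ≤ 33 * n := fun h => by nlinarith
  have hwin : p ∈ primeWindow 0 11 n → p ≤ 33 * n ∧ 91 * n + 2 < p ^ 2 := fun h => by
    rw [mem_primeWindow] at h
    refine ⟨h.1, ?_⟩
    have h1 : n < 11 * p := by exact_mod_cast h.2.2.2
    nlinarith
  unfold denExp
  by_cases h33 : p ≤ 33 * n
  · rw [if_neg (by omega), if_neg (by omega), if_neg (by omega), if_pos h33,
      if_neg (show ¬ 33 * n < p by omega), if_neg (show ¬ 34 * n < p by omega)]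
    by_cases hsq : 91 * n + 2 < p ^ 2
    · rw [if_pos hsq, if_neg (by omega)]
      have := mul_nonneg (Nat.cast_nonneg (α := ℝ) (minStep n p)) hlog
      push_cast
      split_ifs <;> nlinarith
    · rw [if_neg hsq, if_pos (by omega), if_neg (fun h => hsq (hwin h).2)]
      have h1 : (Nat.log p (91 * n + 2) : ℝ) * Real.log p ≤ Real.log (91 * n + 2) := by
        rw [← Real.log_pow]
        have := Nat.pow_log_le_self p (show 91 * n + 2 ≠ 0 by omega)
        refine Real.log_le_log (by positivity) ?_
        exact_mod_cast this
      push_cast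
      nlinarith
  · rw [if_neg h33, if_neg (fun h => h33 (hsmall h)), if_neg (fun h => h33 (hwin h).1)]
    by_cases h35 : 35 * n ≤ p
    · rw [if_pos h35, if_pos (show 33 * n < p by omega), if_pos (show 34 * n < p by omega)]
      push_cast
      linarith
    · rw [if_neg h35]
      by_cases h34 : 34 * n < p
      · rw [if_pos h34.le, if_pos (show 33 * n < p by omega), if_pos h34]
        push_cast
        linarith
      · rw [if_neg h34, if_pos (show 33 * n < p by omega)]
        split_ifs
        all_goals push_cast
        all_goals linarith

lemma theta_natCast (m : ℕ) : Chebyshev.theta m = ∑ p ∈ Nat.primesLE m, Real.log p :=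
  Chebyshev.theta_eq_sum_primesLE_log m

lemma sum_denPrimes_le {n c : ℕ} (hc : c ≤ 35) :
    ∑ p ∈ denPrimes n, (if p ≤ c * n then Real.log p else 0) = Chebyshev.theta (c * n : ℕ) := by
  rw [theta_natCast, ← Finset.sum_filter]
  refine Finset.sum_congr ?_ fun _ _ => rfl
  ext p
  rw [Finset.mem_filter, mem_denPrimes, Nat.mem_primesLE]
  have := Nat.mul_le_mul_right n hc
  constructor
  · rintro ⟨⟨_, h1⟩, h2⟩
    exact ⟨h2, h1⟩
  · rintro ⟨h1, h2⟩
    exact ⟨⟨h1.trans this, h2⟩, h1⟩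

lemma sum_denPrimes_gt {n c : ℕ} (hc : c ≤ 35) :
    ∑ p ∈ denPrimes n, (if c * n < p then Real.log p else 0) =
      Chebyshev.theta (35 * n : ℕ) - Chebyshev.theta (c * n : ℕ) := by
  rw [← sum_denPrimes_le hc, theta_natCast, ← denPrimes, ← Finset.sum_sub_distrib]
  refine Finset.sum_congr rfl fun p _ => ?_
  split_ifs
  · omega
  · ring
  · ring
  · omega

lemma sum_denPrimes_sq_le (n : ℕ) {c : ℝ} (hc : 0 ≤ c) :
    ∑ p ∈ denPrimes n, (if p ^ 2 ≤ 91 * n + 2 then c else 0) ≤ √(91 * n + 2) * c := by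
  rw [← Finset.sum_filter, Finset.sum_const, nsmul_eq_mul]
  refine mul_le_mul_of_nonneg_right ?_ hc
  have hsub : (denPrimes n).filter (fun p => p ^ 2 ≤ 91 * n + 2) ⊆
      Finset.Icc 1 (Nat.sqrt (91 * n + 2)) := fun p hp => by
    rw [Finset.mem_filter, mem_denPrimes] at hp
    rw [Finset.mem_Icc, Nat.le_sqrt']
    exact ⟨hp.1.2.pos, hp.2⟩
  have h1 := Finset.card_le_card hsub
  rw [Nat.card_Icc, Nat.add_sub_cancel] at h1
  calc _ ≤ ((Nat.sqrt (91 * n + 2) : ℕ) : ℝ) := by exact_mod_cast h1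
    _ ≤ √((91 * n + 2 : ℕ) : ℝ) := Real.nat_sqrt_le_real_sqrt
    _ = _ := by push_cast; rfl

lemma tendsto_sqrt_mul_log_div :
    Tendsto (fun n : ℕ => √(91 * n + 2) * (12 * Real.log (91 * n + 2)) / n) atTop (𝓝 0) := by
  have h1 : Tendsto (fun n : ℕ => 91 * (n : ℝ) + 2) atTop atTop :=
    tendsto_atTop_add_const_right _ _ (tendsto_natCast_atTop_atTop.const_mul_atTop (by norm_num))
  have h0 : Tendsto (fun x : ℝ => Real.log x / x ^ (1 / 2 : ℝ)) atTop (𝓝 0) :=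
    (isLittleO_log_rpow_atTop (by norm_num)).tendsto_div_nhds_zero
  have h2 := ((h0.comp h1).mul_const (12 * 93 : ℝ))
  rw [zero_mul] at h2
  refine squeeze_zero' ?_ ?_ h2
  · filter_upwards with n
    have : (0 : ℝ) ≤ n := Nat.cast_nonneg n
    have := Real.log_nonneg (show (1 : ℝ) ≤ 91 * n + 2 by linarith)
    positivity
  · filter_upwards [eventually_ge_atTop 1] with n hn
    have hn1 : (1 : ℝ) ≤ n := by exact_mod_cast hn
    have hlog := Real.log_nonneg (show (1 : ℝ) ≤ 91 * n + 2 by linarith)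
    have hs : 0 < √(91 * (n : ℝ) + 2) := Real.sqrt_pos.2 (by linarith)
    have hsq : √(91 * (n : ℝ) + 2) ^ 2 = 91 * n + 2 := Real.sq_sqrt (by linarith)
    simp only [Function.comp]
    rw [← Real.sqrt_eq_rpow, div_mul_eq_mul_div, div_le_div_iff₀ (by linarith) hs]
    calc √(91 * (n : ℝ) + 2) * (12 * Real.log (91 * n + 2)) * √(91 * n + 2)
        = 12 * Real.log (91 * n + 2) * √(91 * (n : ℝ) + 2) ^ 2 := by ring
      _ = 12 * Real.log (91 * n + 2) * (91 * n + 2) := by rw [hsq]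
      _ ≤ 12 * Real.log (91 * n + 2) * (93 * n) := by gcongr; linarith
      _ = _ := by ring

/-- The common denominator of the linear form grows at most like `exp (226.7 n)`. -/
theorem eventually_prod_denExp_le {ε : ℝ} (hε : 0 < ε) :
    ∀ᶠ n : ℕ in atTop, ((∏ p ∈ denPrimes n, (p : ℚ) ^ denExp n p : ℚ) : ℝ) ≤
      Real.exp ((2267 / 10 + ε) * n) := by
  have lim := ((((tendsto_theta_mul_div (β := 33) (by norm_num)).const_mul 12).add
    (((tendsto_theta_mul_div (β := 35) (by norm_num)).sub
      (tendsto_theta_mul_div (β := 33) (by norm_num))).const_mul 4)).sub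
    ((tendsto_theta_mul_div (β := 35) (by norm_num)).sub
      (tendsto_theta_mul_div (β := 34) (by norm_num)))).add tendsto_sqrt_mul_log_div
  filter_upwards [lim.eventually_le_const (show _ < (4030 / 10 + ε / 2 : ℝ) by linarith),
    hasDensityGE_total (ε / 2) (by positivity), eventually_ge_atTop 12000] with n h1 h2 h3
  have hn : (0 : ℝ) < n := by
    have : 0 < n := by omega
    exact_mod_cast this
  push_cast
  have hpos : ∀ p ∈ denPrimes n, (0 : ℝ) < (p : ℝ) ^ denExp n p := fun p hp => by
    rw [mem_denPrimes] at hp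
    have := hp.2.pos
    positivity
  rw [← Real.log_le_iff_le_exp (Finset.prod_pos hpos), Real.log_prod fun p hp => (hpos p hp).ne']
  have hle := Finset.sum_le_sum fun p (hp : p ∈ denPrimes n) => denExp_mul_log_le h3 hp
  rw [Finset.sum_sub_distrib, Finset.sum_add_distrib, Finset.sum_sub_distrib,
    Finset.sum_add_distrib, ← Finset.mul_sum, ← Finset.mul_sum, sum_denPrimes_le (by norm_num),
    sum_denPrimes_gt (by norm_num), sum_denPrimes_gt (by norm_num)] at hle
  have hwin : ∑ p ∈ denPrimes n, (if p ∈ primeWindow 0 11 n then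
      (minStep n p : ℝ) * Real.log p else 0) =
      ∑ p ∈ primeWindow 0 11 n, (minStep n p : ℝ) * Real.log p := by
    rw [← Finset.sum_filter]
    refine Finset.sum_congr ?_ fun _ _ => rfl
    ext p
    rw [Finset.mem_filter, mem_denPrimes, and_iff_right_iff_imp, mem_primeWindow]
    rintro ⟨h1, h2, _⟩
    exact ⟨by omega, h2⟩
  have hsq := sum_denPrimes_sq_le n (c := 12 * Real.log (91 * n + 2))
    (mul_nonneg (by norm_num) (Real.log_nonneg (by linarith)))
  rw [hwin] at hle
  simp only [← mul_div_assoc, ← sub_div, ← add_div] at h1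
  rw [div_le_iff₀ hn] at h1
  push_cast at hle
  simp only [Real.log_zpow]
  nlinarith

end

section
open Filter Topology

/-- The linear form in `1, ζ(5), ζ(7), ζ(9), ζ(11)`. -/
noncomputable def linForm (n : ℕ) : ℝ :=
  ∑ i ∈ ({3, 5, 7, 9} : Finset ℕ), (zetaCoeff n i : ℝ) * zetaR (i + 2) - ratPart n

lemma padicNorm_sub_le_of_le {p : ℕ} [Fact p.Prime] {x y c : ℚ} (hx : padicNorm p x ≤ c)
    (hy : padicNorm p y ≤ c) : padicNorm p (x - y) ≤ c :=
  padicNorm.sub.trans (max_le hx hy)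

lemma padicNorm_mul_int_le {p : ℕ} [Fact p.Prime] {x c : ℚ} (hx : padicNorm p x ≤ c) (z : ℤ) :
    padicNorm p (x * z) ≤ c := by
  rw [padicNorm.mul]
  exact (mul_le_of_le_one_right (padicNorm.nonneg _) (padicNorm.of_int z)).trans hx

lemma exists_integer_multiples (s : Finset ℕ) (f : ℕ → ℝ)
    (hf : ∀ i ∈ s, f i ∈ Set.range ((↑) : ℚ → ℝ)) :
    ∃ b : ℕ, 0 < b ∧ ∃ z : ℕ → ℤ, ∀ i ∈ s, b * f i = z i := by
  classical
  choose! q hq using hf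
  refine ⟨∏ i ∈ s, (q i).den, Finset.prod_pos fun i _ => (q i).den_pos,
    fun i => (∏ j ∈ s.erase i, ((q j).den : ℤ)) * (q i).num, fun i hi => ?_⟩
  rw [← hq i hi, ← Finset.mul_prod_erase _ _ hi]
  have h := Rat.den_mul_eq_num (q i)
  have h' : ((q i).den : ℝ) * (q i : ℝ) = (q i).num := by exact_mod_cast h
  push_cast
  rw [← h']
  ring

lemma exists_large_prime (N : ℕ) : ∃ n p : ℕ, N ≤ n ∧ N < p ∧ p.Prime ∧ p + 1 = 35 * n := by
  obtain ⟨p, hp, hpp, hmod⟩ := Nat.forall_exists_prime_gt_and_modEq (35 * N) (q := 35) (a := 34)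
    (by norm_num) (by norm_num)
  have h : p % 35 = 34 := hmod
  exact ⟨(p + 1) / 35, p, by omega, by omega, hpp, by omega⟩

/-- Small values of the linear forms force irrationality. -/
theorem not_forall_rational_of_small
    (hsmall : ∀ᶠ n : ℕ in atTop, |linForm n| ≤ Real.exp (-227 * n)) :
    ¬ ∀ i ∈ ({3, 5, 7, 9} : Finset ℕ), zetaR (i + 2) ∈ Set.range ((↑) : ℚ → ℝ) := by
  intro hrat
  obtain ⟨b, hb, z, hz⟩ := exists_integer_multiples _ _ hrat
  have hexp : Tendsto (fun n : ℕ => (b : ℝ) * Real.exp (-(1 / 10) * n)) atTop (𝓝 0) := by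
    have h1 : Tendsto (fun n : ℕ => -(1 / 10) * (n : ℝ)) atTop atBot :=
      tendsto_natCast_atTop_atTop.const_mul_atTop_of_neg (by norm_num)
    simpa using (Real.tendsto_exp_atBot.comp h1).const_mul (b : ℝ)
  obtain ⟨N, hN⟩ := eventually_atTop.1 ((hsmall.and (eventually_prod_denExp_le
    (show (0 : ℝ) < 1 / 10 by norm_num))).and (hexp.eventually_lt_const zero_lt_one))
  obtain ⟨n, p, hn, hpN, hp, hpn⟩ := exists_large_prime (max N b)
  have := Fact.mk hp
  obtain ⟨⟨h1, h2⟩, h3⟩ := hN n ((le_max_left _ _).trans hn)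
  set x : ℚ := ∑ i ∈ ({3, 5, 7, 9} : Finset ℕ), zetaCoeff n i * z i - ratPart n * (b : ℤ) with hxdef
  have hxlin : (x : ℝ) = b * linForm n := by
    rw [hxdef, linForm, mul_sub, Finset.mul_sum]
    push_cast
    rw [mul_comm (ratPart n : ℝ)]
    congr 1
    refine Finset.sum_congr rfl fun i hi => ?_
    rw [← hz i hi]
    ring
  have hx0 : x ≠ 0 := by
    intro hx
    have hlast := padicNorm_ratPart_last (p := p) (n := n) (by omega) hpn
    have h5 : padicNorm p (ratPart n * (b : ℤ)) = (p : ℚ) ^ 3 := by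
      rw [padicNorm.mul, hlast, Int.cast_natCast, padicNorm_natCast_of_lt hb
        ((le_max_right _ _).trans_lt hpN), mul_one]
    have h6 : padicNorm p (∑ i ∈ ({3, 5, 7, 9} : Finset ℕ), zetaCoeff n i * z i) ≤ 1 :=
      padicNorm.sum_le' (fun i _ => padicNorm_mul_int_le
        (padicNorm_zetaCoeff_le_one (by omega)) _) zero_le_one
    rw [hxdef, sub_eq_zero] at hx
    rw [hx, h5] at h6
    exact absurd h6 (not_le.2 (one_lt_pow₀ (by exact_mod_cast hp.one_lt) (by norm_num)))
  have hnorm : ∀ q, q.Prime → padicNorm q x ≤ (q : ℚ) ^ denExp n q := fun q hq => by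
    have := Fact.mk hq
    refine padicNorm_sub_le_of_le (padicNorm.sum_le' (fun i hi => padicNorm_mul_int_le
      (padicNorm_zetaCoeff_le_zpow ?_) _) (by positivity))
      (padicNorm_mul_int_le (padicNorm_ratPart_le n) _)
    simp only [Finset.mem_insert, Finset.mem_singleton] at hi
    rw [Finset.mem_Icc]
    omega
  have key := one_le_abs_mul_prod_zpow hx0 (denPrimes n) (denExp n)
    (fun q hq => (mem_denPrimes.1 hq).2) (fun q hq _ => hnorm q hq) fun q hq hqn => by
      have h := hnorm q hq
      rw [mem_denPrimes, not_and'] at hqn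
      rwa [denExp, if_pos (not_le.1 (hqn hq)).le, zpow_zero] at h
  have key' : (1 : ℝ) ≤ |(x : ℝ)| * ((∏ p ∈ denPrimes n, (p : ℚ) ^ denExp n p : ℚ) : ℝ) := by
    exact_mod_cast key
  rw [hxlin, abs_mul, Nat.abs_cast] at key'
  have : (b : ℝ) * |linForm n| * ((∏ p ∈ denPrimes n, (p : ℚ) ^ denExp n p : ℚ) : ℝ) ≤
      b * Real.exp (-227 * n) * Real.exp ((2267 / 10 + 1 / 10) * n) := by
    gcongr
  rw [mul_assoc (b : ℝ) (Real.exp _), ← Real.exp_add] at this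
  have h4 : (-227 * n + (2267 / 10 + 1 / 10) * n : ℝ) ≤ -(1 / 10) * n := by
    have : (0 : ℝ) ≤ n := Nat.cast_nonneg n
    linarith
  have h5 := mul_le_mul_of_nonneg_left (Real.exp_le_exp.2 h4) (Nat.cast_nonneg (α := ℝ) b)
  linarith

end

section
open MeasureTheory Complex

/-- `1 / ((a + i y)^i (b + i y)^j)` as a function of `y`. -/
noncomputable def linePow (a b : ℝ) (i j : ℕ) (y : ℝ) : ℂ :=
  ((a + y * I : ℂ)⁻¹) ^ i * ((b + y * I : ℂ)⁻¹) ^ j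

lemma add_mul_I_ne_zero {a : ℝ} (ha : a ≠ 0) (y : ℝ) : (a + y * I : ℂ) ≠ 0 := fun h => ha (by
  simpa using congrArg Complex.re h)

lemma norm_add_mul_I_sq (a y : ℝ) : ‖(a + y * I : ℂ)‖ ^ 2 = a ^ 2 + y ^ 2 := by
  rw [← Complex.normSq_eq_norm_sq, Complex.normSq_add_mul_I]

lemma norm_inv_add_mul_I_le {a : ℝ} (ha : a ≠ 0) (y : ℝ) :
    ‖(a + y * I : ℂ)⁻¹‖ ≤ (min 1 |a|)⁻¹ * (√(1 + y ^ 2))⁻¹ := by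
  have hm : 0 < min 1 |a| := lt_min one_pos (abs_pos.2 ha)
  have hs : 0 < √(1 + y ^ 2) := Real.sqrt_pos.2 (by positivity)
  rw [norm_inv, ← mul_inv]
  refine inv_anti₀ (by positivity) (abs_le_of_sq_le_sq' ?_ (norm_nonneg _)).2
  rw [norm_add_mul_I_sq, mul_pow, Real.sq_sqrt (by positivity)]
  have h1 : (min 1 |a|) ^ 2 ≤ 1 := pow_le_one₀ hm.le (min_le_left _ _)
  have h2 : (min 1 |a|) ^ 2 ≤ a ^ 2 := by
    rw [← sq_abs a]
    exact pow_le_pow_left₀ hm.le (min_le_right _ _) 2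
  nlinarith [sq_nonneg y]

lemma continuous_inv_add_mul_I {a : ℝ} (ha : a ≠ 0) :
    Continuous fun y : ℝ => (a + y * I : ℂ)⁻¹ :=
  Continuous.inv₀ (by fun_prop) (add_mul_I_ne_zero ha)

lemma norm_linePow_le {a b : ℝ} (ha : a ≠ 0) (hb : b ≠ 0) {i j : ℕ} (hij : 2 ≤ i + j) (y : ℝ) :
    ‖linePow a b i j y‖ ≤ (min 1 |a|)⁻¹ ^ i * (min 1 |b|)⁻¹ ^ j * (1 + y ^ 2)⁻¹ := by
  have hma : 0 < min 1 |a| := lt_min one_pos (abs_pos.2 ha)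
  have hmb : 0 < min 1 |b| := lt_min one_pos (abs_pos.2 hb)
  have hs1 : 1 ≤ √(1 + y ^ 2) := Real.one_le_sqrt.2 (by nlinarith [sq_nonneg y])
  have hs2 : (√(1 + y ^ 2))⁻¹ ^ (i + j) ≤ (1 + y ^ 2)⁻¹ := by
    calc _ ≤ (√(1 + y ^ 2))⁻¹ ^ 2 :=
          pow_le_pow_of_le_one (by positivity) (inv_le_one_of_one_le₀ hs1) hij
      _ = _ := by rw [inv_pow, Real.sq_sqrt (by positivity)]
  rw [linePow, norm_mul, norm_pow, norm_pow]
  calc _ ≤ ((min 1 |a|)⁻¹ * (√(1 + y ^ 2))⁻¹) ^ i * ((min 1 |b|)⁻¹ * (√(1 + y ^ 2))⁻¹) ^ j := by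
        gcongr
        · exact norm_inv_add_mul_I_le ha y
        · exact norm_inv_add_mul_I_le hb y
    _ = (min 1 |a|)⁻¹ ^ i * (min 1 |b|)⁻¹ ^ j * (√(1 + y ^ 2))⁻¹ ^ (i + j) := by ring
    _ ≤ _ := by gcongr

lemma continuous_linePow {a b : ℝ} (ha : a ≠ 0) (hb : b ≠ 0) (i j : ℕ) :
    Continuous (linePow a b i j) :=
  ((continuous_inv_add_mul_I ha).pow i).mul ((continuous_inv_add_mul_I hb).pow j)

lemma integrable_linePow {a b : ℝ} (ha : a ≠ 0) (hb : b ≠ 0) {i j : ℕ} (hij : 2 ≤ i + j) :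
    Integrable (linePow a b i j) :=
  (integrable_inv_one_add_sq.const_mul _).mono' (continuous_linePow ha hb i j).aestronglyMeasurable
    (Filter.Eventually.of_forall (norm_linePow_le ha hb hij))

lemma div_sq_add_sq {a : ℝ} (ha : a ≠ 0) (y : ℝ) :
    a / (a ^ 2 + y ^ 2) = a⁻¹ * (1 + (y / a) ^ 2)⁻¹ := by
  have h : a ^ 2 + y ^ 2 ≠ 0 := by positivity
  field_simp

lemma integrable_div_sq_add_sq {a : ℝ} (ha : a ≠ 0) :
    Integrable fun y : ℝ => a / (a ^ 2 + y ^ 2) := by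
  simp only [div_sq_add_sq ha]
  exact (integrable_inv_one_add_sq.comp_div ha).const_mul _

lemma integral_univ_div_sq_add_sq {a : ℝ} (ha : a ≠ 0) :
    ∫ y : ℝ, a / (a ^ 2 + y ^ 2) = Real.pi * (|a| / a) := by
  simp only [div_sq_add_sq ha]
  rw [integral_const_mul, Measure.integral_comp_div (fun y : ℝ => (1 + y ^ 2)⁻¹),
    integral_univ_inv_one_add_sq, smul_eq_mul]
  field_simp

lemma mul_linePow_succ {a b : ℝ} (ha : a ≠ 0) (hb : b ≠ 0) (i j : ℕ) (y : ℝ) :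
    ((b : ℂ) - a) * linePow a b (i + 1) (j + 1) y =
      linePow a b (i + 1) j y - linePow a b i (j + 1) y := by
  have h1 := add_mul_I_ne_zero ha y
  have h2 := add_mul_I_ne_zero hb y
  unfold linePow
  rw [pow_succ, pow_succ]
  field_simp
  ring

/-- The integral of a difference of two simple fractions along a line. -/
lemma integral_linePow_one_one {a b : ℝ} (ha : a ≠ 0) (hb : b ≠ 0) :
    ((b : ℂ) - a) * ∫ y, linePow a b 1 1 y = Real.pi * (|a| / a - |b| / b : ℝ) := by
  have hf := (integrable_linePow ha hb (i := 1) (j := 1) le_rfl).const_mul ((b : ℂ) - a)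
  rw [← integral_const_mul]
  set f : ℝ → ℂ := fun y => ((b : ℂ) - a) * linePow a b 1 1 y with hfdef
  have h1 : ∀ y, f y + f (-y) = ((2 * (a / (a ^ 2 + y ^ 2) - b / (b ^ 2 + y ^ 2)) : ℝ) : ℂ) := by
    intro y
    have e (c : ℝ) (hc : c ≠ 0) : (c + y * I : ℂ)⁻¹ + (c + (-y : ℝ) * I : ℂ)⁻¹ =
        ((2 * (c / (c ^ 2 + y ^ 2)) : ℝ) : ℂ) := by
      have h1 := add_mul_I_ne_zero hc y
      have h2 := add_mul_I_ne_zero hc (-y)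
      have h3 : ((c ^ 2 + y ^ 2 : ℝ) : ℂ) = (c + y * I) * (c + (-y : ℝ) * I) := by
        push_cast
        linear_combination ((y : ℂ) ^ 2) * I_sq
      have h4 : (2 * c : ℂ) = (c + y * I) + (c + (-y : ℝ) * I) := by
        push_cast
        ring
      rw [ofReal_mul, ofReal_div, h3, ofReal_ofNat, ← mul_div_assoc, h4]
      generalize (c + (-y : ℝ) * I : ℂ) = v at *
      field_simp
      ring
    have m (y : ℝ) : f y = (a + y * I : ℂ)⁻¹ - (b + y * I : ℂ)⁻¹ := by
      rw [hfdef]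
      simpa [linePow] using mul_linePow_succ ha hb 0 0 y
    rw [m, m, mul_sub]
    push_cast
    have ea := e a ha
    have eb := e b hb
    push_cast at ea eb
    linear_combination ea - eb
  clear_value f
  have h2 : (∫ y, f y) + (∫ y, f y) = ∫ y, (f y + f (-y)) := by
    rw [integral_add hf hf.comp_neg, integral_neg_eq_self]
  simp only [h1] at h2
  rw [integral_complex_ofReal, integral_const_mul, integral_sub (integrable_div_sq_add_sq ha)
    (integrable_div_sq_add_sq hb), integral_univ_div_sq_add_sq ha,
      integral_univ_div_sq_add_sq hb] at h2
  push_cast at h2 ⊢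
  linear_combination h2 / 2

lemma linePow_swap (a b : ℝ) (i j : ℕ) (y : ℝ) : linePow a b i j y = linePow b a j i y :=
  mul_comm _ _

lemma integral_linePow_zero_right {a b : ℝ} (ha : a ≠ 0) (hb : b ≠ 0) (i : ℕ) :
    ∫ y, linePow a b (i + 2) 0 y = 0 := by
  have hderiv : ∀ y : ℝ, HasDerivAt (fun y : ℝ => (I / (i + 1) : ℂ) * ((a + y * I : ℂ)⁻¹) ^ (i + 1))
      (linePow a b (i + 2) 0 y) y := fun y => by
    have h0 := add_mul_I_ne_zero ha y
    have h1 : HasDerivAt (fun y : ℝ => (a + y * I : ℂ)) I y := by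
      simpa using ((hasDerivAt_id y).ofReal_comp.mul_const I).const_add (a : ℂ)
    have h2 := ((h1.inv h0).pow (i + 1)).const_mul (I / (i + 1) : ℂ)
    refine h2.congr_deriv ?_
    have h3 : (i + 1 : ℂ) ≠ 0 := by exact_mod_cast Nat.succ_ne_zero i
    unfold linePow
    simp only [Nat.add_sub_cancel, pow_zero, mul_one]
    push_cast
    have e1 : I * I = -1 := I_mul_I
    have e2 : (I / (i + 1) : ℂ) * ((i + 1) * (a + y * I : ℂ)⁻¹ ^ i * (-I / (a + y * I) ^ 2)) =
      (-(I * I)) * ((a + y * I : ℂ)⁻¹ ^ i * ((a + y * I : ℂ)⁻¹) ^ 2) := by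
      field_simp
    rw [Pi.inv_apply, e2, e1, ← pow_add]
    ring
  have hlim : ∀ l : Filter ℝ, Filter.Tendsto (fun y : ℝ => √(1 + y ^ 2)) l Filter.atTop →
      Filter.Tendsto (fun y : ℝ => (I / (i + 1) : ℂ) * ((a + y * I : ℂ)⁻¹) ^ (i + 1)) l
        (nhds 0) := by
    intro l hl
    have h1 : Filter.Tendsto (fun y : ℝ => (a + y * I : ℂ)⁻¹) l (nhds 0) := by
      refine squeeze_zero_norm (norm_inv_add_mul_I_le ha) ?_
      simpa using hl.inv_tendsto_atTop.const_mul (min 1 |a|)⁻¹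
    simpa using (h1.pow (i + 1)).const_mul (I / (i + 1) : ℂ)
  have hsq : ∀ l : Filter ℝ, Filter.Tendsto (fun y : ℝ => |y|) l Filter.atTop →
      Filter.Tendsto (fun y : ℝ => √(1 + y ^ 2)) l Filter.atTop := fun l hl =>
    Filter.tendsto_atTop_mono (fun y => Real.abs_le_sqrt (by linarith)) hl
  have := integral_of_hasDerivAt_of_tendsto hderiv
    (integrable_linePow ha hb (i := i + 2) (j := 0) (by omega))
    (hlim _ (hsq _ Filter.tendsto_abs_atBot_atTop)) (hlim _ (hsq _ Filter.tendsto_abs_atTop_atTop))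
  simpa using this

lemma integral_linePow_zero_left {a b : ℝ} (ha : a ≠ 0) (hb : b ≠ 0) (i : ℕ) :
    ∫ y, linePow a b 0 (i + 2) y = 0 := by
  simp only [linePow_swap a b]
  exact integral_linePow_zero_right hb ha i

lemma mul_integral_linePow_succ {a b : ℝ} (ha : a ≠ 0) (hb : b ≠ 0) {i j : ℕ} (hij : 1 ≤ i + j) :
    ((b : ℂ) - a) * ∫ y, linePow a b (i + 1) (j + 1) y =
      (∫ y, linePow a b (i + 1) j y) - ∫ y, linePow a b i (j + 1) y := by
  rw [← integral_const_mul, ← integral_sub (integrable_linePow ha hb (by omega))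
    (integrable_linePow ha hb (by omega))]
  simp only [mul_linePow_succ ha hb]

lemma integral_linePow_of_pos {a b : ℝ} (ha : 0 < a) (hb : 0 < b) (i j : ℕ) :
    ∫ y, linePow a b (i + 1) (j + 1) y = 0 := by
  rcases eq_or_ne a b with rfl | hab
  · have : ∀ y, linePow a a (i + 1) (j + 1) y = linePow a a (i + j + 2) 0 y := fun y => by
      unfold linePow
      ring
    simp only [this]
    exact integral_linePow_zero_right ha.ne' ha.ne' _
  have h0 : (b : ℂ) - a ≠ 0 := sub_ne_zero.2 (by exact_mod_cast hab.symm)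
  obtain ⟨m, hm⟩ : ∃ m, i + j = m := ⟨_, rfl⟩
  induction m generalizing i j with
  | zero =>
    obtain ⟨rfl, rfl⟩ : i = 0 ∧ j = 0 := by omega
    refine (mul_eq_zero.1 ?_).resolve_left h0
    rw [integral_linePow_one_one ha.ne' hb.ne', abs_of_pos ha, abs_of_pos hb, div_self ha.ne',
      div_self hb.ne']
    simp
  | succ m ih =>
    refine (mul_eq_zero.1 ?_).resolve_left h0
    rw [mul_integral_linePow_succ ha.ne' hb.ne' (by omega)]
    have h1 : ∫ y, linePow a b (i + 1) j y = 0 := by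
      cases j with
      | zero =>
        obtain rfl : i = m + 1 := by omega
        exact integral_linePow_zero_right ha.ne' hb.ne' _
      | succ j => exact ih i j (by omega)
    have h2 : ∫ y, linePow a b i (j + 1) y = 0 := by
      cases i with
      | zero =>
        obtain rfl : j = m + 1 := by omega
        exact integral_linePow_zero_left ha.ne' hb.ne' _
      | succ i => exact ih i j (by omega)
    rw [h1, h2, sub_zero]

lemma integral_linePow_of_pos_of_neg {a b : ℝ} (ha : 0 < a) (hb : b < 0) (i j : ℕ) :
    ∫ y, linePow a b (i + 1) (j + 1) y =
      (-1) ^ (j + 1) * (2 * Real.pi) * (i + j).choose i / ((a : ℂ) - b) ^ (i + j + 1) := by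
  have h0 : (a : ℂ) - b ≠ 0 := sub_ne_zero.2 (by exact_mod_cast (hb.trans ha).ne')
  obtain ⟨m, hm⟩ : ∃ m, i + j = m := ⟨_, rfl⟩
  induction m generalizing i j with
  | zero =>
    obtain ⟨rfl, rfl⟩ : i = 0 ∧ j = 0 := by omega
    have h := integral_linePow_one_one ha.ne' hb.ne
    rw [abs_of_pos ha, abs_of_neg hb, div_self ha.ne', neg_div, div_self hb.ne] at h
    push_cast at h
    rw [eq_div_iff (pow_ne_zero _ h0)]
    simp only [Nat.choose_self, Nat.cast_one, zero_add, add_zero, pow_one, mul_one]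
    linear_combination -h
  | succ m ih =>
    have h := mul_integral_linePow_succ ha.ne' hb.ne (i := i) (j := j) (by omega)
    rw [eq_div_iff (pow_ne_zero _ h0)]
    have h1 : (∫ y, linePow a b (i + 1) j y) * ((a : ℂ) - b) ^ (m + 1) =
        (-1) ^ j * (2 * Real.pi) * (if j = 0 then 0 else m.choose i : ℕ) := by
      cases j with
      | zero =>
        obtain rfl : i = m + 1 := by omega
        rw [integral_linePow_zero_right ha.ne' hb.ne]
        simp
      | succ j =>
        rw [ih i j (by omega), show i + j = m by omega, div_mul_cancel₀ _ (pow_ne_zero _ h0),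
          if_neg j.succ_ne_zero]
    have h2 : (∫ y, linePow a b i (j + 1) y) * ((a : ℂ) - b) ^ (m + 1) =
        (-1) ^ (j + 1) * (2 * Real.pi) * (if i = 0 then 0 else m.choose (i - 1) : ℕ) := by
      cases i with
      | zero =>
        obtain rfl : j = m + 1 := by omega
        rw [integral_linePow_zero_left ha.ne' hb.ne]
        simp
      | succ i =>
        rw [ih i j (by omega), show i + j = m by omega, div_mul_cancel₀ _ (pow_ne_zero _ h0),
          if_neg i.succ_ne_zero, Nat.add_sub_cancel]
    have h3 : (m + 1).choose i = (if j = 0 then 0 else m.choose i) +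
        (if i = 0 then 0 else m.choose (i - 1)) := by
      rcases i with _ | i
      · rw [if_neg (by omega)]
        simp
      · rw [Nat.choose_succ_succ, if_neg i.succ_ne_zero, Nat.add_sub_cancel]
        split_ifs with hj
        · rw [Nat.choose_eq_zero_of_lt (by omega : m < i + 1)]
          ring
        · ring
    rw [hm, h3, pow_succ, show ((a : ℂ) - b) = -(b - a) by ring] at *
    push_cast at *
    linear_combination (-(-(b - a : ℂ)) ^ (m + 1)) * h - h1 + h2

end

section
open Complex

/-- The kernel `π³ cos(π t) / sin³(π t)` on the line `Re t = 1/2`, as a sum over its poles. -/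
noncomputable def kernelSum (y : ℝ) : ℂ := ∑' m : ℤ, (((m + 1 / 2 : ℝ) + y * I : ℂ)⁻¹) ^ 3

lemma hasSum_sq_mul_geometric {r : ℂ} (hr : ‖r‖ < 1) :
    HasSum (fun n : ℕ => (n : ℂ) ^ 2 * r ^ n) (r * (1 + r) / (1 - r) ^ 3) := by
  have h1 : (1 - r) ≠ 0 := sub_ne_zero.2 fun h => by simp [← h] at hr
  have h := (((hasSum_choose_mul_geometric_of_norm_lt_one 2 hr).mul_left 2).sub
    ((hasSum_choose_mul_geometric_of_norm_lt_one 1 hr).mul_left 3)).add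
    (hasSum_choose_mul_geometric_of_norm_lt_one 0 hr)
  have hf : (fun n : ℕ => (n : ℂ) ^ 2 * r ^ n) = fun n => 2 * (((n + 2).choose 2 : ℂ) * r ^ n) -
      3 * (((n + 1).choose 1 : ℂ) * r ^ n) + ((n + 0).choose 0 : ℂ) * r ^ n := by
    funext n
    rw [Nat.choose_one_right, Nat.choose_zero_right, Nat.cast_choose_two]
    push_cast
    ring
  have hv : r * (1 + r) / (1 - r) ^ 3 =
      2 * (1 / (1 - r) ^ (2 + 1)) - 3 * (1 / (1 - r) ^ (1 + 1)) + 1 / (1 - r) ^ (0 + 1) := by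
    field_simp
    ring
  rw [hf, hv]
  exact h

lemma exp_two_pi_I_mul_half_add (y : ℝ) :
    exp (2 * Real.pi * I * (1 / 2 + y * I)) = ((-Real.exp (-2 * Real.pi * y) : ℝ) : ℂ) := by
  rw [show 2 * Real.pi * I * (1 / 2 + y * I) = Real.pi * I + (-2 * Real.pi * y : ℝ) by
    push_cast
    linear_combination (2 * Real.pi * y : ℂ) * I_sq, exp_add, exp_pi_mul_I]
  push_cast
  ring

lemma norm_kernelSum_le_of_pos {y : ℝ} (hy : 0 < y) :
    ‖kernelSum y‖ ≤ 4 * Real.pi ^ 3 * Real.exp (-2 * Real.pi * y) := by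
  have him : 0 < (1 / 2 + y * I : ℂ).im := by simpa using hy
  have h := EisensteinSeries.qExpansion_identity (k := 2) (by norm_num) ⟨1 / 2 + y * I, him⟩
  have h1 : kernelSum y = ∑' n : ℤ, 1 / ((1 / 2 + y * I : ℂ) + n) ^ (2 + 1) := by
    unfold kernelSum
    congr 1
    ext m
    rw [one_div, inv_pow]
    push_cast
    ring
  set r := Real.exp (-2 * Real.pi * y) with hr
  have hr0 : 0 < r := Real.exp_pos _
  have hr1 : r < 1 := (Real.exp_lt_exp.2 (by nlinarith [Real.pi_pos])).trans_eq Real.exp_zero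
  have hnorm : ‖((-r : ℝ) : ℂ)‖ < 1 := by
    rw [norm_real, Real.norm_eq_abs]
    exact abs_lt.2 ⟨by linarith, by linarith⟩
  have h2 : (1 - ((-r : ℝ) : ℂ)) = ((1 + r : ℝ) : ℂ) := by push_cast; ring
  have h3 : (1 + ((-r : ℝ) : ℂ)) = ((1 - r : ℝ) : ℂ) := by push_cast; ring
  rw [h1, h]
  rw [exp_two_pi_I_mul_half_add, ← hr, (hasSum_sq_mul_geometric hnorm).tsum_eq, h2, h3]
  simp only [norm_mul, norm_div, norm_pow, norm_neg, norm_real, norm_I, Real.norm_eq_abs,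
    Complex.norm_natCast, RCLike.norm_ofNat, mul_one]
  rw [abs_of_pos hr0, abs_of_pos Real.pi_pos, abs_of_pos (show 0 < 1 - r by linarith),
    abs_of_pos (show 0 < 1 + r by linarith)]
  have h4 : r * (1 - r) / (1 + r) ^ 3 ≤ r := by
    rw [div_le_iff₀ (by positivity)]
    have : 1 ≤ (1 + r) ^ 3 := one_le_pow₀ (by linarith)
    nlinarith
  have h5 : ((2 : ℕ).factorial : ℝ) = 2 := by norm_num
  rw [h5]
  have h6 : 0 < Real.pi ^ 3 := by have := Real.pi_pos; positivity
  norm_num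
  nlinarith

lemma norm_kernelSum_neg (y : ℝ) : ‖kernelSum (-y)‖ = ‖kernelSum y‖ := by
  rw [← Complex.norm_conj (kernelSum y), kernelSum, kernelSum, conj_tsum]
  congr 2
  ext m
  rw [map_pow, map_inv₀, map_add, map_mul, conj_ofReal, conj_ofReal, conj_I]
  push_cast
  ring_nf

lemma norm_kernelSum_le {y : ℝ} (hy : y ≠ 0) :
    ‖kernelSum y‖ ≤ 4 * Real.pi ^ 3 * Real.exp (-2 * Real.pi * |y|) := by
  rcases lt_or_gt_of_ne hy with h | h
  · rw [← norm_kernelSum_neg, abs_of_neg h]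
    exact norm_kernelSum_le_of_pos (by linarith)
  · rw [abs_of_pos h]
    exact norm_kernelSum_le_of_pos h

end

section
open MeasureTheory Complex

lemma half_le_abs_int_add_half (j : ℤ) : 1 / 2 ≤ |(j + 1 / 2 : ℝ)| := by
  rcases le_or_gt 0 j with h | h
  · have : (0 : ℝ) ≤ j := by exact_mod_cast h
    rw [abs_of_nonneg] <;> linarith
  · have : (j : ℝ) ≤ -1 := by exact_mod_cast (show j ≤ -1 by omega)
    rw [abs_of_neg] <;> linarith

lemma int_add_half_ne_zero (j : ℤ) : (j + 1 / 2 : ℝ) ≠ 0 :=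
  abs_pos.1 (by linarith [half_le_abs_int_add_half j])

lemma summable_int_add_half_sq_inv : Summable fun j : ℤ => ((j + 1 / 2 : ℝ) ^ 2)⁻¹ := by
  have h : Summable fun t : ℕ => ((t + 1 / 2 : ℝ) ^ 2)⁻¹ := by
    refine ((Real.summable_one_div_nat_add_rpow (1 / 2) 2).2 (by norm_num)).congr fun t => ?_
    rw [one_div, abs_of_pos (by positivity)]
    norm_num
  refine Summable.of_nat_of_neg_add_one (by simpa using h) ?_
  refine h.congr fun t => ?_
  push_cast
  congr 1
  ring

lemma norm_linePow_three_le {a b : ℝ} (ha : a ≠ 0) (hb : 1 / 2 ≤ |b|) (i : ℕ) (y : ℝ) :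
    ‖linePow a b (i + 1) 3 y‖ ≤ (min 1 |a|)⁻¹ ^ (i + 1) * 2 * (1 + y ^ 2)⁻¹ * (b ^ 2)⁻¹ := by
  have hb0 : b ≠ 0 := abs_pos.1 (by linarith)
  have h1 : linePow a b (i + 1) 3 y = linePow a b (i + 1) 1 y * ((b + y * I : ℂ)⁻¹) ^ 2 := by
    unfold linePow
    ring
  have h2 : ‖((b + y * I : ℂ)⁻¹) ^ 2‖ ≤ (b ^ 2)⁻¹ := by
    rw [norm_pow, norm_inv, inv_pow, norm_add_mul_I_sq]
    exact inv_anti₀ (by positivity) (by nlinarith [sq_nonneg y])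
  have h3 : (min 1 |b|)⁻¹ ≤ 2 := by
    rw [inv_le_comm₀ (lt_min one_pos (abs_pos.2 hb0)) two_pos]
    exact le_min (by norm_num) (by linarith)
  have h4 : 0 < min 1 |a| := lt_min one_pos (abs_pos.2 ha)
  rw [h1, norm_mul]
  refine mul_le_mul ((norm_linePow_le ha hb0 (by omega) y).trans ?_) h2 (norm_nonneg _)
    (by positivity)
  rw [pow_one]
  gcongr

/-- The rational function of the construction on the line `Re t = -3 n - 1 / 2`, as a sum of
partial fractions. -/
noncomputable def lineFun (n : ℕ) (y : ℝ) : ℂ :=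
  ∑ x ∈ poles n ×ˢ Finset.Icc 1 10,
    (pfCoeff n x.2 x.1 : ℂ) * (((x.1 - 3 * n - 1 / 2 : ℝ) + y * I : ℂ)⁻¹) ^ x.2

lemma lineShift_pos {n k : ℕ} (hk : k ∈ poles n) : (0 : ℝ) < k - 3 * n - 1 / 2 := by
  have h := (Finset.mem_Icc.1 hk).1
  have h' : (29 * n + 1 : ℝ) ≤ k := by exact_mod_cast h
  have h0 : (0 : ℝ) ≤ n := n.cast_nonneg
  linarith

lemma hasSum_integral_lineFun (n : ℕ) : HasSum (fun j : ℤ => ∑ x ∈ poles n ×ˢ Finset.Icc 1 10,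
      (pfCoeff n x.2 x.1 : ℂ) * ∫ y, linePow (x.1 - 3 * n - 1 / 2) (j + 1 / 2) x.2 3 y)
    (∫ y, lineFun n y * kernelSum y) := by
  set F : ℤ → ℝ → ℂ := fun j y => ∑ x ∈ poles n ×ˢ Finset.Icc 1 10,
    (pfCoeff n x.2 x.1 : ℂ) * linePow (x.1 - 3 * n - 1 / 2) (j + 1 / 2) x.2 3 y with hF
  have hInt : ∀ x ∈ poles n ×ˢ Finset.Icc 1 10, ∀ j : ℤ, Integrable fun y =>
      (pfCoeff n x.2 x.1 : ℂ) * linePow (x.1 - 3 * n - 1 / 2) (j + 1 / 2) x.2 3 y :=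
    fun x hx j => (integrable_linePow (lineShift_pos (Finset.mem_product.1 hx).1).ne'
      (int_add_half_ne_zero j) (by omega)).const_mul _
  set Cst : ℝ := ∑ x ∈ poles n ×ˢ Finset.Icc 1 10, ‖(pfCoeff n x.2 x.1 : ℂ)‖ *
    ((min 1 |(x.1 - 3 * n - 1 / 2 : ℝ)|)⁻¹ ^ x.2 * 2) with hC
  have hbound : ∀ j y, ‖F j y‖ ≤ (Cst * ((j + 1 / 2 : ℝ) ^ 2)⁻¹) * (1 + y ^ 2)⁻¹ := by
    intro j y
    rw [hF, hC, Finset.sum_mul, Finset.sum_mul]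
    refine (norm_sum_le _ _).trans (Finset.sum_le_sum fun x hx => ?_)
    obtain ⟨h1, h2⟩ := Finset.mem_product.1 hx
    obtain ⟨i, hi⟩ := Nat.exists_eq_add_of_le' (Finset.mem_Icc.1 h2).1
    rw [norm_mul, hi]
    calc _ ≤ ‖(pfCoeff n (i + 1) x.1 : ℂ)‖ * _ := mul_le_mul_of_nonneg_left
          (norm_linePow_three_le (lineShift_pos h1).ne' (half_le_abs_int_add_half j) i y)
          (norm_nonneg _)
      _ = _ := by ring
  have hFint : ∀ j, Integrable (F j) := fun j => integrable_finsetSum _ fun x hx => hInt x hx j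
  have hsum : Summable fun j => ∫ y, ‖F j y‖ := by
    refine Summable.of_nonneg_of_le (fun j => integral_nonneg fun y => norm_nonneg _) (fun j => ?_)
      (summable_int_add_half_sq_inv.mul_left (Cst * Real.pi))
    calc ∫ y, ‖F j y‖ ≤ ∫ y : ℝ, (Cst * ((j + 1 / 2 : ℝ) ^ 2)⁻¹) * (1 + y ^ 2)⁻¹ :=
          integral_mono (hFint j).norm (integrable_inv_one_add_sq.const_mul _) (hbound j)
      _ = _ := by
        rw [integral_const_mul, integral_univ_inv_one_add_sq]
        ring
  have h1 : (fun j : ℤ => ∑ x ∈ poles n ×ˢ Finset.Icc 1 10, (pfCoeff n x.2 x.1 : ℂ) *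
      ∫ y, linePow (x.1 - 3 * n - 1 / 2) (j + 1 / 2) x.2 3 y) = fun j => ∫ y, F j y := by
    funext j
    rw [hF, integral_finsetSum _ fun x hx => hInt x hx j]
    exact Finset.sum_congr rfl fun x _ => (integral_const_mul _ _).symm
  have h2 : (fun y => lineFun n y * kernelSum y) = fun y => ∑' j, F j y := by
    funext y
    rw [kernelSum, ← tsum_mul_left]
    refine tsum_congr fun j => ?_
    rw [hF, lineFun, Finset.sum_mul]
    refine Finset.sum_congr rfl fun x _ => ?_
    rw [linePow, mul_assoc]
  rw [h1, h2]
  exact hasSum_integral_of_summable_integral_norm hFint hsum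

/-- The terms of the series of the linear form. -/
noncomputable def formTerm (n t : ℕ) : ℝ := ∑ x ∈ poles n ×ˢ Finset.Icc 1 10,
  (pfCoeff n x.2 x.1 : ℝ) * (((x.2 + 1).choose 2 : ℝ) *
    (1 / ((x.1 : ℝ) - (27 * n + 1) + t) ^ (x.2 + 2)))

lemma formTerm_eq_zero {n t : ℕ} (hn : 0 < n) (ht : t < 27 * n + 1) : formTerm n t = 0 := by
  have h := sum_pfCoeff_mul_eq_zero hn (a := 27 * n + 1 - t) (Finset.mem_Icc.2 (by omega))
  have h' := congrArg ((↑) : ℚ → ℝ) h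
  rw [← Finset.sum_product'] at h'
  rw [formTerm]
  rw [Rat.cast_sum, Rat.cast_zero] at h'
  rw [← h']
  refine Finset.sum_congr rfl fun x _ => ?_
  rw [Nat.cast_choose_two]
  push_cast [Nat.cast_sub ht.le]
  rw [one_div, inv_pow]
  congr 2
  · ring
  · congr 2
    ring

lemma zetaR_hasSum_tail {s : ℕ} (hs : 2 ≤ s) (N : ℕ) :
    HasSum (fun t : ℕ => 1 / ((t + N : ℕ) + 1 : ℝ) ^ s)
      (zetaR s - ∑ l ∈ Finset.Icc 1 N, ((l : ℝ) ^ s)⁻¹) := by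
  have h : HasSum (fun t : ℕ => 1 / (t + 1 : ℝ) ^ s) (zetaR s) := by
    have := (summable_nat_add_iff 1).2 (Real.summable_one_div_nat_pow.2 (show 1 < s by omega))
    exact (by simpa using this : Summable fun t : ℕ => 1 / (t + 1 : ℝ) ^ s).hasSum
  have h2 : ∑ l ∈ Finset.range N, 1 / (l + 1 : ℝ) ^ s =
      ∑ l ∈ Finset.Icc 1 N, ((l : ℝ) ^ s)⁻¹ := by
    rw [Finset.range_eq_Ico, ← Finset.Ico_add_one_right_eq_Icc,
      ← Finset.sum_Ico_add' (fun l : ℕ => ((l : ℝ) ^ s)⁻¹) 0 N 1]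
    exact Finset.sum_congr rfl fun l _ => by push_cast; rw [one_div]
  rw [← h2]
  exact (hasSum_nat_add_iff' N).2 h

lemma linForm_eq_sum (n : ℕ) : linForm n = ∑ x ∈ poles n ×ˢ Finset.Icc 1 10,
    (pfCoeff n x.2 x.1 : ℝ) * (((x.2 + 1).choose 2 : ℝ) *
      (zetaR (x.2 + 2) - ∑ l ∈ Finset.Icc 1 (x.1 - 27 * n - 2), ((l : ℝ) ^ (x.2 + 2))⁻¹)) := by
  have h1 : ∑ x ∈ poles n ×ˢ Finset.Icc 1 10,
      (pfCoeff n x.2 x.1 : ℝ) * (((x.2 + 1).choose 2 : ℝ) * zetaR (x.2 + 2)) =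
      ∑ i ∈ Finset.Icc 1 10, (zetaCoeff n i : ℝ) * zetaR (i + 2) := by
    rw [Finset.sum_product_right]
    refine Finset.sum_congr rfl fun i _ => ?_
    rw [zetaCoeff]
    push_cast
    rw [Finset.mul_sum, Finset.sum_mul]
    exact Finset.sum_congr rfl fun k _ => by ring
  have h2 : ∑ i ∈ ({3, 5, 7, 9} : Finset ℕ), (zetaCoeff n i : ℝ) * zetaR (i + 2) =
      ∑ i ∈ Finset.Icc 1 10, (zetaCoeff n i : ℝ) * zetaR (i + 2) := by
    refine Finset.sum_subset (by decide) fun i hi hi' => ?_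
    have h0 : zetaCoeff n i = 0 := by
      rw [zetaCoeff, mul_eq_zero]
      right
      by_cases he : Even i
      · exact sum_pfCoeff_of_even (Finset.mem_Icc.1 hi).2 he
      · have : i = 1 := by
          revert hi hi' he
          clear h1
          revert i
          decide
        rw [this]
        exact sum_pfCoeff_one n
    rw [h0, Rat.cast_zero, zero_mul]
  have h3 : (ratPart n : ℝ) = ∑ x ∈ poles n ×ˢ Finset.Icc 1 10,
      (pfCoeff n x.2 x.1 : ℝ) * (((x.2 + 1).choose 2 : ℝ) *
        ∑ l ∈ Finset.Icc 1 (x.1 - 27 * n - 2), ((l : ℝ) ^ (x.2 + 2))⁻¹) := by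
    rw [ratPart]
    unfold ratTerm
    push_cast
    rfl
  rw [linForm, h2, h3, ← h1, ← Finset.sum_sub_distrib]
  exact Finset.sum_congr rfl fun x _ => by ring

lemma hasSum_formTerm {n : ℕ} (hn : 0 < n) : HasSum (formTerm n) (linForm n) := by
  rw [linForm_eq_sum]
  refine hasSum_sum fun x hx => ((HasSum.mul_left _ ?_).mul_left _)
  obtain ⟨h1, h2⟩ := Finset.mem_product.1 hx
  have h3 := (Finset.mem_Icc.1 h1).1
  obtain ⟨N, hN⟩ := Nat.exists_eq_add_of_le (show 27 * n + 2 ≤ x.1 by omega)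
  rw [show x.1 - 27 * n - 2 = N by omega]
  refine (zetaR_hasSum_tail (show 2 ≤ x.2 + 2 by omega) N).congr_fun fun t => ?_
  rw [hN]
  push_cast
  ring_nf

lemma integral_linePow_eq_formTerm (n t : ℕ) : ∑ x ∈ poles n ×ˢ Finset.Icc 1 10,
      (pfCoeff n x.2 x.1 : ℂ) *
        ∫ y, linePow (x.1 - 3 * n - 1 / 2) (Int.negSucc t + 1 / 2) x.2 3 y =
    ((-2 * Real.pi * formTerm n (t + 24 * n + 1) : ℝ) : ℂ) := by
  rw [formTerm, Finset.mul_sum, ofReal_sum]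
  refine Finset.sum_congr rfl fun x hx => ?_
  obtain ⟨h1, h2⟩ := Finset.mem_product.1 hx
  obtain ⟨i, hi⟩ := Nat.exists_eq_add_of_le' (Finset.mem_Icc.1 h2).1
  have hneg : (Int.negSucc t + 1 / 2 : ℝ) < 0 := by
    rw [Int.cast_negSucc]
    have : (0 : ℝ) ≤ t := t.cast_nonneg
    push_cast
    linarith
  rw [hi, integral_linePow_of_pos_of_neg (lineShift_pos h1) hneg i 2, Nat.choose_symm_add,
    Int.cast_negSucc]
  push_cast
  rw [show (x.1 - 3 * n - 1 / 2 - (-(t + 1) + 1 / 2) : ℂ) =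
    x.1 - (27 * n + 1) + (t + 24 * n + 1) by ring]
  ring

lemma integral_lineFun {n : ℕ} (hn : 0 < n) :
    ∫ y, lineFun n y * kernelSum y = ((-2 * Real.pi * linForm n : ℝ) : ℂ) := by
  have h1 := hasSum_integral_lineFun n
  have hinj : Function.Injective Int.negSucc := fun a b h => Int.negSucc.inj h
  rw [← hinj.hasSum_iff] at h1
  · have h2 : HasSum (fun t => formTerm n (t + 24 * n + 1)) (linForm n) := by
      have h := (hasSum_nat_add_iff' (24 * n + 1)).2 (hasSum_formTerm hn)
      rw [Finset.sum_eq_zero fun t ht => formTerm_eq_zero hn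
        ((Finset.mem_range.1 ht).trans_le (by omega)), sub_zero] at h
      exact h
    refine h1.unique ?_
    convert (hasSum_ofReal.2 (h2.mul_left (-2 * Real.pi))) using 1
    funext t
    exact integral_linePow_eq_formTerm n t
  · intro j hj
    refine Finset.sum_eq_zero fun x hx => ?_
    obtain ⟨h1, h2⟩ := Finset.mem_product.1 hx
    obtain ⟨i, hi⟩ := Nat.exists_eq_add_of_le' (Finset.mem_Icc.1 h2).1
    have hj0 : 0 ≤ j := by
      rcases j with t | t
      · exact Int.natCast_nonneg t
      · exact absurd ⟨t, rfl⟩ hj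
    have hj1 : (0 : ℝ) ≤ j := by exact_mod_cast hj0
    rw [hi, integral_linePow_of_pos (lineShift_pos h1) (by linarith) i 2, mul_zero]

lemma lineFun_eq (n : ℕ) (y : ℝ) {z : ℂ} (hz : z = (-(3 * n) - 1 / 2 : ℝ) + y * I) :
    lineFun n y = Polynomial.aeval z (numPoly n) * ∏ j ∈ poles n, ((z + j)⁻¹) ^ 10 := by
  have h (k : ℕ) : z + k = (k - 3 * n - 1 / 2 : ℝ) + y * I := by
    rw [hz]
    push_cast
    ring
  rw [eval_numPoly_div fun j hj => by
    rw [h]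
    exact add_mul_I_ne_zero (lineShift_pos hj).ne' y, lineFun, Finset.sum_product]
  simp only [h]

lemma abs_linForm_le {n : ℕ} (hn : 0 < n) {B : ℝ}
    (h : ∀ y : ℝ, y ≠ 0 → ‖lineFun n y‖ * Real.exp (-2 * Real.pi * |y|) ≤ B * (1 + y ^ 2)⁻¹) :
    |linForm n| ≤ 2 * Real.pi ^ 3 * B := by
  have hpi := Real.pi_pos
  have h1 : ‖∫ y, lineFun n y * kernelSum y‖ ≤ ∫ y : ℝ, (4 * Real.pi ^ 3 * B) * (1 + y ^ 2)⁻¹ := by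
    refine norm_integral_le_of_norm_le (integrable_inv_one_add_sq.const_mul _) ?_
    filter_upwards [Measure.ae_ne volume (0 : ℝ)] with y hy
    rw [norm_mul]
    calc _ ≤ ‖lineFun n y‖ * (4 * Real.pi ^ 3 * Real.exp (-2 * Real.pi * |y|)) :=
          mul_le_mul_of_nonneg_left (norm_kernelSum_le hy) (norm_nonneg _)
      _ = 4 * Real.pi ^ 3 * (‖lineFun n y‖ * Real.exp (-2 * Real.pi * |y|)) := by ring
      _ ≤ 4 * Real.pi ^ 3 * (B * (1 + y ^ 2)⁻¹) :=
          mul_le_mul_of_nonneg_left (h y hy) (by positivity)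
      _ = _ := by ring
  rw [integral_lineFun hn, norm_real, Real.norm_eq_abs, abs_mul, abs_mul, abs_neg,
    abs_of_pos hpi, abs_two, integral_const_mul, integral_univ_inv_one_add_sq] at h1
  have h2 : (2 * Real.pi) * |linForm n| ≤ (2 * Real.pi) * (2 * Real.pi ^ 3 * B) := by linarith
  exact le_of_mul_le_mul_left h2 (by positivity)

end

section
open Real

/-- The primitive in `s` of `log |s + i y|` vanishing at `s = 0`. -/
noncomputable def logPrim (s y : ℝ) : ℝ := s * (log (s ^ 2 + y ^ 2) / 2) - s + y * arctan (s / y)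

lemma hasDerivAt_logPrim {y : ℝ} (hy : 0 < y) (s : ℝ) :
    HasDerivAt (fun s => logPrim s y) (log (s ^ 2 + y ^ 2) / 2) s := by
  have hp : s ^ 2 + y ^ 2 ≠ 0 := by positivity
  have hp' : y ^ 2 + s ^ 2 ≠ 0 := by positivity
  have h1 : HasDerivAt (fun s : ℝ => s ^ 2 + y ^ 2) (2 * s) s := by
    simpa using (hasDerivAt_pow 2 s).add_const (y ^ 2)
  have h2 := ((hasDerivAt_id s).mul ((h1.log hp).div_const 2)).sub (hasDerivAt_id s)
  have h3 := (((hasDerivAt_id s).div_const y).arctan).const_mul y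
  refine (h2.add h3).congr_deriv ?_
  simp only [id]
  field_simp
  ring

lemma logPrim_zero (y : ℝ) : logPrim 0 y = 0 := by simp [logPrim]

lemma logPrim_neg (s y : ℝ) : logPrim (-s) y = -logPrim s y := by
  rw [logPrim, logPrim, neg_div, arctan_neg, neg_sq]
  ring

lemma logPrim_sub_le {y s t : ℝ} (hy : 0 < y) (hst : s < t) (h : -s ≤ t) :
    logPrim t y - logPrim s y ≤ (t - s) * (log (t ^ 2 + y ^ 2) / 2) := by
  obtain ⟨c, hc, he⟩ := exists_hasDerivAt_eq_slope _ _ hst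
    (fun x _ => (hasDerivAt_logPrim hy x).continuousAt.continuousWithinAt)
    (fun x _ => hasDerivAt_logPrim hy x)
  have h1 : log (c ^ 2 + y ^ 2) ≤ log (t ^ 2 + y ^ 2) :=
    log_le_log (by positivity) (by nlinarith [hc.1, hc.2])
  rw [eq_div_iff (by linarith)] at he
  nlinarith

lemma le_logPrim_sub {y s t : ℝ} (hy : 0 < y) (hst : s < t) (h : 0 ≤ s) :
    (t - s) * (log (s ^ 2 + y ^ 2) / 2) ≤ logPrim t y - logPrim s y := by
  obtain ⟨c, hc, he⟩ := exists_hasDerivAt_eq_slope _ _ hst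
    (fun x _ => (hasDerivAt_logPrim hy x).continuousAt.continuousWithinAt)
    (fun x _ => hasDerivAt_logPrim hy x)
  have h1 : log (s ^ 2 + y ^ 2) ≤ log (c ^ 2 + y ^ 2) :=
    log_le_log (by positivity) (by nlinarith [hc.1, hc.2])
  rw [eq_div_iff (by linarith)] at he
  nlinarith

lemma logPrim_mul {n : ℝ} (hn : 0 < n) {y : ℝ} (hy : 0 < y) (s : ℝ) :
    logPrim (s * n) (y * n) = n * logPrim s y + s * n * log n := by
  rw [logPrim, logPrim, mul_div_mul_right _ _ hn.ne',
    show (s * n) ^ 2 + (y * n) ^ 2 = n ^ 2 * (s ^ 2 + y ^ 2) by ring,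
    log_mul (by positivity) (by positivity), log_pow]
  push_cast
  ring

/-- The primitive of the arctangent vanishing at `0`. -/
noncomputable def arctanPrim (x : ℝ) : ℝ := x * arctan x - log (1 + x ^ 2) / 2

lemma hasDerivAt_arctanPrim (x : ℝ) : HasDerivAt arctanPrim (arctan x) x := by
  have hp : 1 + x ^ 2 ≠ 0 := by positivity
  have h1 : HasDerivAt (fun s : ℝ => 1 + s ^ 2) (2 * x) x := by
    simpa using (hasDerivAt_pow 2 x).const_add 1
  refine (((hasDerivAt_id x).mul (hasDerivAt_arctan x)).sub
    ((h1.log hp).div_const 2)).congr_deriv ?_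
  simp only [id]
  field_simp
  ring

lemma arctanPrim_zero : arctanPrim 0 = 0 := by simp [arctanPrim]

lemma nonneg_of_hasDerivAt {f f' : ℝ → ℝ} (hf : ∀ x, HasDerivAt f (f' x) x) (h0 : f 0 = 0)
    (h : ∀ x, 0 ≤ x → 0 ≤ f' x) {x : ℝ} (hx : 0 ≤ x) : 0 ≤ f x := by
  have hm : MonotoneOn f (Set.Ici 0) := by
    refine monotoneOn_of_deriv_nonneg (convex_Ici 0)
      (fun x _ => (hf x).continuousAt.continuousWithinAt)
      (fun x _ => (hf x).differentiableAt.differentiableWithinAt) fun x hx => ?_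
    rw [(hf x).deriv]
    rw [interior_Ici] at hx
    exact h x (le_of_lt hx)
  rw [← h0]
  exact hm Set.self_mem_Ici hx hx

lemma arctan_le_self' {x : ℝ} (hx : 0 ≤ x) : arctan x ≤ x := by
  refine sub_nonneg.1 (nonneg_of_hasDerivAt (f := fun x => x - arctan x)
    (fun x => (hasDerivAt_id x).sub (hasDerivAt_arctan x)) (by simp) (fun x _ => ?_) hx)
  rw [sub_nonneg, div_le_one (by positivity)]
  nlinarith [sq_nonneg x]

lemma sub_cube_le_arctan {x : ℝ} (hx : 0 ≤ x) : x - x ^ 3 / 3 ≤ arctan x := by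
  refine sub_nonneg.1 (nonneg_of_hasDerivAt (f := fun x => arctan x - (x - x ^ 3 / 3))
    (fun x => (hasDerivAt_arctan x).sub
      ((hasDerivAt_id x).sub ((hasDerivAt_pow 3 x).div_const 3))) (by simp) (fun x _ => ?_) hx)
  have h : 0 < 1 + x ^ 2 := by positivity
  rw [sub_nonneg, le_div_iff₀ h]
  push_cast
  nlinarith [sq_nonneg (x ^ 2)]

lemma arctanPrim_le {x : ℝ} (hx : 0 ≤ x) : arctanPrim x ≤ x ^ 2 / 2 := by
  refine sub_nonneg.1 (nonneg_of_hasDerivAt (f := fun x => x ^ 2 / 2 - arctanPrim x)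
    (fun x => ((hasDerivAt_pow 2 x).div_const 2).sub (hasDerivAt_arctanPrim x))
    (by simp [arctanPrim_zero]) (fun x hx => ?_) hx)
  have := arctan_le_self' hx
  norm_num
  linarith

lemma le_arctanPrim {x : ℝ} (hx : 0 ≤ x) : x ^ 2 / 2 - x ^ 4 / 12 ≤ arctanPrim x := by
  refine sub_nonneg.1 (nonneg_of_hasDerivAt (f := fun x => arctanPrim x - (x ^ 2 / 2 - x ^ 4 / 12))
    (fun x => (hasDerivAt_arctanPrim x).sub (((hasDerivAt_pow 2 x).div_const 2).sub
      ((hasDerivAt_pow 4 x).div_const 12)))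
    (by simp [arctanPrim_zero]) (fun x hx => ?_) hx)
  have := sub_cube_le_arctan hx
  norm_num
  linarith

lemma arctanPrim_tangent (x : ℝ) : x * (π / 4) - log 2 / 2 ≤ arctanPrim x := by
  have h1 : arctanPrim 1 = π / 4 - log 2 / 2 := by
    rw [arctanPrim, arctan_one]
    norm_num
  have hc (s : Set ℝ) : ContinuousOn arctanPrim s :=
    fun x _ => (hasDerivAt_arctanPrim x).continuousAt.continuousWithinAt
  rcases lt_trichotomy x 1 with h | h | h
  · obtain ⟨c, hc, he⟩ := exists_hasDerivAt_eq_slope _ _ h (hc _)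
      (fun x _ => hasDerivAt_arctanPrim x)
    have := arctan_strictMono hc.2
    rw [eq_div_iff (by linarith)] at he
    rw [arctan_one] at this
    nlinarith
  · rw [h, h1, one_mul]
  · obtain ⟨c, hc, he⟩ := exists_hasDerivAt_eq_slope _ _ h (hc _)
      (fun x _ => hasDerivAt_arctanPrim x)
    have := arctan_strictMono hc.1
    rw [eq_div_iff (by linarith)] at he
    rw [arctan_one] at this
    nlinarith

/-- The difference between `logPrim s y` and its linear part `s log s - s + π y / 2`. -/
noncomputable def logDefect (s y : ℝ) : ℝ := s * arctanPrim (y / s)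

lemma logPrim_eq {s y : ℝ} (hs : 0 < s) (hy : 0 < y) :
    logPrim s y = s * log s - s + π / 2 * y - logDefect s y := by
  have h1 : s ^ 2 + y ^ 2 = s ^ 2 * (1 + (y / s) ^ 2) := by field_simp
  rw [logPrim, logDefect, arctanPrim, ← inv_div y s, arctan_inv_of_pos (by positivity), h1,
    log_mul (by positivity) (by positivity), log_pow]
  field_simp
  push_cast
  ring

lemma logDefect_le {s y : ℝ} (hs : 0 < s) (hy : 0 ≤ y) : logDefect s y ≤ y ^ 2 / (2 * s) := by
  have h := mul_le_mul_of_nonneg_left (arctanPrim_le (div_nonneg hy hs.le)) hs.le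
  refine h.trans_eq ?_
  field_simp

lemma le_logDefect {s y : ℝ} (hs : 0 < s) (hy : 0 ≤ y) :
    y ^ 2 / (2 * s) - y ^ 4 / (12 * s ^ 3) ≤ logDefect s y := by
  have h := mul_le_mul_of_nonneg_left (le_arctanPrim (div_nonneg hy hs.le)) hs.le
  refine h.trans_eq' ?_
  field_simp

lemma logDefect_tangent {s : ℝ} (hs : 0 < s) (y : ℝ) :
    π / 4 * y - s * log 2 / 2 ≤ logDefect s y := by
  have h := mul_le_mul_of_nonneg_left (arctanPrim_tangent (y / s)) hs.le
  refine h.trans_eq' ?_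
  field_simp

lemma hasDerivAt_logDefect {s y : ℝ} (hs : 0 < s) :
    HasDerivAt (fun s => logDefect s y) (-(log (1 + (y / s) ^ 2) / 2)) s := by
  have h1 : HasDerivAt (fun s : ℝ => y / s) (-y / s ^ 2) s :=
    ((hasDerivAt_const s y).div (hasDerivAt_id s) hs.ne').congr_deriv (by simp)
  refine ((hasDerivAt_id s).mul ((hasDerivAt_arctanPrim (y / s)).comp s h1)).congr_deriv ?_
  simp only [id, Function.comp, arctanPrim]
  field_simp
  ring

lemma logDefect_sub_bounds {s t : ℝ} (hs : 0 < s) (hst : s < t) (y : ℝ) :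
    (t - s) * (log (1 + (y / t) ^ 2) / 2) ≤ logDefect s y - logDefect t y ∧
      logDefect s y - logDefect t y ≤ (t - s) * (log (1 + (y / s) ^ 2) / 2) := by
  obtain ⟨c, hc, he⟩ := exists_hasDerivAt_eq_slope _ _ hst
    (fun x hx => (hasDerivAt_logDefect (hs.trans_le hx.1) (y := y)).continuousAt.continuousWithinAt)
    (fun x hx => hasDerivAt_logDefect (hs.trans hx.1))
  have hc0 : 0 < c := hs.trans hc.1
  have h1 : log (1 + (y / t) ^ 2) ≤ log (1 + (y / c) ^ 2) := by
    refine log_le_log (by positivity) ?_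
    rw [div_pow, div_pow]
    have := hc.2
    gcongr
  have h2 : log (1 + (y / c) ^ 2) ≤ log (1 + (y / s) ^ 2) := by
    refine log_le_log (by positivity) ?_
    rw [div_pow, div_pow]
    have := hc.1
    gcongr
  rw [eq_div_iff (by linarith)] at he
  constructor <;> nlinarith

end

section
open Real

/-- The logarithm of `∏ |l + 1 / 2 + i y|` over `l < N`. -/
noncomputable def logSum (N : ℕ) (y : ℝ) : ℝ :=
  ∑ l ∈ Finset.range N, log ((l + 1 / 2) ^ 2 + y ^ 2) / 2

lemma half_log_sq_add_sq_le {s y T : ℝ} (hs : 0 ≤ s) (hy : 0 < y) (hT : s + y ≤ T) :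
    log (s ^ 2 + y ^ 2) / 2 ≤ log T := by
  have h : log (s ^ 2 + y ^ 2) ≤ log (T ^ 2) :=
    log_le_log (by positivity) (by nlinarith [mul_nonneg hs hy.le])
  rw [log_pow] at h
  push_cast at h
  linarith

lemma neg_one_le_half_log {s y : ℝ} (hs : 1 / 2 ≤ s) : -1 ≤ log (s ^ 2 + y ^ 2) / 2 := by
  have h : log ((1 / 2) ^ 2) ≤ log (s ^ 2 + y ^ 2) :=
    log_le_log (by norm_num) (by nlinarith [sq_nonneg y])
  rw [log_pow, one_div, log_inv] at h
  push_cast at h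
  linarith [log_two_lt_d9]

lemma neg_one_le_logPrim_half {y : ℝ} (hy : 0 < y) : -1 ≤ logPrim (1 / 2) y := by
  have h1 := neg_one_le_half_log (le_refl (1 / 2 : ℝ)) (y := y)
  have h2 : 0 ≤ y * arctan (1 / 2 / y) := mul_nonneg hy.le (arctan_nonneg.2 (by positivity))
  rw [logPrim]
  linarith

lemma logSum_le_sub {y : ℝ} (hy : 0 < y) (N : ℕ) :
    logSum N y ≤ logPrim (N + 1 / 2) y - logPrim (1 / 2) y := by
  induction N with
  | zero => simp [logSum]
  | succ N ih =>
    rw [logSum, Finset.sum_range_succ]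
    have h := le_logPrim_sub hy (s := N + 1 / 2) (t := N + 1 + 1 / 2) (by linarith)
      (by positivity)
    rw [logSum] at ih
    push_cast
    linarith

lemma add_le_logSum {y : ℝ} (hy : 0 < y) (N : ℕ) :
    logPrim (N - 1 / 2) y + logPrim (1 / 2) y ≤ logSum N y := by
  induction N with
  | zero =>
    rw [Nat.cast_zero, zero_sub, logPrim_neg]
    simp [logSum]
  | succ N ih =>
    rw [logSum, Finset.sum_range_succ]
    have h0 : (0 : ℝ) ≤ N := N.cast_nonneg
    have h := logPrim_sub_le hy (s := N - 1 / 2) (t := N + 1 / 2) (by linarith) (by linarith)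
    rw [logSum] at ih
    push_cast
    rw [show (N + 1 - 1 / 2 : ℝ) = N + 1 / 2 by ring]
    linarith

lemma logSum_le {y T : ℝ} (hy : 0 < y) {N : ℕ} (hT : N + 1 + y ≤ T) :
    logSum N y ≤ logPrim N y + (log T + 1) := by
  have h0 : (0 : ℝ) ≤ N := N.cast_nonneg
  have h1 := logSum_le_sub hy N
  have h2 := neg_one_le_logPrim_half hy
  have h3 := logPrim_sub_le hy (s := N) (t := N + 1 / 2) (by linarith) (by linarith)
  have h4 := half_log_sq_add_sq_le (s := N + 1 / 2) (by linarith) hy (show _ ≤ T by linarith)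
  have h5 : 0 ≤ log T := log_nonneg (by linarith)
  linarith

lemma le_logSum {y T : ℝ} (hy : 0 < y) {N : ℕ} (hT : N + 1 + y ≤ T) :
    logPrim N y - (log T + 1) ≤ logSum N y := by
  have h5 : 0 ≤ log T := log_nonneg (by
    have : (0 : ℝ) ≤ N := N.cast_nonneg
    linarith)
  rcases N.eq_zero_or_pos with rfl | hN
  · rw [Nat.cast_zero, logPrim_zero]
    simp only [logSum, Finset.range_zero, Finset.sum_empty]
    linarith
  have h0 : (1 : ℝ) ≤ N := by exact_mod_cast hN
  have h1 := add_le_logSum hy N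
  have h2 := neg_one_le_logPrim_half hy
  have h3 := logPrim_sub_le hy (s := N - 1 / 2) (t := N) (by linarith) (by linarith)
  have h4 := half_log_sq_add_sq_le (s := N) (by linarith) hy (show _ ≤ T by linarith)
  linarith

lemma logSum_succ_le {y T : ℝ} (hy : 0 < y) {N : ℕ} (hT : N + 1 + y ≤ T) :
    logSum (N + 1) y ≤ logPrim N y + (2 * log T + 1) := by
  have h4 := half_log_sq_add_sq_le (s := N + 1 / 2) (by positivity) hy (show _ ≤ T by linarith)
  have h := logSum_le hy hT
  rw [logSum, Finset.sum_range_succ, ← logSum]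
  linarith

lemma le_logSum_succ {y T : ℝ} (hy : 0 < y) {N : ℕ} (hT : N + 1 + y ≤ T) :
    logPrim N y - (log T + 2) ≤ logSum (N + 1) y := by
  have h0 : (0 : ℝ) ≤ N := N.cast_nonneg
  have h4 := neg_one_le_half_log (s := N + 1 / 2) (y := y) (by linarith)
  have h := le_logSum hy hT
  rw [logSum, Finset.sum_range_succ, ← logSum]
  linarith

lemma log_factorial_le (m : ℕ) : log m.factorial ≤ (m + 1) * log (m + 1) - m := by
  induction m with
  | zero => simp
  | succ m ih =>
    have h0 : (0 : ℝ) < m + 1 := by positivity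
    rw [Nat.factorial_succ]
    push_cast
    rw [log_mul (by positivity) (by positivity)]
    have h : log ((m + 1) / (m + 1 + 1)) ≤ (m + 1) / (m + 1 + 1 : ℝ) - 1 :=
      log_le_sub_one_of_pos (by positivity)
    rw [log_div (by positivity) (by positivity)] at h
    have h1 : ((m + 1) / (m + 1 + 1 : ℝ) - 1) * (m + 1 + 1) = -1 := by
      field_simp
      ring
    nlinarith

lemma log_factorial_le' {m : ℕ} {T : ℝ} (hm : 0 < m) (hT : m + 1 ≤ T) :
    log m.factorial ≤ m * log m - m + (log T + 1) := by
  have h := log_factorial_le m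
  have h0 : (0 : ℝ) < m := by exact_mod_cast hm
  have h1 : log ((m + 1) / m) ≤ (m + 1) / m - 1 := log_le_sub_one_of_pos (by positivity)
  rw [log_div (by positivity) (by positivity)] at h1
  have h2 : ((m + 1) / m - 1 : ℝ) * m = 1 := by
    field_simp
    ring
  have h3 := log_le_log (by positivity) hT
  nlinarith

lemma le_log_factorial {m : ℕ} (hm : 0 < m) : m * log m - m ≤ log m.factorial := by
  have h0 : (0 : ℝ) < m := by exact_mod_cast hm
  have h := Real.pow_div_factorial_le_exp (m : ℝ) h0.le m
  have h1 := log_le_log (by positivity) h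
  rw [log_exp, log_div (by positivity) (by positivity), log_pow] at h1
  linarith

end

section
open Complex

lemma log_norm_add_mul_I (s y : ℝ) : Real.log ‖(s + y * I : ℂ)‖ = Real.log (s ^ 2 + y ^ 2) / 2 := by
  rw [← norm_add_mul_I_sq, Real.log_pow]
  push_cast
  ring

lemma sum_log_norm_Icc {z : ℂ} {n : ℕ} {y : ℝ} (hz : z = (-(3 * n) - 1 / 2 : ℝ) + y * I)
    {p q : ℕ} (h : p ≤ q) :
    ∑ j ∈ Finset.Icc (3 * n + p + 1) (3 * n + q), Real.log ‖z + j‖ = logSum q y - logSum p y := by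
  rw [logSum, logSum, ← Finset.sum_Ico_eq_sub _ h, ← Finset.Ico_add_one_right_eq_Icc]
  rw [show 3 * n + p + 1 = p + (3 * n + 1) by ring, show 3 * n + q + 1 = q + (3 * n + 1) by ring,
    ← Finset.sum_Ico_add']
  refine Finset.sum_congr rfl fun l _ => ?_
  rw [hz, ← log_norm_add_mul_I]
  congr 2
  push_cast
  ring

lemma sum_log_norm_Icc_left {z : ℂ} {n : ℕ} {y : ℝ} (hz : z = (-(3 * n) - 1 / 2 : ℝ) + y * I) :
    ∑ j ∈ Finset.Icc 1 (3 * n), Real.log ‖z + j‖ = logSum (3 * n) y := by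
  rw [logSum, ← Finset.sum_range_reflect, Finset.range_eq_Ico,
    ← Finset.Ico_add_one_right_eq_Icc]
  have h := Finset.sum_Ico_add' (fun j : ℕ => Real.log ‖z + j‖) 0 (3 * n) 1
  rw [zero_add] at h
  rw [← h]
  refine Finset.sum_congr rfl fun l hl => ?_
  have hl' := (Finset.mem_Ico.1 hl).2
  have h1 : ((3 * n - 1 - l : ℕ) : ℝ) + 1 / 2 = 3 * n - 1 / 2 - l := by
    rw [Nat.cast_sub (by omega), Nat.cast_sub (by omega)]
    push_cast
    ring
  rw [h1, hz, ← neg_sq (3 * n - 1 / 2 - l : ℝ), ← log_norm_add_mul_I]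
  congr 2
  push_cast
  ring

lemma log_norm_prod_add {z : ℂ} (s : Finset ℕ) (h : ∀ j : ℕ, z + j ≠ 0) :
    Real.log ‖∏ j ∈ s, (z + j)‖ = ∑ j ∈ s, Real.log ‖z + j‖ := by
  rw [norm_prod, Real.log_prod fun j _ => norm_ne_zero_iff.2 (h j)]

lemma lineFun_eq_prod {n : ℕ} {y : ℝ} {z : ℂ} (hz : z = (-(3 * n) - 1 / 2 : ℝ) + y * I)
    (h : ∀ j : ℕ, z + j ≠ 0) :
    lineFun n y = normConst n * ((85 * n + 1 : ℝ) + (2 * y : ℝ) * I) *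
      ((∏ a ∈ Finset.Icc 1 (3 * n), (z + a)) *
        (∏ a ∈ Finset.Icc (3 * n + 0 + 1) (3 * n + (24 * n + 1)), (z + a)) *
      ∏ b ∈ Finset.Icc (3 * n + 61 * n + 1) (3 * n + (88 * n + 1)), (z + b)) ^ 3 *
      ∏ i ∈ Finset.range 10,
        (∏ j ∈ Finset.Icc (3 * n + (26 + i) * n + 1) (3 * n + ((59 - i) * n + 1)), (z + j))⁻¹ := by
  have h1 : (∏ a ∈ Finset.Icc 1 (3 * n), (z + a)) *
      (∏ a ∈ Finset.Icc (3 * n + 0 + 1) (3 * n + (24 * n + 1)), (z + a)) =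
      ∏ a ∈ Finset.Icc 1 (27 * n + 1), (z + a) := by
    have e1 : Finset.Icc 1 (3 * n) = Finset.Ioc 0 (3 * n) := rfl
    have e2 : Finset.Icc (3 * n + 0 + 1) (3 * n + (24 * n + 1)) =
        Finset.Ioc (3 * n) (27 * n + 1) := by
      ext j
      simp only [Finset.mem_Icc, Finset.mem_Ioc]
      omega
    have e3 : Finset.Icc 1 (27 * n + 1) = Finset.Ioc 0 (27 * n + 1) := rfl
    rw [e1, e2, e3]
    exact Finset.prod_Ioc_consecutive _ (by omega) (by omega)
  have h2 : ∀ i ∈ Finset.range 10,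
      (∏ j ∈ poles n \ poleBlock n i, (z + j)) * ∏ j ∈ poles n, (z + j)⁻¹ =
      (∏ j ∈ Finset.Icc (3 * n + (26 + i) * n + 1) (3 * n + ((59 - i) * n + 1)), (z + j))⁻¹ := by
    intro i hi
    have hi' := Finset.mem_range.1 hi
    have e : Finset.Icc (3 * n + (26 + i) * n + 1) (3 * n + ((59 - i) * n + 1)) =
        poleBlock n i := by
      rw [poleBlock]
      congr 1
      · ring
      · rw [show 62 - i = 3 + (59 - i) by omega]
        ring
    have hsub : poleBlock n i ⊆ poles n := by
      refine Finset.Icc_subset_Icc ?_ ?_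
      · gcongr
        omega
      · gcongr
        omega
    rw [e, ← Finset.prod_sdiff hsub, Finset.prod_inv_distrib, Finset.prod_inv_distrib, ← mul_assoc,
      mul_inv_cancel₀ (Finset.prod_ne_zero_iff.2 fun j _ => h j), one_mul]
  have h3 : ∏ j ∈ poles n, ((z + j)⁻¹) ^ 10 =
      ∏ i ∈ Finset.range 10, ∏ j ∈ poles n, (z + j)⁻¹ := by
    rw [Finset.prod_const, Finset.card_range, Finset.prod_pow]
  have h4 : Polynomial.aeval z (numPoly n) = normConst n * (2 * z + (91 * n + 2 : ℕ)) *
      ((∏ a ∈ Finset.Icc 1 (27 * n + 1), (z + a)) *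
        ∏ b ∈ Finset.Icc (64 * n + 1) (91 * n + 1), (z + b)) ^ 3 *
      ∏ i ∈ Finset.range 10, ∏ j ∈ poles n \ poleBlock n i, (z + j) := by
    simp [numPoly, map_prod]
  rw [lineFun_eq n y hz, h3, h4, h1, mul_assoc, ← Finset.prod_mul_distrib,
    Finset.prod_congr rfl h2]
  have h5 : (2 * z + (91 * n + 2 : ℕ)) = ((85 * n + 1 : ℝ) + (2 * y : ℝ) * I : ℂ) := by
    rw [hz]
    push_cast
    ring
  have h6 : Finset.Icc (3 * n + 61 * n + 1) (3 * n + (88 * n + 1)) =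
      Finset.Icc (64 * n + 1) (91 * n + 1) := by
    congr 1 <;> ring
  rw [h5, h6]

lemma log_norm_lineFun (n : ℕ) (y : ℝ) :
    Real.log ‖lineFun n y‖ = Real.log (normConst n : ℝ) +
      Real.log ((85 * n + 1) ^ 2 + (2 * y) ^ 2) / 2 +
      3 * (logSum (3 * n) y + logSum (24 * n + 1) y +
        (logSum (88 * n + 1) y - logSum (61 * n) y)) -
      ∑ i ∈ Finset.range 10, (logSum ((59 - i) * n + 1) y - logSum ((26 + i) * n) y) := by
  obtain ⟨z, hz⟩ : ∃ z : ℂ, z = (-(3 * n) - 1 / 2 : ℝ) + y * I := ⟨_, rfl⟩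
  have h : ∀ j : ℕ, z + j ≠ 0 := fun j => by
    have e : z + j = ((j - 3 * n - 1 / 2 : ℝ) : ℂ) + y * I := by
      rw [hz]
      push_cast
      ring
    rw [e]
    refine add_mul_I_ne_zero (fun h0 => ?_) y
    have h1 : ((2 * j : ℕ) : ℝ) = (6 * n + 1 : ℕ) := by
      push_cast
      linarith
    have h2 : 2 * j = 6 * n + 1 := by exact_mod_cast h1
    omega
  have hp : ∀ s : Finset ℕ, ∏ j ∈ s, (z + j) ≠ 0 := fun s =>
    Finset.prod_ne_zero_iff.2 fun j _ => h j
  have hc : 0 < normConst n := by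
    rw [normConst]
    positivity
  have hlin : ((85 * n + 1 : ℝ) + (2 * y : ℝ) * I : ℂ) ≠ 0 :=
    add_mul_I_ne_zero (by positivity) _
  have hnc : Real.log ‖(normConst n : ℂ)‖ = Real.log (normConst n : ℝ) := by
    rw [Complex.norm_ratCast, abs_of_pos (by exact_mod_cast hc)]
  have hblock : ∀ i ∈ Finset.range 10, ‖(∏ j ∈ Finset.Icc (3 * n + (26 + i) * n + 1)
      (3 * n + ((59 - i) * n + 1)), (z + j))⁻¹‖ ≠ 0 := fun i _ =>
    norm_ne_zero_iff.2 (inv_ne_zero (hp _))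
  rw [lineFun_eq_prod hz h, norm_mul, norm_mul, norm_mul, norm_pow, norm_mul, norm_mul,
    norm_prod (Finset.range 10)]
  rw [Real.log_mul (mul_ne_zero (mul_ne_zero _ _) _) (Finset.prod_ne_zero_iff.2 hblock),
    Real.log_mul, Real.log_mul, Real.log_pow, Real.log_mul, Real.log_mul, Real.log_prod hblock,
    log_norm_add_mul_I, log_norm_prod_add _ h, log_norm_prod_add _ h, log_norm_prod_add _ h,
    sum_log_norm_Icc_left hz, sum_log_norm_Icc hz (p := 0) (by omega),
    sum_log_norm_Icc hz (by omega),
    hnc, sub_eq_add_neg _ (∑ i ∈ Finset.range 10, _), ← Finset.sum_neg_distrib]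
  · congr 1
    · simp only [logSum, Finset.range_zero, Finset.sum_empty, sub_zero]
      push_cast
      ring
    · refine Finset.sum_congr rfl fun i hi => ?_
      have hi' := Finset.mem_range.1 hi
      have hle : (26 + i) * n ≤ (59 - i) * n + 1 :=
        (Nat.mul_le_mul_right _ (by omega)).trans (Nat.le_succ _)
      rw [norm_inv, Real.log_inv, log_norm_prod_add _ h, sum_log_norm_Icc hz hle]
  all_goals simp only [ne_eq, pow_eq_zero_iff, mul_eq_zero, norm_eq_zero, hp, hlin,
    Rat.cast_eq_zero,
    hc.ne', or_self, not_false_eq_true, OfNat.ofNat_ne_zero]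

end

section
open Real

/-- The exponential growth rate in `n` of the rational function at height `n y`. -/
noncomputable def growthRate (y : ℝ) : ℝ :=
  3 * (logPrim 3 y + logPrim 24 y + (logPrim 88 y - logPrim 61 y)) -
    ∑ i ∈ Finset.range 10, (logPrim (59 - i) y - logPrim (26 + i) y) +
    (∑ i ∈ Finset.range 10, ((33 - 2 * i) * log (33 - 2 * i) - (33 - 2 * i)) -
      6 * (27 * log 27 - 27))

/-- The constant term in the expansion of the growth rate. -/
noncomputable def growthConst : ℝ :=
  3 * (3 * log 3 + 24 * log 24 + 88 * log 88 - 61 * log 61) - 162 * log 27 +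
    ∑ i ∈ Finset.range 10, ((33 - 2 * i) * log (33 - 2 * i) -
      ((59 - i) * log (59 - i) - (26 + i) * log (26 + i)))

lemma growthConst_le : growthConst ≤ -334 * log 2 - 231 / 1000 := by
  have h1 : log ((3 ^ 9 * 24 ^ 72 * 88 ^ 264 * 2 ^ 334 * ∏ i ∈ Finset.range 10,
        ((33 - 2 * i) ^ (33 - 2 * i) * (26 + i) ^ (26 + i)) : ℕ) : ℝ) =
      9 * log 3 + 72 * log 24 + 264 * log 88 + 334 * log 2 + ∑ i ∈ Finset.range 10,
        ((33 - 2 * i) * log (33 - 2 * i) + (26 + i) * log (26 + i)) := by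
    have hne : ∀ i ∈ Finset.range 10, ((33 - 2 * i : ℕ) : ℝ) ^ (33 - 2 * i) *
        (26 + i : ℝ) ^ (26 + i) ≠ 0 := fun i hi => by
      have : 0 < 33 - 2 * i := by have := Finset.mem_range.1 hi; omega
      positivity
    simp only [Nat.cast_mul, Nat.cast_pow, Nat.cast_prod, Nat.cast_ofNat, Nat.cast_add]
    rw [log_mul (by positivity) (Finset.prod_ne_zero_iff.2 hne), log_mul (by positivity)
      (by positivity), log_mul (by positivity) (by positivity),
      log_mul (by positivity) (by positivity), log_pow, log_pow, log_pow, log_pow, log_prod hne]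
    simp only [Nat.cast_ofNat]
    congr 1
    refine Finset.sum_congr rfl fun i hi => ?_
    have hi' := Finset.mem_range.1 hi
    rw [log_mul (left_ne_zero_of_mul (hne i hi)) (by positivity), log_pow, log_pow,
      Nat.cast_sub (by omega)]
    push_cast
    rfl
  have h2 : log ((61 ^ 183 * 27 ^ 162 * ∏ i ∈ Finset.range 10,
        (59 - i) ^ (59 - i) : ℕ) : ℝ) =
      183 * log 61 + 162 * log 27 + ∑ i ∈ Finset.range 10, (59 - i) * log (59 - i) := by
    have hne : ∀ i ∈ Finset.range 10, ((59 - i : ℕ) : ℝ) ^ (59 - i) ≠ 0 := fun i hi => by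
      have : 0 < 59 - i := by have := Finset.mem_range.1 hi; omega
      positivity
    simp only [Nat.cast_mul, Nat.cast_pow, Nat.cast_prod, Nat.cast_ofNat]
    rw [log_mul (by positivity) (Finset.prod_ne_zero_iff.2 hne), log_mul (by positivity)
      (by positivity), log_pow, log_pow, log_prod hne]
    simp only [Nat.cast_ofNat]
    congr 1
    refine Finset.sum_congr rfl fun i hi => ?_
    have hi' := Finset.mem_range.1 hi
    rw [log_pow, Nat.cast_sub (by omega)]
    push_cast
    rfl
  obtain ⟨M, hM⟩ : ∃ M : ℕ, M = 3 ^ 9 * 24 ^ 72 * 88 ^ 264 * 2 ^ 334 * ∏ i ∈ Finset.range 10,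
    ((33 - 2 * i) ^ (33 - 2 * i) * (26 + i) ^ (26 + i)) := ⟨_, rfl⟩
  obtain ⟨D, hD⟩ : ∃ D : ℕ, D = 61 ^ 183 * 27 ^ 162 * ∏ i ∈ Finset.range 10,
    (59 - i) ^ (59 - i) := ⟨_, rfl⟩
  have h3 : 1000 * M ≤ 769 * D := by
    rw [hM, hD]
    decide +kernel
  have hM0 : 0 < M := by
    rw [hM]
    decide +kernel
  rw [← hM] at h1
  rw [← hD] at h2
  have hMr : (0 : ℝ) < M := by exact_mod_cast hM0
  have h3' : (1000 : ℝ) * M ≤ 769 * D := by exact_mod_cast h3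
  have hDr : (0 : ℝ) < D := by linarith
  have h4 : log M - log D ≤ -231 / 1000 := by
    rw [← log_div hMr.ne' hDr.ne']
    have h5 := log_le_sub_one_of_pos (show (0 : ℝ) < M / D by positivity)
    have h6 : (M : ℝ) / D ≤ 769 / 1000 := by
      rw [div_le_iff₀ hDr]
      linarith
    linarith
  rw [h1, h2] at h4
  rw [Finset.sum_add_distrib] at h4
  rw [growthConst]
  simp only [Finset.sum_sub_distrib] at h4 ⊢
  linarith

lemma growthRate_eq {y : ℝ} (hy : 0 < y) : growthRate y = growthConst + 3 * π * y -
    3 * logDefect 3 y - 3 * logDefect 24 y - 3 * logDefect 88 y + 3 * logDefect 61 y +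
    ∑ i ∈ Finset.range 10, (logDefect (59 - i) y - logDefect (26 + i) y) := by
  have h1 : ∑ i ∈ Finset.range 10, (logPrim (59 - i) y - logPrim (26 + i) y) =
      ∑ i ∈ Finset.range 10, (((59 - i) * log (59 - i) - (26 + i) * log (26 + i)) -
        (33 - 2 * i) - (logDefect (59 - i) y - logDefect (26 + i) y)) := by
    refine Finset.sum_congr rfl fun i hi => ?_
    have hi' : (i : ℝ) < 10 := by exact_mod_cast Finset.mem_range.1 hi
    rw [logPrim_eq (by linarith) hy, logPrim_eq (by positivity) hy]
    ring
  rw [growthRate, h1, growthConst, logPrim_eq (by norm_num) hy, logPrim_eq (by norm_num) hy,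
    logPrim_eq (by norm_num) hy, logPrim_eq (by norm_num) hy]
  simp only [Finset.sum_sub_distrib]
  ring

lemma growthRate_le_of_le {y : ℝ} (hy : 0 < y) (hy' : y ≤ 20) :
    growthRate y ≤ -(2271 / 10) + 627 / 100 * y := by
  have h3 := logDefect_tangent (s := 3) (by norm_num) y
  have h24 := le_logDefect (s := 24) (by norm_num) hy.le
  have h88 := le_logDefect (s := 88) (by norm_num) hy.le
  have h61 := logDefect_le (s := 61) (by norm_num) hy.le
  have hs : ∑ i ∈ Finset.range 10, (logDefect (59 - i) y - logDefect (26 + i) y) ≤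
      ∑ i ∈ Finset.range 10, (y ^ 2 / (2 * (59 - i)) -
        (y ^ 2 / (2 * (26 + i)) - y ^ 4 / (12 * (26 + i) ^ 3))) := by
    refine Finset.sum_le_sum fun i hi => ?_
    have hi' : (i : ℝ) < 10 := by exact_mod_cast Finset.mem_range.1 hi
    exact sub_le_sub (logDefect_le (by linarith) hy.le) (le_logDefect (by positivity) hy.le)
  have h4 : y ^ 4 ≤ 400 * y ^ 2 := by
    have : y ^ 2 ≤ 400 := by nlinarith
    nlinarith [sq_nonneg y]
  have hp := pi_lt_d4
  have hpy := mul_le_mul_of_nonneg_right hp.le hy.le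
  have hC := growthConst_le
  have hl1 := log_two_gt_d9
  have hl2 := log_two_lt_d9
  rw [growthRate_eq hy]
  simp only [Finset.sum_range_succ, Finset.sum_range_zero] at hs
  norm_num at hs h24 h88 h61 hp hpy
  have h5 : 0.7986 * y - 0.1086 * y ^ 2 ≤ 1.47 := by nlinarith [sq_nonneg (y - 3.68)]
  simp only [Finset.sum_range_succ, Finset.sum_range_zero]
  norm_num
  nlinarith

lemma growthRate_le_of_ge {y : ℝ} (hy : 20 ≤ y) :
    growthRate y ≤ -(2271 / 10) + 627 / 100 * y := by
  have hy0 : 0 < y := by linarith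
  have h3 := logDefect_tangent (s := 3) (by norm_num) y
  have h24 := logDefect_tangent (s := 24) (by norm_num) y
  have h61 := (logDefect_sub_bounds (s := 61) (t := 88) (by norm_num) (by norm_num) y).2
  have hs : ∑ i ∈ Finset.range 10, (logDefect (59 - i) y - logDefect (26 + i) y) ≤
      ∑ i ∈ Finset.range 10, (-((33 - 2 * i) * (log (1 + (y / 61) ^ 2) / 2))) := by
    refine Finset.sum_le_sum fun i hi => ?_
    have hi' : (i : ℝ) ≤ 9 := by exact_mod_cast Nat.le_of_lt_succ (Finset.mem_range.1 hi)
    have h := (logDefect_sub_bounds (s := 26 + i) (t := 59 - i) (by positivity)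
      (by linarith) y).1
    have hlog : log (1 + (y / 61) ^ 2) ≤ log (1 + (y / (59 - i)) ^ 2) := by
      refine log_le_log (by positivity) ?_
      have : (0 : ℝ) ≤ i := i.cast_nonneg
      have h0 : (0 : ℝ) < 59 - i := by linarith
      gcongr
      linarith
    have h2 := mul_le_mul_of_nonneg_left hlog (show (0 : ℝ) ≤ 33 - 2 * i by linarith)
    have h3 : (59 - i - (26 + i) : ℝ) = 33 - 2 * i := by ring
    rw [h3] at h
    linarith
  have hL : 0 ≤ log (1 + (y / 61) ^ 2) := log_nonneg (by nlinarith [sq_nonneg (y / 61)])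
  have hp := pi_lt_d4
  have hpy := mul_le_mul_of_nonneg_right hp.le hy0.le
  have hC := growthConst_le
  have hl1 := log_two_gt_d9
  have hl2 := log_two_lt_d9
  rw [growthRate_eq hy0]
  simp only [Finset.sum_range_succ, Finset.sum_range_zero] at hs
  norm_num at hs h61 hp hpy
  simp only [Finset.sum_range_succ, Finset.sum_range_zero]
  norm_num
  nlinarith

lemma growthRate_le {y : ℝ} (hy : 0 < y) : growthRate y ≤ -(2271 / 10) + 627 / 100 * y :=
  (le_total y 20).elim (growthRate_le_of_le hy) growthRate_le_of_ge

end

section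
open Real

lemma log_normConst_le {n : ℕ} (hn : 0 < n) {T : ℝ} (hT : 33 * n + 1 ≤ T) :
    log (normConst n : ℝ) ≤ n * (∑ i ∈ Finset.range 10, ((33 - 2 * i) * log (33 - 2 * i) -
      (33 - 2 * i)) - 6 * (27 * log 27 - 27)) + 78 * (n * log n) + 10 * (log T + 1) := by
  have hn0 : (0 : ℝ) < n := by exact_mod_cast hn
  have hf (m : ℕ) : (m.factorial : ℝ) ≠ 0 := by positivity
  have h1 : log (normConst n : ℝ) = ∑ i ∈ Finset.range 10,
      log (((33 - 2 * i) * n).factorial : ℝ) - 6 * log ((27 * n).factorial : ℝ) := by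
    rw [normConst]
    push_cast
    rw [log_div (Finset.prod_ne_zero_iff.2 fun i _ => hf _) (pow_ne_zero _ (hf _)),
      log_prod fun i _ => hf _, log_pow]
    norm_num
  have h2 : ∑ i ∈ Finset.range 10, log (((33 - 2 * i) * n).factorial : ℝ) ≤
      ∑ i ∈ Finset.range 10, (n * ((33 - 2 * i) * log (33 - 2 * i) - (33 - 2 * i)) +
        (33 - 2 * i) * (n * log n) + (log T + 1)) := by
    refine Finset.sum_le_sum fun i hi => ?_
    have hi' := Finset.mem_range.1 hi
    have hir : (i : ℝ) ≤ 9 := by exact_mod_cast Nat.le_of_lt_succ hi'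
    have hc : (((33 - 2 * i) * n : ℕ) : ℝ) = (33 - 2 * i) * n := by
      rw [Nat.cast_mul, Nat.cast_sub (by omega)]
      push_cast
      rfl
    have h := log_factorial_le' (m := (33 - 2 * i) * n) (T := T)
      (Nat.mul_pos (by omega) hn) (by
        rw [hc]
        nlinarith [(i.cast_nonneg : (0 : ℝ) ≤ i)])
    rw [hc, log_mul (by linarith) hn0.ne'] at h
    linarith
  have h3 := le_log_factorial (m := 27 * n) (by omega)
  rw [Nat.cast_mul, Nat.cast_ofNat, log_mul (by norm_num) hn0.ne'] at h3
  have h4 : ∑ i ∈ Finset.range 10, (33 - 2 * i : ℝ) * (n * log n) = 240 * (n * log n) := by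
    rw [← Finset.sum_mul]
    congr 1
    simp only [Finset.sum_range_succ, Finset.sum_range_zero]
    norm_num
  rw [Finset.sum_add_distrib, Finset.sum_add_distrib, h4, ← Finset.mul_sum, Finset.sum_const,
    Finset.card_range, nsmul_eq_mul] at h2
  push_cast at h2
  rw [h1]
  linarith

lemma log_norm_lineFun_le {n : ℕ} (hn : 0 < n) {y T : ℝ} (hy : 0 < y)
    (hT : 100 * (n + 1) + 2 * (y * n) ≤ T) :
    log ‖lineFun n (y * n)‖ ≤ n * growthRate y + (49 * log T + 52) := by
  have hn0 : (0 : ℝ) < n := by exact_mod_cast hn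
  have hyn : 0 < y * n := mul_pos hy hn0
  have h0 := log_normConst_le hn (T := T) (by linarith)
  have h1 := half_log_sq_add_sq_le (s := 85 * n + 1) (y := 2 * (y * n)) (T := T) (by positivity)
    (by positivity) (by linarith)
  have h2 := logSum_le hyn (N := 3 * n) (T := T) (by push_cast; linarith)
  have h3 := logSum_succ_le hyn (N := 24 * n) (T := T) (by push_cast; linarith)
  have h4 := logSum_succ_le hyn (N := 88 * n) (T := T) (by push_cast; linarith)
  have h5 := le_logSum hyn (N := 61 * n) (T := T) (by push_cast; linarith)
  rw [Nat.cast_mul, Nat.cast_ofNat, logPrim_mul hn0 hy] at h2 h3 h4 h5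
  have h6 : ∑ i ∈ Finset.range 10, (n * (logPrim (59 - i) y - logPrim (26 + i) y) +
      (33 - 2 * i) * (n * log n) - (2 * log T + 3)) ≤
      ∑ i ∈ Finset.range 10, (logSum ((59 - i) * n + 1) (y * n) -
        logSum ((26 + i) * n) (y * n)) := by
    refine Finset.sum_le_sum fun i hi => ?_
    have hi' := Finset.mem_range.1 hi
    have hir : (i : ℝ) ≤ 9 := by exact_mod_cast Nat.le_of_lt_succ hi'
    have hi0 : (0 : ℝ) ≤ i := i.cast_nonneg
    have hc : (((59 - i) * n : ℕ) : ℝ) = (59 - i) * n := by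
      rw [Nat.cast_mul, Nat.cast_sub (by omega)]
      push_cast
      rfl
    have hc' : (((26 + i) * n : ℕ) : ℝ) = (26 + i) * n := by push_cast; rfl
    have e1 := le_logSum_succ hyn (N := (59 - i) * n) (T := T) (by
      rw [hc]
      nlinarith)
    have e2 := logSum_le hyn (N := (26 + i) * n) (T := T) (by
      rw [hc']
      nlinarith)
    rw [hc, logPrim_mul hn0 hy] at e1
    rw [hc', logPrim_mul hn0 hy] at e2
    linarith
  have h7 : ∑ i ∈ Finset.range 10, (33 - 2 * i : ℝ) * (n * log n) = 240 * (n * log n) := by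
    rw [← Finset.sum_mul]
    congr 1
    simp only [Finset.sum_range_succ, Finset.sum_range_zero]
    norm_num
  rw [Finset.sum_sub_distrib, Finset.sum_add_distrib, h7, ← Finset.mul_sum, Finset.sum_const,
    Finset.card_range, nsmul_eq_mul] at h6
  push_cast at h6
  rw [log_norm_lineFun, growthRate]
  linarith

lemma one_add_pow_mul_exp_le (m : ℕ) {y : ℝ} (hy : 0 ≤ y) :
    (1 + y) ^ m * exp (-(1 / 100) * y) ≤ m.factorial * 100 ^ m * exp (1 / 100) := by
  have h := pow_div_factorial_le_exp ((1 + y) / 100) (by positivity) m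
  rw [div_pow, div_div, div_le_iff₀ (by positivity)] at h
  calc (1 + y) ^ m * exp (-(1 / 100) * y)
      ≤ exp ((1 + y) / 100) * (100 ^ m * m.factorial) * exp (-(1 / 100) * y) := by gcongr
    _ = m.factorial * 100 ^ m * (exp ((1 + y) / 100) * exp (-(1 / 100) * y)) := by ring
    _ = _ := by
      rw [← exp_add]
      congr 2
      ring

lemma lineFun_abs (n : ℕ) (y : ℝ) : ‖lineFun n |y|‖ = ‖lineFun n y‖ := by
  rcases abs_choice y with h | h
  · rw [h]
  · rw [h, ← Complex.norm_conj (lineFun n y)]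
    congr 1
    rw [lineFun, lineFun, map_sum]
    refine Finset.sum_congr rfl fun x _ => ?_
    rw [map_mul, map_pow, map_inv₀, map_add, map_mul, Complex.conj_ofReal, Complex.conj_ofReal,
      Complex.conj_I, map_ratCast]
    push_cast
    ring_nf

lemma exists_norm_lineFun_mul_exp_le : ∃ C : ℝ, ∀ n : ℕ, 0 < n → ∀ y : ℝ, 0 < y →
    ‖lineFun n y‖ * exp (-2 * π * y) ≤
      C * (n + 1) ^ 49 * exp (-(2271 / 10) * n) * (1 + y ^ 2)⁻¹ := by
  obtain ⟨c, hc⟩ : ∃ c : ℝ, ∀ y : ℝ, 0 ≤ y → (1 + y) ^ 51 * exp (-(1 / 100) * y) ≤ c :=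
    ⟨_, fun y hy => one_add_pow_mul_exp_le 51 hy⟩
  refine ⟨100 ^ 49 * exp 52 * c, fun n hn y hy => ?_⟩
  have hn0 : (0 : ℝ) < n := by exact_mod_cast hn
  have hnn : (1 : ℝ) ≤ n := by exact_mod_cast hn
  obtain ⟨T, hT⟩ : ∃ T : ℝ, T = 100 * (n + 1) * (1 + y) := ⟨_, rfl⟩
  have hT0 : 0 < T := by
    rw [hT]
    positivity
  have h1 := log_norm_lineFun_le hn (div_pos hy hn0) (T := T) (by
    rw [div_mul_cancel₀ _ hn0.ne', hT]
    nlinarith)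
  rw [div_mul_cancel₀ _ hn0.ne'] at h1
  have h2 := mul_le_mul_of_nonneg_left (growthRate_le (div_pos hy hn0)) hn0.le
  rw [show (n : ℝ) * (-(2271 / 10) + 627 / 100 * (y / n)) = -(2271 / 10) * n + 627 / 100 * y by
    field_simp] at h2
  have h3 : ‖lineFun n y‖ ≤ exp (-(2271 / 10) * n + 627 / 100 * y + (49 * log T + 52)) := by
    rcases (norm_nonneg (lineFun n y)).eq_or_lt with h | h
    · rw [← h]
      positivity
    · rw [← log_le_iff_le_exp h]
      linarith
  have h4 : exp (49 * log T) = T ^ 49 := by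
    rw [← exp_log hT0, ← exp_nat_mul, log_exp]
    norm_num
  have h5 : exp (627 / 100 * y) * exp (-2 * π * y) ≤ exp (-(1 / 100) * y) := by
    rw [← exp_add]
    refine exp_le_exp.2 ?_
    nlinarith [pi_gt_d2]
  have h6 : (1 + y) ^ 49 * exp (-(1 / 100) * y) ≤
      c * (1 + y ^ 2)⁻¹ := by
    rw [← div_eq_mul_inv, le_div_iff₀ (by positivity)]
    refine le_trans ?_ (hc y hy.le)
    have : 1 + y ^ 2 ≤ (1 + y) ^ 2 := by nlinarith
    calc (1 + y) ^ 49 * exp (-(1 / 100) * y) * (1 + y ^ 2)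
        ≤ (1 + y) ^ 49 * exp (-(1 / 100) * y) * (1 + y) ^ 2 := by gcongr
      _ = _ := by ring
  calc ‖lineFun n y‖ * exp (-2 * π * y)
      ≤ exp (-(2271 / 10) * n + 627 / 100 * y + (49 * log T + 52)) * exp (-2 * π * y) := by gcongr
    _ = T ^ 49 * exp 52 * exp (-(2271 / 10) * n) * (exp (627 / 100 * y) * exp (-2 * π * y)) := by
      rw [exp_add, exp_add, exp_add, h4]
      ring
    _ ≤ T ^ 49 * exp 52 * exp (-(2271 / 10) * n) * exp (-(1 / 100) * y) := by gcongr
    _ = 100 ^ 49 * exp 52 * (n + 1) ^ 49 * exp (-(2271 / 10) * n) *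
        ((1 + y) ^ 49 * exp (-(1 / 100) * y)) := by
      rw [hT, mul_pow, mul_pow]
      ac_rfl
    _ ≤ 100 ^ 49 * exp 52 * (n + 1) ^ 49 * exp (-(2271 / 10) * n) * (c * (1 + y ^ 2)⁻¹) := by
      gcongr
    _ = _ := by ac_rfl

lemma eventually_abs_linForm_le :
    ∀ᶠ n : ℕ in Filter.atTop, |linForm n| ≤ exp (-227 * n) := by
  obtain ⟨C, hC⟩ := exists_norm_lineFun_mul_exp_le
  obtain ⟨K, hK⟩ : ∃ K : ℝ, K = 2 * π ^ 3 * C := ⟨_, rfl⟩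
  have hlim : Filter.Tendsto (fun n : ℕ => K * exp (1 / 10) * (((n + 1 : ℕ) : ℝ) ^ 49 *
      exp (-(1 / 10) * ((n + 1 : ℕ) : ℝ)))) Filter.atTop (nhds 0) := by
    have h0 : Filter.Tendsto (fun x : ℝ => x ^ 49 * exp (-(1 / 10) * x)) Filter.atTop (nhds 0) := by
      refine (tendsto_rpow_mul_exp_neg_mul_atTop_nhds_zero (49 : ℕ) (1 / 10) (by norm_num)).congr
        fun x => ?_
      rw [rpow_natCast]
    have h := (h0.comp (tendsto_natCast_atTop_atTop.comp
      (Filter.tendsto_add_atTop_nat 1))).const_mul (K * exp (1 / 10))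
    rw [mul_zero] at h
    exact h
  filter_upwards [hlim.eventually_le_const one_pos, Filter.eventually_gt_atTop 0] with n h hn
  refine (abs_linForm_le hn (B := C * (n + 1) ^ 49 * exp (-(2271 / 10) * n))
    fun y hy => ?_).trans ?_
  · rw [← lineFun_abs, ← sq_abs y]
    exact hC n hn _ (abs_pos.2 hy)
  · have e1 : exp (-(2271 / 10) * n) = exp (1 / 10) * exp (-(1 / 10) * ((n + 1 : ℕ) : ℝ)) *
        exp (-227 * n) := by
      rw [← exp_add, ← exp_add]
      congr 1
      push_cast
      ring
    calc _ = K * exp (1 / 10) * (((n + 1 : ℕ) : ℝ) ^ 49 *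
        exp (-(1 / 10) * ((n + 1 : ℕ) : ℝ))) * exp (-227 * n) := by
          rw [e1, hK]
          push_cast
          ac_rfl
      _ ≤ 1 * exp (-227 * n) := by gcongr
      _ = _ := one_mul _

end

/-- (Zudilin) At least one of the four numbers `ζ(5), ζ(7), ζ(9), ζ(11)`
is irrational. -/
theorem zudilin_one_of_four_irrational :
    Irrational (zetaR 5) ∨ Irrational (zetaR 7) ∨ Irrational (zetaR 9) ∨
    Irrational (zetaR 11) := by
  by_contra! h
  refine not_forall_rational_of_small eventually_abs_linForm_le fun i hi => ?_
  simp only [Irrational, not_not] at h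
  simp only [Finset.mem_insert, Finset.mem_singleton] at hi
  rcases hi with rfl | rfl | rfl | rfl
  exacts [h.1, h.2.1, h.2.2.1, h.2.2.2]
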